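/- Let f : 𝔸 → 𝔸 be a positive twist map that preserves the Lebesgue measure Leb, let ℐ(f) be the union of all f-invariant essential curves in 𝔸, and let U be a bounded connected component of 𝔸 ∖ ℐ(f). Then the set {z ∈ U : the asymptotic torsion Torsion(f,z) exists and is nonzero} has positive Lebesgue measure, and moreover ∫_{⋃_{i∈ℤ} f^i(U)} Torsion(f,z) dLeb(z) < 0. -/

import Mathlib

noncomputable section

open MeasureTheory Set Filter Topology Function

/-- The annulus `𝔸 = (ℝ/ℤ) × ℝ`. -/
abbrev Ann : Type := AddCircle (1 : ℝ) × ℝ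

/-- The plane `ℝ²`, universal cover of the annulus. -/
abbrev Pl : Type := ℝ × ℝ

/-- The covering projection `π : ℝ² → 𝔸`, `π(x,y) = (x + ℤ, y)`. -/
def pr : Pl → Ann := fun p => ((p.1 : AddCircle (1 : ℝ)), p.2)

/-- The vertical vector `v = (0,1)`. -/
def vv : Pl := (0, 1)

/-- Data of a `C¹` diffeomorphism `f` of the annulus, isotopic to the identity,
presented through a lifted isotopy `(Ft t)_{t ∈ [0,1]}` of `C¹` diffeomorphisms of the
plane commuting with the deck transformation, with `Ft 0 = id` and `Ft 1` a lift of `f`,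
whose derivatives depend continuously on `(t, z)`. -/
structure IsotopySetup where
  f : Ann → Ann
  Ft : ℝ → Pl → Pl
  lift_f : ∀ p, pr (Ft 1 p) = f (pr p)
  Ft_zero : Ft 0 = id
  Ft_periodic : ∀ t, ∀ p : Pl, Ft t (p + (1, 0)) = Ft t p + (1, 0)
  Ft_smooth : ∀ t ∈ Icc (0:ℝ) 1, ContDiff ℝ 1 (Ft t)
  Ft_diffeo : ∀ t ∈ Icc (0:ℝ) 1, ∃ G : Pl → Pl, ContDiff ℝ 1 G ∧
      Function.LeftInverse G (Ft t) ∧ Function.RightInverse G (Ft t)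
  Ft_cont : ContinuousOn (fun q : ℝ × Pl => Ft q.1 q.2) (Icc (0:ℝ) 1 ×ˢ univ)
  DFt_cont : ContinuousOn (fun q : ℝ × Pl => fderiv ℝ (Ft q.1) q.2) (Icc (0:ℝ) 1 ×ˢ univ)

namespace IsotopySetup

variable (S : IsotopySetup)

/-- The canonical lift `F : ℝ² → ℝ²` of `f`. -/
def F : Pl → Pl := S.Ft 1

/-- The extended linearized isotopy: for `t ≥ 0`, `D t p` is the derivative at `p` of the
extended isotopy `f_t`, determined by `Df_{n+s} = Df_s ∘ Df^n` for `n ∈ ℕ`, `s ∈ [0,1)`. -/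
def D (t : ℝ) (p : Pl) : Pl →L[ℝ] Pl :=
  (fderiv ℝ (S.Ft (Int.fract t)) (S.F^[⌊t⌋₊] p)).comp (fderiv ℝ (S.F^[⌊t⌋₊]) p)

/-- `S.AngleVar p w n a` : the total angular variation on `[0,n]` of the vector `w ∈ T_{π(p)}𝔸`
under the extended linearized isotopy equals `a`; that is, `a = n·Torsionₙ(f, π(p), w)`.
Here `Θ` is a continuous lift of the angle `≺(v, Df_t(z)w)` (so that the direction of
`Df_t(z)w` is `(−sin(2πΘ(t)), cos(2πΘ(t)))`). -/
def AngleVar (p w : Pl) (n : ℕ) (a : ℝ) : Prop :=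
  ∃ Θ : ℝ → ℝ, ContinuousOn Θ (Icc 0 (n:ℝ)) ∧
    (∀ t ∈ Icc (0:ℝ) (n:ℝ), ∃ r : ℝ, 0 < r ∧
      S.D t p w = r • (-Real.sin (2 * Real.pi * Θ t), Real.cos (2 * Real.pi * Θ t))) ∧
    a = Θ n - Θ 0

/-- `S.TorsionFin p w n τ` : the finite-time torsion `Torsionₙ(f, π(p), w)` equals `τ`. -/
def TorsionFin (p w : Pl) (n : ℕ) (τ : ℝ) : Prop :=
  ∃ a : ℝ, S.AngleVar p w n a ∧ τ = a / n

/-- The asymptotic torsion at the lifted point `p` exists and equals `L`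
(for every choice of nonzero tangent vector `w`). -/
def TorsionLift (p : Pl) (L : ℝ) : Prop :=
  ∀ w : Pl, w ≠ 0 → ∃ a : ℕ → ℝ, (∀ n : ℕ, 1 ≤ n → S.AngleVar p w n (a n)) ∧
    Tendsto (fun n : ℕ => a n / (n : ℝ)) atTop (nhds L)

/-- The asymptotic torsion at `z ∈ 𝔸` exists and equals `L`. -/
def Torsion (z : Ann) (L : ℝ) : Prop :=
  ∃ p : Pl, pr p = z ∧ S.TorsionLift p L

open Classical in
/-- The asymptotic torsion as a function on the annulus (defaulting to `0` where undefined). -/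
def torsionFun (z : Ann) : ℝ :=
  if h : ∃ L, S.Torsion z L then h.choose else 0

/-- The lifted point `p` has conjugate points: `n·Torsionₙ(f,z,v) = −k/2` for some `n,k ≥ 1`. -/
def ConjLift (p : Pl) : Prop :=
  ∃ n k : ℕ, 1 ≤ n ∧ 1 ≤ k ∧ ∃ a : ℝ, S.AngleVar p vv n a ∧ a = -(k : ℝ) / 2

/-- The lifted point `p` has over-conjugate points: `n·Torsionₙ(f,z,v) < −1/2` for some `n ≥ 1`. -/
def OverConjLift (p : Pl) : Prop :=
  ∃ n : ℕ, 1 ≤ n ∧ ∃ a : ℝ, S.AngleVar p vv n a ∧ a < -(1:ℝ) / 2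

/-- The point `z ∈ 𝔸` has conjugate points. -/
def Conj (z : Ann) : Prop := ∃ p : Pl, pr p = z ∧ S.ConjLift p

/-- The point `z ∈ 𝔸` has over-conjugate points. -/
def OverConj (z : Ann) : Prop := ∃ p : Pl, pr p = z ∧ S.OverConjLift p

/-- `f` is a positive twist map: for every `x`, the map `y ↦ p₁(F(x,y))` is an increasing
diffeomorphism of `ℝ` onto `ℝ`. -/
def PosTwist : Prop :=
  ∀ x : ℝ, StrictMono (fun y => (S.F (x, y)).1) ∧
    Function.Surjective (fun y => (S.F (x, y)).1) ∧
    ∀ y : ℝ, 0 < deriv (fun y => (S.F (x, y)).1) y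

/-- `f` has no conjugate points (linearized-dynamics formulation): for every `z ∈ ℝ²` and
`n ≥ 1`, the first component of `DFⁿ(z)(0,1)` does not vanish. -/
def NoConjPts : Prop :=
  ∀ p : Pl, ∀ n : ℕ, 1 ≤ n → ((fderiv ℝ (S.F^[n]) p) (0, 1)).1 ≠ 0

/-- `f` is exact symplectic: it preserves the Lebesgue measure and `F*(y dx) − y dx = dS`
for a `C¹` function `S : ℝ² → ℝ` with `S(x+1,y) = S(x,y)`. -/
def ExactSymplectic : Prop :=
  MeasurePreserving S.f volume volume ∧
  ∃ Sg : Pl → ℝ, ContDiff ℝ 1 Sg ∧ (∀ p : Pl, Sg (p + (1, 0)) = Sg p) ∧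
    ∀ p : Pl,
      fderiv ℝ Sg p (1, 0) = (S.F p).2 * (fderiv ℝ S.F p (1, 0)).1 - p.2 ∧
      fderiv ℝ Sg p (0, 1) = (S.F p).2 * (fderiv ℝ S.F p (0, 1)).1

end IsotopySetup

/-- `γ` is an essential curve of the annulus: a topological embedding of the circle which is
not homotopic to a constant map. -/
def EssentialCurve (γ : C(AddCircle (1:ℝ), Ann)) : Prop :=
  Topology.IsEmbedding γ ∧ ∀ z : Ann, ¬ γ.Homotopic (ContinuousMap.const _ z)

/-- An open subset of the annulus is essential if it contains an essential curve. -/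
def EssentialSet (U : Set Ann) : Prop :=
  ∃ γ : C(AddCircle (1:ℝ), Ann), EssentialCurve γ ∧ range γ ⊆ U

/-- `f` restricted to `U` is `C⁰`-integrable: `U` is the disjoint union of a family of
`f`-invariant images of essential curves. -/
def C0IntegrableOn (f : Ann → Ann) (U : Set Ann) : Prop :=
  ∃ (ι : Type) (γ : ι → C(AddCircle (1:ℝ), Ann)),
    (∀ i, EssentialCurve (γ i) ∧ f '' range (γ i) = range (γ i)) ∧
    (⋃ i, range (γ i)) = U ∧
    Pairwise (Disjoint on fun i => range (γ i))

/-- `ℤ`-iterates of a bijection (negative iterates through the inverse map). -/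
def iterZ {α : Type*} [Nonempty α] (f : α → α) : ℤ → α → α
  | Int.ofNat n => f^[n]
  | Int.negSucc n => (Function.invFun f)^[n + 1]

/-- `ℐ(f)`: the union of all `f`-invariant essential curves. -/
def invCurveUnion (f : Ann → Ann) : Set Ann :=
  ⋃ γ ∈ {γ : C(AddCircle (1:ℝ), Ann) | EssentialCurve γ ∧ f '' range γ = range γ}, range γ



section

/-! ## Part T: angles and planar topology -/

/-- unit vector with angle `θ` (in turns) measured from the vertical -/
def dirv (θ : ℝ) : Pl := (-Real.sin (2 * Real.pi * θ), Real.cos (2 * Real.pi * θ))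

/-- `θ` is an angle of `w` -/
def IsAng (w : Pl) (θ : ℝ) : Prop := ∃ r : ℝ, 0 < r ∧ w = r • dirv θ

lemma continuous_dirv : Continuous dirv := by unfold dirv; fun_prop

lemma dirv_ne (θ : ℝ) : dirv θ ≠ 0 := by
  intro h
  have h1 := congrArg Prod.fst h
  have h2 := congrArg Prod.snd h
  simp only [dirv, Prod.fst_zero, Prod.snd_zero, neg_eq_zero] at h1 h2
  have := Real.sin_sq_add_cos_sq (2 * Real.pi * θ)
  rw [h1, h2] at this; norm_num at this

lemma IsAng.ne {w : Pl} {θ : ℝ} (h : IsAng w θ) : w ≠ 0 := by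
  obtain ⟨r, hr, rfl⟩ := h
  exact smul_ne_zero hr.ne' (dirv_ne θ)

/-- complex number attached to a vector -/
def cx (w : Pl) : ℂ := ⟨w.2, -w.1⟩

lemma continuous_cx : Continuous cx := by
  have : cx = fun w : Pl => (w.2 : ℂ) + ((-w.1 : ℝ) : ℂ) * Complex.I := by
    funext w
    apply Complex.ext <;> simp [cx]
  rw [this]; fun_prop

lemma cx_ne {w : Pl} (h : w ≠ 0) : cx w ≠ 0 := by
  intro h'
  apply h
  have h1 := congrArg Complex.re h'
  have h2 := congrArg Complex.im h'
  simp [cx] at h1 h2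
  exact Prod.ext h2 h1

lemma isAng_of_exp {w : Pl} {L : ℂ} (h : Complex.exp L = cx w) :
    IsAng w (L.im / (2 * Real.pi)) := by
  have h1 := congrArg Complex.re h
  have h2 := congrArg Complex.im h
  rw [Complex.exp_re] at h1
  rw [Complex.exp_im] at h2
  refine ⟨Real.exp L.re, Real.exp_pos _, ?_⟩
  have e : 2 * Real.pi * (L.im / (2 * Real.pi)) = L.im := by
    field_simp
  simp only [dirv, e]
  simp [cx] at h1 h2
  ext
  · simp; linarith
  · simp; linarith

lemma exp_of_isAng {w : Pl} {θ : ℝ} (h : IsAng w θ) :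
    ∃ L : ℂ, Complex.exp L = cx w ∧ L.im = 2 * Real.pi * θ := by
  obtain ⟨r, hr, rfl⟩ := h
  refine ⟨⟨Real.log r, 2 * Real.pi * θ⟩, ?_, rfl⟩
  apply Complex.ext
  · rw [Complex.exp_re]; simp [cx, dirv, Real.exp_log hr]
  · rw [Complex.exp_im]; simp [cx, dirv, Real.exp_log hr]

lemma IsAng.int_diff {w : Pl} {θ θ' : ℝ} (h : IsAng w θ) (h' : IsAng w θ') :
    ∃ k : ℤ, θ' = θ + k := by
  obtain ⟨L, hL, e⟩ := exp_of_isAng h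
  obtain ⟨L', hL', e'⟩ := exp_of_isAng h'
  obtain ⟨n, hn⟩ := Complex.exp_eq_exp_iff_exists_int.1 (hL'.trans hL.symm)
  refine ⟨n, ?_⟩
  have := congrArg Complex.im hn
  simp at this
  rw [e, e'] at this
  have hp := Real.pi_pos
  have : 2 * Real.pi * θ' = 2 * Real.pi * (θ + n) := by linarith
  exact mul_left_cancel₀ (by positivity) this

lemma IsAng.add_int {w : Pl} {θ : ℝ} (h : IsAng w θ) (k : ℤ) : IsAng w (θ + k) := by
  obtain ⟨r, hr, rfl⟩ := h
  refine ⟨r, hr, ?_⟩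
  have : 2 * Real.pi * (θ + k) = 2 * Real.pi * θ + k * (2 * Real.pi) := by ring
  simp only [dirv, this, Real.sin_add_int_mul_two_pi, Real.cos_add_int_mul_two_pi]

lemma dirv_half (θ : ℝ) : dirv (θ + 1/2) = - dirv θ := by
  have : 2 * Real.pi * (θ + 1/2) = 2 * Real.pi * θ + Real.pi := by ring
  simp only [dirv, this, Real.sin_add_pi, Real.cos_add_pi]
  ext <;> simp

lemma IsAng.neg {w : Pl} {θ : ℝ} (h : IsAng w θ) : IsAng (-w) (θ + 1/2) := by
  obtain ⟨r, hr, rfl⟩ := h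
  exact ⟨r, hr, by rw [dirv_half]; simp⟩

lemma IsAng.smul {w : Pl} {θ c : ℝ} (h : IsAng w θ) (hc : 0 < c) : IsAng (c • w) θ := by
  obtain ⟨r, hr, rfl⟩ := h
  exact ⟨c * r, by positivity, by rw [smul_smul]⟩

lemma isAng_dirv (θ : ℝ) : IsAng (dirv θ) θ := ⟨1, one_pos, by simp⟩

lemma exists_isAng {w : Pl} (h : w ≠ 0) : ∃ θ, IsAng w θ :=
  ⟨_, isAng_of_exp (Complex.exp_log (cx_ne h))⟩

/-- global continuous angle, prescribed at a point -/
lemma angle_lift {X : Type*} [TopologicalSpace X] [SimplyConnectedSpace X]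
    [LocallyPathConnectedSpace X] (Φ : X → Pl) (hc : Continuous Φ) (h0 : ∀ x, Φ x ≠ 0)
    (x0 : X) (θ0 : ℝ) (hθ : IsAng (Φ x0) θ0) :
    ∃ Θ : X → ℝ, Continuous Θ ∧ Θ x0 = θ0 ∧ ∀ x, IsAng (Φ x) (Θ x) := by
  obtain ⟨L, hL, e⟩ := exp_of_isAng hθ
  let g : C(X, {z : ℂ // z ≠ 0}) := ⟨fun x => ⟨cx (Φ x), cx_ne (h0 x)⟩,
    (continuous_cx.comp hc).subtype_mk _⟩
  obtain ⟨Λ, ⟨h1, h2⟩, -⟩ := Complex.isCoveringMap_exp.existsUnique_continuousMap_lifts g x0 L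
    (by apply Subtype.ext; simpa [g] using hL)
  refine ⟨fun x => (Λ x).im / (2 * Real.pi), by fun_prop, ?_, ?_⟩
  · simp only [h1, e]; field_simp
  · intro x
    apply isAng_of_exp
    have := congrArg Subtype.val (congrFun h2 x)
    simpa [g] using this

/-- values stay in a forbidden-boundary interval on a preconnected set -/
lemma stay_Ioo {X : Type*} [TopologicalSpace X] {s : Set X} (hs : IsPreconnected s) {g : X → ℝ}
    (hg : ContinuousOn g s) {a b : ℝ} (ha : ∀ x ∈ s, g x ≠ a) (hb : ∀ x ∈ s, g x ≠ b)
    {x0 : X} (hx0 : x0 ∈ s) (h : g x0 ∈ Ioo a b) {x : X} (hx : x ∈ s) : g x ∈ Ioo a b := by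
  have hi := (hs.image g hg).ordConnected
  have m0 : g x0 ∈ g '' s := mem_image_of_mem g hx0
  have m1 : g x ∈ g '' s := mem_image_of_mem g hx
  constructor
  · by_contra hh
    push Not at hh
    have : a ∈ g '' s := hi.out m1 m0 ⟨hh, h.1.le⟩
    obtain ⟨y, hy, e⟩ := this
    exact ha y hy e
  · by_contra hh
    push Not at hh
    have : b ∈ g '' s := hi.out m0 m1 ⟨h.2.le, hh⟩
    obtain ⟨y, hy, e⟩ := this
    exact hb y hy e

/-- two continuous angle functions of the same vector differ by a constant -/
lemma lifts_diff {X : Type*} [TopologicalSpace X] {s : Set X} (hs : IsPreconnected s)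
    {g g' : X → ℝ} (hg : ContinuousOn g s) (hg' : ContinuousOn g' s)
    (h : ∀ x ∈ s, ∃ k : ℤ, g' x = g x + k) {x y : X} (hx : x ∈ s) (hy : y ∈ s) :
    g' x - g x = g' y - g y := by
  obtain ⟨k, hk⟩ := h x hx
  have key : ∀ z ∈ s, ∀ m : ℤ, g' z - g z ≠ m + 1/2 := by
    intro z hz m e
    obtain ⟨j, hj⟩ := h z hz
    rw [hj] at e
    have : (j : ℝ) = m + 1/2 := by linarith
    have h2 : ((2 * j : ℤ) : ℝ) = ((2 * m + 1 : ℤ) : ℝ) := by push_cast; linarith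
    have := Int.cast_injective h2
    omega
  have st := stay_Ioo hs (hg'.sub hg) (a := (k - 1 : ℤ) + 1/2) (b := (k : ℤ) + 1/2)
    (fun z hz => key z hz (k-1)) (fun z hz => key z hz k) hx
    (by rw [Pi.sub_apply, hk]; constructor <;> push_cast <;> linarith) hy
  obtain ⟨j, hj⟩ := h y hy
  rw [Pi.sub_apply, hj] at st
  have h1 : ((k-1:ℤ):ℝ) + 1/2 < j := by linarith [st.1]
  have h2 : (j:ℝ) < k + 1/2 := by linarith [st.2]
  have h3 : (k:ℝ) < j + 1 := by push_cast at h1; linarith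
  have h4 : (j:ℝ) < k + 1 := by linarith
  have : j = k := by
    have a1 : k < j + 1 := by exact_mod_cast h3
    have a2 : j < k + 1 := by exact_mod_cast h4
    omega
  rw [hk, hj, this]; ring

/-! ### reading off signs -/

lemma sgn_aux (θ : ℝ) (k : ℤ) : Real.sin (2 * Real.pi * (θ + k)) = Real.sin (2 * Real.pi * θ) ∧
    Real.cos (2 * Real.pi * (θ + k)) = Real.cos (2 * Real.pi * θ) := by
  have : 2 * Real.pi * (θ + k) = 2 * Real.pi * θ + k * (2 * Real.pi) := by ring
  rw [this, Real.sin_add_int_mul_two_pi, Real.cos_add_int_mul_two_pi]; exact ⟨rfl, rfl⟩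

/-- first coordinate positive and angle within `(-1, 1/2)` up to bounds -/
lemma IsAng.fst_pos {w : Pl} {θ : ℝ} (h : IsAng w θ) (h1 : -(1/2) < θ) (h2 : θ < 0) : 0 < w.1 := by
  obtain ⟨r, hr, rfl⟩ := h
  simp only [dirv, Prod.smul_fst, smul_eq_mul]
  have : Real.sin (2 * Real.pi * θ) < 0 := by
    apply Real.sin_neg_of_neg_of_neg_pi_lt <;> nlinarith [Real.pi_pos]
  nlinarith

lemma IsAng.fst_neg {w : Pl} {θ : ℝ} (h : IsAng w θ) (h1 : 0 < θ) (h2 : θ < 1/2) : w.1 < 0 := by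
  have := IsAng.fst_pos (w := -w) (θ := θ - 1/2)
    (by have := (h.neg).add_int (-1); convert this using 1; push_cast; ring) (by linarith) (by linarith)
  simpa using this

lemma IsAng.fst_zero {w : Pl} {k : ℤ} (h : IsAng w (k/2)) : w.1 = 0 := by
  obtain ⟨r, hr, rfl⟩ := h
  have : 2 * Real.pi * ((k:ℝ)/2) = k * Real.pi := by ring
  simp [dirv, this, Real.sin_int_mul_pi]

lemma IsAng.snd_pos {w : Pl} {θ : ℝ} (h : IsAng w θ) (h1 : -(1/4) < θ) (h2 : θ < 1/4) : 0 < w.2 := by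
  obtain ⟨r, hr, rfl⟩ := h
  simp only [dirv, Prod.smul_snd, smul_eq_mul]
  have : 0 < Real.cos (2 * Real.pi * θ) := by
    apply Real.cos_pos_of_mem_Ioo; constructor <;> nlinarith [Real.pi_pos]
  positivity

lemma IsAng.snd_neg {w : Pl} {θ : ℝ} (h : IsAng w θ) (h1 : 1/4 < θ) (h2 : θ < 3/4) : w.2 < 0 := by
  have := IsAng.snd_pos (w := -w) (θ := θ - 1/2)
    (by have := (h.neg).add_int (-1); convert this using 1; push_cast; ring) (by linarith) (by linarith)
  simpa using this

lemma IsAng.snd_zero {w : Pl} {k : ℤ} (h : IsAng w (1/4 + k/2)) : w.2 = 0 := by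
  obtain ⟨r, hr, rfl⟩ := h
  have : 2 * Real.pi * (1/4 + (k:ℝ)/2) = Real.pi/2 + k * Real.pi := by ring
  simp only [dirv, this, Prod.smul_snd, smul_eq_mul]
  rw [Real.cos_add, Real.cos_pi_div_two, Real.sin_pi_div_two, Real.sin_int_mul_pi]; ring

/-- normal form of an angle -/
lemma IsAng.exists_shift {w : Pl} {θ : ℝ} (_h : IsAng w θ) (c : ℝ) :
    ∃ k : ℤ, c ≤ θ + k ∧ θ + k < c + 1 := by
  refine ⟨⌈c - θ⌉, ?_, ?_⟩
  · linarith [Int.le_ceil (c - θ)]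
  · linarith [Int.ceil_lt_add_one (c - θ)]

/-- first coordinate nonzero: angle avoids half integers -/
lemma IsAng.ne_half {w : Pl} {θ : ℝ} (h : IsAng w θ) (hw : w.1 ≠ 0) (k : ℤ) : θ ≠ k/2 := by
  rintro rfl; exact hw h.fst_zero

lemma IsAng.ne_quarter {w : Pl} {θ : ℝ} (h : IsAng w θ) (hw : w.2 ≠ 0) (k : ℤ) : θ ≠ 1/4 + k/2 := by
  rintro rfl; exact hw h.snd_zero

/-- clamp to the unit interval -/
def cl (t : ℝ) : ℝ := max 0 (min 1 t)
lemma continuous_cl : Continuous cl := by unfold cl; fun_prop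
lemma cl_mem (t : ℝ) : cl t ∈ Icc (0:ℝ) 1 := ⟨le_max_left _ _, max_le zero_le_one (min_le_left _ _)⟩
lemma cl_eq {t : ℝ} (h : t ∈ Icc (0:ℝ) 1) : cl t = t := by
  unfold cl; rw [min_eq_right h.2, max_eq_right h.1]

/-- Poincaré–Miranda for the unit square -/
lemma poincare_miranda (Φ : ℝ × ℝ → Pl) (hc : ContinuousOn Φ (Icc 0 1 ×ˢ Icc 0 1))
    (hl : ∀ t ∈ Icc (0:ℝ) 1, (Φ (0, t)).1 < 0) (hr : ∀ t ∈ Icc (0:ℝ) 1, 0 < (Φ (1, t)).1)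
    (hb : ∀ s ∈ Icc (0:ℝ) 1, 0 < (Φ (s, 0)).2) (ht : ∀ s ∈ Icc (0:ℝ) 1, (Φ (s, 1)).2 < 0) :
    ∃ p ∈ (Icc 0 1 ×ˢ Icc 0 1 : Set (ℝ × ℝ)), Φ p = 0 := by
  by_contra hne
  push Not at hne
  let Ψ : ℝ × ℝ → Pl := fun q => Φ (cl q.1, cl q.2)
  have hΨ : Continuous Ψ := by
    apply hc.comp_continuous
    · exact (continuous_cl.comp continuous_fst).prodMk (continuous_cl.comp continuous_snd)
    · intro q; exact ⟨cl_mem _, cl_mem _⟩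
  have h0 : ∀ q, Ψ q ≠ 0 := fun q => hne _ ⟨cl_mem _, cl_mem _⟩
  have c0 : cl 0 = 0 := cl_eq (by simp)
  have c1 : cl 1 = 1 := cl_eq (by simp)
  obtain ⟨θ, hθ⟩ := exists_isAng (h0 (0,0))
  obtain ⟨k, hk1, hk2⟩ := hθ.exists_shift (-(1/2))
  obtain ⟨Θ, hΘ, e0, hA⟩ := angle_lift Ψ hΨ h0 (0,0) _ (hθ.add_int k)
  have L : ∀ t, (Ψ (0,t)).1 < 0 := fun t => by simp only [Ψ, c0]; exact hl _ (cl_mem _)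
  have R : ∀ t, 0 < (Ψ (1,t)).1 := fun t => by simp only [Ψ, c1]; exact hr _ (cl_mem _)
  have B : ∀ s, 0 < (Ψ (s,0)).2 := fun t => by simp only [Ψ, c0]; exact hb _ (cl_mem _)
  have Tt : ∀ s, (Ψ (s,1)).2 < 0 := fun t => by simp only [Ψ, c1]; exact ht _ (cl_mem _)
  rw [← e0] at hk1 hk2
  have A00 : Θ (0,0) ∈ Ioo (0:ℝ) (1/2) := by
    refine ⟨?_, by linarith⟩
    by_contra hh
    rcases lt_or_eq_of_le (not_lt.1 hh) with h | h
    · rcases lt_or_eq_of_le hk1 with h' | h'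
      · have := (hA (0,0)).fst_pos h' h; linarith [L 0]
      · have := (hA (0,0)).ne_half (L 0).ne (-1); apply this; rw [← h']; norm_num
    · have := (hA (0,0)).ne_half (L 0).ne 0; apply this; rw [h]; norm_num
  have hu : IsPreconnected (univ : Set ℝ) := isPreconnected_univ
  have sL := fun t => stay_Ioo hu (g := fun t => Θ (0,t)) (by fun_prop) (a := 0) (b := 1/2)
    (fun x _ => by simpa using (hA (0,x)).ne_half (L x).ne 0)
    (fun x _ => by simpa using (hA (0,x)).ne_half (L x).ne 1) (mem_univ 0) A00 (mem_univ t)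
  have A00' : Θ (0,0) ∈ Ioo (-(1/4):ℝ) (1/4) := by
    refine ⟨by linarith [A00.1], ?_⟩
    by_contra hh
    rcases lt_or_eq_of_le (not_lt.1 hh) with h | h
    · have := (hA (0,0)).snd_neg h (by linarith [A00.2]); linarith [B 0]
    · have := (hA (0,0)).ne_quarter (B 0).ne' 0; apply this; rw [← h]; norm_num
  have sB := fun t => stay_Ioo hu (g := fun t => Θ (t,0)) (by fun_prop) (a := -(1/4)) (b := 1/4)
    (fun x _ => by have := (hA (x,0)).ne_quarter (B x).ne' (-1); norm_num at this ⊢; exact this)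
    (fun x _ => by simpa using (hA (x,0)).ne_quarter (B x).ne' 0) (mem_univ 0) A00' (mem_univ t)
  have A01 : Θ (0,1) ∈ Ioo (1/4:ℝ) (3/4) := by
    have := sL 1
    refine ⟨?_, by linarith [this.2]⟩
    by_contra hh
    rcases lt_or_eq_of_le (not_lt.1 hh) with h | h
    · have := (hA (0,1)).snd_pos (by linarith [this.1]) h; linarith [Tt 0]
    · have := (hA (0,1)).ne_quarter (Tt 0).ne 0; apply this; rw [h]; norm_num
  have sT := fun t => stay_Ioo hu (g := fun t => Θ (t,1)) (by fun_prop) (a := 1/4) (b := 3/4)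
    (fun x _ => by simpa using (hA (x,1)).ne_quarter (Tt x).ne 0)
    (fun x _ => by have := (hA (x,1)).ne_quarter (Tt x).ne 1; norm_num at this ⊢; exact this)
    (mem_univ 0) A01 (mem_univ t)
  have A11 : Θ (1,1) ∈ Ioo (1/2:ℝ) 1 := by
    have := sT 1
    refine ⟨?_, by linarith [this.2]⟩
    by_contra hh
    rcases lt_or_eq_of_le (not_lt.1 hh) with h | h
    · have := (hA (1,1)).fst_neg (by linarith [this.1]) h; linarith [R 1]
    · have := (hA (1,1)).ne_half (R 1).ne' 1; apply this; rw [h]; norm_num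
  have sR := fun t => stay_Ioo hu (g := fun t => Θ (1,t)) (by fun_prop) (a := 1/2) (b := 1)
    (fun x _ => by have := (hA (1,x)).ne_half (R x).ne' 1; norm_num at this ⊢; exact this)
    (fun x _ => by have := (hA (1,x)).ne_half (R x).ne' 2; norm_num at this ⊢; exact this)
    (mem_univ 1) A11 (mem_univ t)
  have := (sR 0).1
  have := (sB 1).2
  linarith


end

section

/-! ## Part B: angle function of a line-like curve -/

structure LineCurve (γ : ℝ → Pl) : Prop where
  cont : Continuous γ
  bot : Tendsto (fun s => (γ s).1) atBot atBot
  top : Tendsto (fun s => (γ s).1) atTop atTop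
  bdd : ∃ M : ℝ, ∀ s, |(γ s).2| ≤ M

structure IsA (γ : ℝ → Pl) (z : Pl) (a : ℝ → ℝ) : Prop where
  cont : Continuous a
  ang : ∀ s, IsAng (z - γ s) (a s)
  bot : ∀ᶠ s in atBot, a s ∈ Ioo (-(1/2):ℝ) 0

lemma int_zero_of_abs {k : ℤ} (h1 : (-1:ℝ) < k) (h2 : (k:ℝ) < 1) : k = 0 := by
  have a1 : (-1:ℤ) < k := by exact_mod_cast h1
  have a2 : k < 1 := by exact_mod_cast h2
  omega

lemma IsA.unique {γ : ℝ → Pl} {z : Pl} {a b : ℝ → ℝ} (ha : IsA γ z a) (hb : IsA γ z b) : a = b := by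
  obtain ⟨s0, h1, h2⟩ := (ha.bot.and hb.bot).exists
  have key : b s0 - a s0 = 0 := by
    obtain ⟨k, hk⟩ := (ha.ang s0).int_diff (hb.ang s0)
    have : k = 0 := int_zero_of_abs (by linarith [h1.1, h1.2, h2.1, h2.2]) (by linarith [h1.1, h1.2, h2.1, h2.2])
    rw [hk, this]; simp
  funext s
  have := lifts_diff (isPreconnected_univ (α := ℝ)) ha.cont.continuousOn hb.cont.continuousOn
    (fun x _ => (ha.ang x).int_diff (hb.ang x)) (mem_univ s) (mem_univ s0)
  linarith

/-- clamp to a box -/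
def cbx (z0 : Pl) (δ : ℝ) (z : Pl) : Pl :=
  (max (z0.1 - δ) (min (z0.1 + δ) z.1), max (z0.2 - δ) (min (z0.2 + δ) z.2))

lemma continuous_cbx (z0 : Pl) (δ : ℝ) : Continuous (cbx z0 δ) := by unfold cbx; fun_prop

lemma cbx_mem (z0 : Pl) {δ : ℝ} (hδ : 0 ≤ δ) (z : Pl) : cbx z0 δ z ∈ Metric.closedBall z0 δ := by
  rw [Metric.mem_closedBall, Prod.dist_eq, max_le_iff, Real.dist_eq, Real.dist_eq, abs_le, abs_le]
  simp only [cbx]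
  refine ⟨⟨?_, ?_⟩, ?_, ?_⟩
  · linarith [le_max_left (z0.1 - δ) (min (z0.1 + δ) z.1)]
  · have : max (z0.1 - δ) (min (z0.1 + δ) z.1) ≤ z0.1 + δ := max_le (by linarith) (min_le_left _ _)
    linarith
  · linarith [le_max_left (z0.2 - δ) (min (z0.2 + δ) z.2)]
  · have : max (z0.2 - δ) (min (z0.2 + δ) z.2) ≤ z0.2 + δ := max_le (by linarith) (min_le_left _ _)
    linarith

lemma cbx_eq {z0 : Pl} {δ : ℝ} {z : Pl} (h : z ∈ Metric.closedBall z0 δ) : cbx z0 δ z = z := by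
  rw [Metric.mem_closedBall, Prod.dist_eq, max_le_iff, Real.dist_eq, Real.dist_eq, abs_le, abs_le] at h
  obtain ⟨⟨h1, h2⟩, h3, h4⟩ := h
  unfold cbx
  rw [min_eq_right (by linarith), min_eq_right (by linarith), max_eq_right (by linarith),
    max_eq_right (by linarith)]

lemma fst_near {z z0 : Pl} {δ : ℝ} (h : z ∈ Metric.closedBall z0 δ) :
    z0.1 - δ ≤ z.1 ∧ z.1 ≤ z0.1 + δ := by
  rw [Metric.mem_closedBall, Prod.dist_eq, max_le_iff, Real.dist_eq, Real.dist_eq, abs_le, abs_le] at h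
  constructor <;> linarith [h.1.1, h.1.2]

lemma LineCurve.far {γ : ℝ → Pl} (hγ : LineCurve γ) (c : ℝ) :
    ∃ s1 s2 : ℝ, (∀ s ≤ s1, (γ s).1 < c) ∧ (∀ s ≥ s2, c < (γ s).1) := by
  obtain ⟨s1, h1⟩ := (hγ.bot.eventually (eventually_lt_atBot c)).exists_forall_of_atBot
  obtain ⟨s2, h2⟩ := (hγ.top.eventually (eventually_gt_atTop c)).exists_forall_of_atTop
  exact ⟨s1, s2, h1, h2⟩

lemma LineCurve.isClosed {γ : ℝ → Pl} (hγ : LineCurve γ) : IsClosed (range γ) := by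
  rw [← isOpen_compl_iff, Metric.isOpen_iff]
  intro z0 hz0
  obtain ⟨s1, -, h1, -⟩ := hγ.far (z0.1 - 1)
  obtain ⟨-, s2, -, h2⟩ := hγ.far (z0.1 + 1)
  have hc : IsClosed (γ '' Icc s1 s2) := (isCompact_Icc.image hγ.cont).isClosed
  obtain ⟨ε, hε, hb⟩ := Metric.isOpen_iff.1 hc.isOpen_compl z0
    (fun h => hz0 (image_subset_range _ _ h))
  refine ⟨min ε 1, by positivity, ?_⟩
  rintro z hz ⟨s, rfl⟩
  have hf := fst_near (Metric.ball_subset_closedBall (Metric.ball_subset_ball (min_le_right ε 1) hz))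
  refine hb (Metric.ball_subset_ball (min_le_left ε 1) hz) ⟨s, ⟨?_, ?_⟩, rfl⟩
  · by_contra h; push Not at h; linarith [h1 s h.le]
  · by_contra h; push Not at h; linarith [h2 s h.le]

lemma ang_right {w : Pl} {θ : ℝ} (h : IsAng w θ) (hw : 0 < w.1) :
    ∃ k : ℤ, θ + k ∈ Ioo (-(1/2):ℝ) 0 := by
  obtain ⟨k, h1, h2⟩ := h.exists_shift (-(1/2))
  have h' := h.add_int k
  refine ⟨k, ?_, ?_⟩
  · rcases lt_or_eq_of_le h1 with h | h
    · exact h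
    · exact absurd (by rw [← h]; norm_num) (h'.ne_half hw.ne' (-1))
  · by_contra hh
    rcases lt_or_eq_of_le (not_lt.1 hh) with h | h
    · have := h'.fst_neg h (by linarith); linarith
    · exact absurd (by rw [← h]; norm_num) (h'.ne_half hw.ne' 0)

lemma LineCurve.local_lift {γ : ℝ → Pl} (hγ : LineCurve γ) {z0 : Pl} (hz0 : z0 ∉ range γ) :
    ∃ δ > 0, ∃ L : Pl × ℝ → ℝ, Continuous L ∧
      ∀ z ∈ Metric.closedBall z0 δ, z ∉ range γ ∧ IsA γ z (fun s => L (z, s)) := by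
  obtain ⟨ε, hε, hb⟩ := Metric.isOpen_iff.1 hγ.isClosed.isOpen_compl z0 hz0
  set δ := min (ε/2) 1 with hδ
  have hδ0 : 0 < δ := by positivity
  have hball : ∀ z ∈ Metric.closedBall z0 δ, z ∉ range γ := fun z hz =>
    hb (Metric.closedBall_subset_ball (by have := min_le_left (ε/2) 1; linarith) hz)
  let Φ : Pl × ℝ → Pl := fun q => cbx z0 δ q.1 - γ q.2
  have hΦ : Continuous Φ := by
    have := continuous_cbx z0 δ
    have := hγ.cont
    fun_prop
  have hΦ0 : ∀ q, Φ q ≠ 0 := by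
    intro q h
    exact hball _ (cbx_mem z0 hδ0.le q.1) ⟨q.2, (sub_eq_zero.1 h).symm⟩
  obtain ⟨s1, -, h1, -⟩ := hγ.far (z0.1 - δ)
  have hpos : ∀ q : Pl × ℝ, q.2 ≤ s1 → 0 < (Φ q).1 := by
    intro q hq
    have := h1 _ hq
    have := (fst_near (cbx_mem z0 hδ0.le q.1)).1
    simp only [Φ, Prod.fst_sub]; linarith
  obtain ⟨θ, hθ⟩ := exists_isAng (hΦ0 (z0, s1))
  obtain ⟨k, hk⟩ := ang_right hθ (hpos (z0, s1) le_rfl)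
  obtain ⟨L, hL, e, hA⟩ := angle_lift Φ hΦ hΦ0 (z0, s1) _ (hθ.add_int k)
  refine ⟨δ, hδ0, L, hL, fun z hz => ⟨hball z hz, by fun_prop, ?_, ?_⟩⟩
  · intro s
    have := hA (z, s)
    simpa [Φ, cbx_eq hz] using this
  · filter_upwards [eventually_le_atBot s1] with s hs
    refine stay_Ioo (s := (univ : Set Pl) ×ˢ Iic s1) (isPreconnected_univ.prod isPreconnected_Iic)
      hL.continuousOn (x0 := (z0, s1)) (fun x hx => ?_) (fun x hx => ?_) (by simp) (by rw [e]; exact hk)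
      (x := (z, s)) (by simpa using hs)
    · have := (hA x).ne_half (hpos x hx.2).ne' (-1); norm_num at this ⊢; exact this
    · have := (hA x).ne_half (hpos x hx.2).ne' 0; norm_num at this ⊢; exact this

open Classical in
/-- the angle function -/
def Aa (γ : ℝ → Pl) (z : Pl) : ℝ → ℝ := if h : ∃ a, IsA γ z a then h.choose else 0

lemma LineCurve.isA {γ : ℝ → Pl} (hγ : LineCurve γ) {z : Pl} (hz : z ∉ range γ) : IsA γ z (Aa γ z) := by
  have h : ∃ a, IsA γ z a := by
    obtain ⟨δ, hδ, L, hL, h⟩ := hγ.local_lift hz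
    exact ⟨_, (h z (Metric.mem_closedBall_self hδ.le)).2⟩
  unfold Aa; rw [dif_pos h]; exact h.choose_spec

lemma LineCurve.A_cont {γ : ℝ → Pl} (hγ : LineCurve γ) {z0 : Pl} (hz0 : z0 ∉ range γ) (s : ℝ) :
    ContinuousAt (fun z => Aa γ z s) z0 := by
  obtain ⟨δ, hδ, L, hL, h⟩ := hγ.local_lift hz0
  have : (fun z => Aa γ z s) =ᶠ[𝓝 z0] fun z => L (z, s) := by
    filter_upwards [Metric.closedBall_mem_nhds z0 hδ] with z hz
    have := (hγ.isA (h z hz).1).unique (h z hz).2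
    exact congrFun this s
  exact (Continuous.continuousAt (by fun_prop)).congr this.symm

/-- the upper region: limit angle at the right end is `1/4` -/
def UpR (γ : ℝ → Pl) : Set Pl := {z | z ∉ range γ ∧ ∀ᶠ s in atTop, Aa γ z s ∈ Ioo (0:ℝ) (1/2)}

lemma ang_left {w : Pl} {θ : ℝ} (h : IsAng w θ) (hw : w.1 < 0) :
    ∃ k : ℤ, θ + k ∈ Ioo (0:ℝ) (1/2) := by
  obtain ⟨k, hk⟩ := ang_right h.neg (by simpa using hw)
  refine ⟨k + 1, ?_, ?_⟩ <;> push_cast <;> linarith [hk.1, hk.2]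

/-- far to the right the angle stays in one half-unit interval -/
lemma LineCurve.stay_right {γ : ℝ → Pl} (hγ : LineCurve γ) {z : Pl} (hz : z ∉ range γ) {s0 : ℝ}
    (hs0 : ∀ s ≥ s0, z.1 < (γ s).1) (m : ℤ) {s1 : ℝ} (hs1 : s0 ≤ s1)
    (h1 : Aa γ z s1 ∈ Ioo (m:ℝ) (m + 1/2)) {s : ℝ} (hs : s0 ≤ s) :
    Aa γ z s ∈ Ioo (m:ℝ) (m + 1/2) := by
  have hA := hγ.isA hz
  have hn : ∀ s ∈ Ici s0, (z - γ s).1 ≠ 0 := fun s hs => by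
    have := hs0 s hs; simp only [Prod.fst_sub]; linarith
  refine stay_Ioo (s := Ici s0) isPreconnected_Ici hA.cont.continuousOn (fun x hx => ?_)
    (fun x hx => ?_) hs1 h1 hs
  · have := (hA.ang x).ne_half (hn x hx) (2 * m); push_cast at this
    rwa [mul_div_cancel_left₀ _ two_ne_zero] at this
  · have := (hA.ang x).ne_half (hn x hx) (2 * m + 1); push_cast at this
    intro h; apply this; rw [h]; ring

lemma LineCurve.mem_UpR_iff {γ : ℝ → Pl} (hγ : LineCurve γ) {z : Pl} (hz : z ∉ range γ) {s0 : ℝ}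
    (hs0 : ∀ s ≥ s0, z.1 < (γ s).1) : z ∈ UpR γ ↔ Aa γ z s0 ∈ Ioo (0:ℝ) (1/2) := by
  constructor
  · rintro ⟨-, h⟩
    obtain ⟨s1, h1, h2⟩ := (h.and (eventually_ge_atTop s0)).exists
    simpa using hγ.stay_right hz hs0 0 h2 (by simpa using h1) le_rfl
  · intro h
    refine ⟨hz, ?_⟩
    filter_upwards [eventually_ge_atTop s0] with s hs
    simpa using hγ.stay_right hz hs0 0 le_rfl (by simpa using h) hs

lemma LineCurve.isOpen_UpR {γ : ℝ → Pl} (hγ : LineCurve γ) : IsOpen (UpR γ) := by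
  rw [isOpen_iff_mem_nhds]
  intro z0 hz0
  obtain ⟨-, s0, -, h0⟩ := hγ.far (z0.1 + 1)
  have e1 : ∀ᶠ z in 𝓝 z0, z ∉ range γ := hγ.isClosed.isOpen_compl.mem_nhds hz0.1
  have e2 : ∀ᶠ z in 𝓝 z0, z.1 < z0.1 + 1 :=
    (isOpen_Iio.preimage continuous_fst).mem_nhds (by simp)
  have h3 := (hγ.mem_UpR_iff hz0.1 (s0 := s0) (fun s hs => by linarith [h0 s hs])).1 hz0
  have e3 := (hγ.A_cont hz0.1 s0).eventually (isOpen_Ioo.mem_nhds h3)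
  filter_upwards [e1, e2, e3] with z a1 a2 a3
  exact (hγ.mem_UpR_iff a1 (fun s hs => by linarith [h0 s hs])).2 a3

/-- off the curve, membership in `UpR` is locally constant (closedness relative) -/
lemma LineCurve.isOpen_not_UpR {γ : ℝ → Pl} (hγ : LineCurve γ) : IsOpen ((range γ)ᶜ \ UpR γ) := by
  rw [isOpen_iff_mem_nhds]
  rintro z0 ⟨hz0, hz0'⟩
  obtain ⟨-, s0, -, h0⟩ := hγ.far (z0.1 + 1)
  have e1 : ∀ᶠ z in 𝓝 z0, z ∉ range γ := hγ.isClosed.isOpen_compl.mem_nhds hz0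
  have e2 : ∀ᶠ z in 𝓝 z0, z.1 < z0.1 + 1 :=
    (isOpen_Iio.preimage continuous_fst).mem_nhds (by simp)
  rw [hγ.mem_UpR_iff hz0 (s0 := s0) (fun s hs => by linarith [h0 s hs])] at hz0'
  obtain ⟨k, hk⟩ := ang_left ((hγ.isA hz0).ang s0) (by have := h0 s0 le_rfl; simp; linarith)
  have hk' : Aa γ z0 s0 ∈ Ioo (-(k:ℝ)) (-k + 1/2) := ⟨by linarith [hk.1], by linarith [hk.2]⟩
  have hk0 : k ≠ 0 := by rintro rfl; apply hz0'; simpa using hk'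
  have e3 := (hγ.A_cont hz0 s0).eventually (isOpen_Ioo.mem_nhds hk')
  filter_upwards [e1, e2, e3] with z a1 a2 a3
  refine ⟨a1, ?_⟩
  rw [hγ.mem_UpR_iff a1 (s0 := s0) (fun s hs => by linarith [h0 s hs])]
  intro h
  apply hk0
  apply int_zero_of_abs <;> linarith [h.1, h.2, a3.1, a3.2]

lemma LineCurve.A_top {γ : ℝ → Pl} (hγ : LineCurve γ) {z : Pl} (hz : z ∉ range γ)
    (h : ∀ s, (γ s).2 ≤ z.2) (s : ℝ) : Aa γ z s ∈ Ioo (-(1/2):ℝ) (1/2) := by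
  have hA := hγ.isA hz
  obtain ⟨s0, h0⟩ := hA.bot.exists
  refine stay_Ioo isPreconnected_univ hA.cont.continuousOn (fun x _ hx => ?_) (fun x _ hx => ?_)
    (mem_univ s0) ⟨h0.1, by linarith [h0.2]⟩ (mem_univ s)
  · have h1 := (hA.ang x).add_int 1
    have := h1.snd_neg (by rw [hx]; norm_num) (by rw [hx]; norm_num)
    have := h x; simp at *; linarith
  · have := (hA.ang x).snd_neg (by rw [hx]; norm_num) (by rw [hx]; norm_num)
    have := h x; simp at *; linarith

lemma LineCurve.top_mem {γ : ℝ → Pl} (hγ : LineCurve γ) {z : Pl} (hz : z ∉ range γ)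
    (h : ∀ s, Aa γ z s ∈ Ioo (-(1/2):ℝ) (1/2)) : z ∈ UpR γ := by
  obtain ⟨-, s0, -, h0⟩ := hγ.far z.1
  rw [hγ.mem_UpR_iff hz h0]
  obtain ⟨k, hk⟩ := ang_left ((hγ.isA hz).ang s0) (by have := h0 s0 le_rfl; simp; linarith)
  have h1 := h s0
  rcases lt_trichotomy k 0 with h' | h' | h'
  · have : (k:ℝ) ≤ -1 := by exact_mod_cast (by omega : k ≤ -1)
    linarith [hk.1, h1.2]
  · simpa [h'] using hk
  · have : (1:ℝ) ≤ k := by exact_mod_cast h'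
    have hn := ((hγ.isA hz).ang s0).ne_half (by have := h0 s0 le_rfl; simp; linarith) (-1)
    linarith [hk.2, h1.1]

lemma LineCurve.A_bottom {γ : ℝ → Pl} (hγ : LineCurve γ) {z : Pl} (hz : z ∉ range γ)
    (h : ∀ s, z.2 ≤ (γ s).2) (s : ℝ) : Aa γ z s < 0 := by
  have hA := hγ.isA hz
  obtain ⟨s0, h0⟩ := hA.bot.exists
  refine (stay_Ioo isPreconnected_univ hA.cont.continuousOn (a := -1) (b := 0) (fun x _ hx => ?_)
    (fun x _ hx => ?_) (mem_univ s0) ⟨by linarith [h0.1], h0.2⟩ (mem_univ s)).2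
  · have h1 := (hA.ang x).add_int 1
    have := h1.snd_pos (by rw [hx]; norm_num) (by rw [hx]; norm_num)
    have := h x; simp at *; linarith
  · have := (hA.ang x).snd_pos (by rw [hx]; norm_num) (by rw [hx]; norm_num)
    have := h x; simp at *; linarith

lemma LineCurve.bottom_not_mem {γ : ℝ → Pl} (hγ : LineCurve γ) {z : Pl}
    (h : ∀ s, z.2 ≤ (γ s).2) : z ∉ UpR γ := by
  intro hz
  obtain ⟨s, hs⟩ := hz.2.exists
  linarith [hs.1, hγ.A_bottom hz.1 h s]


end

section

/-- abstract positive twist homeomorphisms of the plane with a non-wandering property -/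
structure TH where
  F : Pl ≃ₜ Pl
  per : ∀ p, F (p + (1, 0)) = F p + (1, 0)
  tw : ∀ x, StrictMono fun y => (F (x, y)).1
  tws : ∀ x, Surjective fun y => (F (x, y)).1
  tw' : ∀ x, StrictAnti fun y => (F.symm (x, y)).1
  tws' : ∀ x, Surjective fun y => (F.symm (x, y)).1
  nw : ∀ N : Set Pl, IsOpen N → N.Nonempty → (∃ M : ℝ, ∀ n : ℕ, ∀ p ∈ N, |(F^[n] p).2| ≤ M) →
    ∃ n : ℕ, ∃ k : ℤ, ∃ p ∈ N, F^[n + 1] p - ((k:ℝ), (0:ℝ)) ∈ N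
  nw' : ∀ N : Set Pl, IsOpen N → N.Nonempty → (∃ M : ℝ, ∀ n : ℕ, ∀ p ∈ N, |(F.symm^[n] p).2| ≤ M) →
    ∃ n : ℕ, ∃ k : ℤ, ∃ p ∈ N, F.symm^[n + 1] p - ((k:ℝ), (0:ℝ)) ∈ N

/-- periodicity with integers -/
lemma per_int {F : Pl → Pl} (h : ∀ p, F (p + (1, 0)) = F p + (1, 0)) (p : Pl) (k : ℤ) :
    F (p + ((k:ℝ), 0)) = F p + ((k:ℝ), 0) := by
  induction k using Int.induction_on with
  | zero => simp only [Int.cast_zero]; exact (by simp [Prod.mk_zero_zero])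
  | succ n ih =>
    have e : ((((n:ℤ) + 1 : ℤ) : ℝ), (0:ℝ)) = (((n:ℤ):ℝ), (0:ℝ)) + (1, 0) := by simp
    rw [e, ← add_assoc, h, ih, add_assoc]
  | pred n ih =>
    have e : (((-(n:ℤ) : ℤ) : ℝ), (0:ℝ)) = (((-(n:ℤ) - 1 : ℤ):ℝ), (0:ℝ)) + (1, 0) := by simp
    rw [e, ← add_assoc, h, ← add_assoc] at ih
    exact add_right_cancel ih

namespace TH
variable (T : TH)

lemma symm_per (p : Pl) : T.F.symm (p + (1, 0)) = T.F.symm p + (1, 0) := by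
  apply T.F.injective; rw [T.per]; simp

/-- if two images are on a vertical then the upper one comes from the left -/
lemma up_left {p q : Pl} (h1 : (T.F p).1 = (T.F q).1) (h2 : (T.F p).2 < (T.F q).2) : q.1 < p.1 := by
  have := T.tw' (T.F p).1 h2
  simp only at this
  have e1 : ((T.F p).1, (T.F q).2) = T.F q := by rw [h1]
  have e2 : ((T.F p).1, (T.F p).2) = T.F p := rfl
  rw [e1, e2] at this
  simpa using this

/-- image of two points on a vertical -/
lemma vert {p q : Pl} (h1 : p.1 = q.1) (h2 : p.2 < q.2) : (T.F p).1 < (T.F q).1 := by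
  have := T.tw p.1 h2
  simp only at this
  have e1 : (p.1, q.2) = q := by rw [h1]
  rw [e1] at this; exact this

end TH

lemma dirv_fst_zero_aux {θ : ℝ} (h1 : -(1/2) < θ) (h2 : θ < 0) : 0 < (dirv θ).1 :=
  (isAng_dirv θ).fst_pos h1 h2

lemma dirv_zero : dirv 0 = (0, 1) := by simp [dirv]

lemma dirv_half' : dirv (1/2) = (0, -1) := by
  have := dirv_half 0
  rw [zero_add, dirv_zero] at this; rw [this]; simp

lemma ang_down {w : Pl} {θ : ℝ} (h : IsAng w θ) (k : ℤ) (hθ : θ = 1/2 + k) : w.1 = 0 ∧ w.2 < 0 := by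
  have h' := h.add_int (-k)
  have e : θ + ((-k : ℤ) : ℝ) = 1/2 := by rw [hθ]; push_cast; ring
  rw [e] at h'
  exact ⟨by have := IsAng.fst_zero (k := 1) (w := w) (by simpa using h'); exact this,
    h'.snd_neg (by norm_num) (by norm_num)⟩

lemma ang_up {w : Pl} {θ : ℝ} (h : IsAng w θ) (k : ℤ) (hθ : θ = k) : w.1 = 0 ∧ 0 < w.2 := by
  have h' := h.add_int (-k)
  have e : θ + ((-k : ℤ) : ℝ) = 0 := by rw [hθ]; push_cast; ring
  rw [e] at h'
  exact ⟨by have := IsAng.fst_zero (k := 0) (w := w) (by simpa using h'); exact this,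
    h'.snd_pos (by norm_num) (by norm_num)⟩

/-- the lifted action on directions of pairs of points -/
lemma TH.exists_H (T : TH) : ∃ H : Pl × ℝ × ℝ → ℝ, Continuous H ∧
    (∀ w ρ α, IsAng (T.F (w + Real.exp ρ • dirv α) - T.F w) (H (w, ρ, α))) ∧
    (∀ w ρ α, α ≤ 1/2 → H (w, ρ, α) < 1/2) ∧
    (∀ w ρ α, H (w, ρ, α + 1) = H (w, ρ, α) + 1) ∧
    (∀ w ρ α, -(1/2) ≤ α → α ≤ 0 → H (w, ρ, α) ∈ Ioo (-1:ℝ) 0) ∧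
    (∀ w ρ α, 0 ≤ α → α ≤ 1/2 → H (w, ρ, α) ∈ Ioo (-(1/2):ℝ) (1/2)) := by
  let Φ : Pl × ℝ × ℝ → Pl := fun q => T.F (q.1 + Real.exp q.2.1 • dirv q.2.2) - T.F q.1
  have hΦ : Continuous Φ := by
    have := continuous_dirv
    have := T.F.continuous
    fun_prop
  have h0 : ∀ q, Φ q ≠ 0 := by
    intro q h
    have := T.F.injective (sub_eq_zero.1 h)
    have := (smul_eq_zero.1 (add_eq_left.1 this)).resolve_left (Real.exp_pos _).ne'
    exact dirv_ne _ this
  have hv0 : ∀ w ρ, 0 < (Φ (w, ρ, 0)).1 := by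
    intro w ρ
    have := T.vert (p := w) (q := w + Real.exp ρ • dirv 0) (by simp [dirv_zero])
      (by simp [dirv_zero, Real.exp_pos])
    simp only [Φ, Prod.fst_sub]; linarith
  have hv1 : ∀ w ρ, (Φ (w, ρ, 1/2)).1 < 0 := by
    intro w ρ
    have := T.vert (q := w) (p := w + Real.exp ρ • dirv (1/2)) (by rw [dirv_half']; simp)
      (by rw [dirv_half']; simp [Real.exp_pos])
    simp only [Φ, Prod.fst_sub]; linarith
  have hvm : ∀ w ρ, (Φ (w, ρ, -(1/2))).1 < 0 := by
    intro w ρ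
    have := hv1 w ρ
    have e : dirv (-(1/2)) = dirv (1/2) := by
      have h1 := dirv_half (-(1/2)); have h2 := dirv_half 0
      rw [zero_add] at h2
      rw [show -(1/2:ℝ) + 1/2 = 0 by norm_num] at h1
      rw [h2, h1]; simp
    simp only [Φ] at this ⊢
    rw [e]; exact this
  obtain ⟨θ, hθ⟩ := exists_isAng (h0 (0, 0, 0))
  obtain ⟨k, hk⟩ := ang_right hθ (hv0 0 0)
  obtain ⟨H, hH, e, hA⟩ := angle_lift Φ hΦ h0 (0, 0, 0) _ (hθ.add_int k)
  have H0 : ∀ w ρ, H (w, ρ, 0) ∈ Ioo (-(1/2):ℝ) 0 := by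
    intro w ρ
    refine stay_Ioo (s := (univ : Set (Pl × ℝ))) isPreconnected_univ (g := fun q => H (q.1, q.2, 0))
      (Continuous.continuousOn (by fun_prop)) (fun x _ => ?_) (fun x _ => ?_) (mem_univ (0,0))
      (by simp only; rw [e]; exact hk) (mem_univ (w, ρ))
    · have := (hA (x.1, x.2, 0)).ne_half (hv0 _ _).ne' (-1); norm_num at this ⊢; exact this
    · have := (hA (x.1, x.2, 0)).ne_half (hv0 _ _).ne' 0; norm_num at this ⊢; exact this
  have Hneg : ∀ w ρ α, -(1/2) ≤ α → α ≤ 0 → H (w, ρ, α) ∈ Ioo (-1:ℝ) 0 := by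
    intro w ρ α h1 h2
    have key : ∀ a ∈ Icc (-(1/2):ℝ) 0, ∀ m : ℤ, H (w, ρ, a) ≠ m := by
      intro a ha m hm
      have := ang_up (hA (w, ρ, a)) m hm
      have hl := T.up_left (p := w) (q := w + Real.exp ρ • dirv a)
        (by have := this.1; simp only [Φ, Prod.fst_sub] at this; linarith)
        (by have := this.2; simp only [Φ, Prod.snd_sub] at this; linarith)
      simp only [Prod.fst_add, Prod.smul_fst, smul_eq_mul] at hl
      have hd : (dirv a).1 < 0 := by
        by_contra hh
        have := mul_nonneg (Real.exp_pos ρ).le (not_lt.1 hh)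
        linarith
      rcases eq_or_lt_of_le ha.1 with h | h
      · have h3 := dirv_half (-(1/2))
        rw [show -(1/2:ℝ) + 1/2 = 0 by norm_num, dirv_zero] at h3
        have := congrArg Prod.fst h3
        rw [← h] at hd; simp only [Prod.fst_neg] at this; linarith
      · rcases eq_or_lt_of_le ha.2 with h' | h'
        · rw [h', dirv_zero] at hd; simp at hd
        · linarith [dirv_fst_zero_aux h h']
    refine stay_Ioo (s := Icc (-(1/2):ℝ) 0) isPreconnected_Icc (g := fun a => H (w, ρ, a))
      (Continuous.continuousOn (by fun_prop)) (fun x hx => ?_) (fun x hx => ?_) (x0 := 0)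
      (by simp) ⟨?_, (H0 w ρ).2⟩ ⟨h1, h2⟩
    · simpa using key x hx (-1)
    · simpa using key x hx 0
    · linarith [(H0 w ρ).1]
  have Hpos : ∀ w ρ α, 0 ≤ α → α ≤ 1/2 → H (w, ρ, α) ∈ Ioo (-(1/2):ℝ) (1/2) := by
    intro w ρ α h1 h2
    have key : ∀ a ∈ Icc (0:ℝ) (1/2), ∀ m : ℤ, H (w, ρ, a) ≠ 1/2 + m := by
      intro a ha m hm
      have := ang_down (hA (w, ρ, a)) m hm
      have hl := T.up_left (q := w) (p := w + Real.exp ρ • dirv a)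
        (by have := this.1; simp only [Φ, Prod.fst_sub] at this; linarith)
        (by have := this.2; simp only [Φ, Prod.snd_sub] at this; linarith)
      simp only [Prod.fst_add, Prod.smul_fst, smul_eq_mul] at hl
      have hd : 0 < (dirv a).1 := by
        by_contra hh
        have := mul_nonneg (Real.exp_pos ρ).le (neg_nonneg.2 (not_lt.1 hh))
        linarith
      rcases eq_or_lt_of_le ha.1 with h | h
      · rw [← h, dirv_zero] at hd; simp at hd
      · rcases eq_or_lt_of_le ha.2 with h' | h'
        · rw [h', dirv_half'] at hd; simp at hd
        · linarith [(isAng_dirv a).fst_neg h h']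
    refine stay_Ioo (s := Icc (0:ℝ) (1/2)) isPreconnected_Icc (g := fun a => H (w, ρ, a))
      (Continuous.continuousOn (by fun_prop)) (fun x hx => ?_) (fun x hx => ?_) (x0 := 0)
      (by simp) ⟨(H0 w ρ).1, ?_⟩ ⟨h1, h2⟩
    · have := key x hx (-1); push_cast at this; norm_num at this ⊢; exact this
    · simpa using key x hx 0
    · linarith [(H0 w ρ).2]
  have dper : ∀ α, dirv (α + 1) = dirv α := by
    intro α
    have h1 := dirv_half α
    have h2 := dirv_half (α + 1/2)
    rw [show α + 1/2 + 1/2 = α + 1 by ring] at h2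
    rw [h2, h1, neg_neg]
  have Hper : ∀ w ρ α, H (w, ρ, α + 1) = H (w, ρ, α) + 1 := by
    intro w ρ α
    have hd := fun a => (hA (w, ρ, a)).int_diff (θ' := H (w, ρ, a + 1))
      (by have := hA (w, ρ, a + 1); simp only [Φ] at this ⊢; rwa [dper] at this)
    have := lifts_diff (isPreconnected_univ (α := ℝ)) (g := fun a => H (w, ρ, a))
      (g' := fun a => H (w, ρ, a + 1)) (Continuous.continuousOn (by fun_prop))
      (Continuous.continuousOn (by fun_prop)) (fun x _ => hd x) (mem_univ α) (mem_univ (-(1/2)))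
    obtain ⟨j, hj⟩ := hd (-(1/2))
    have a1 := Hneg w ρ (-(1/2)) (by norm_num) (by norm_num)
    have a2 : H (w, ρ, -(1/2)) < -(1/2) := by
      by_contra hh
      rcases lt_or_eq_of_le (not_lt.1 hh) with h | h
      · have := (hA (w, ρ, -(1/2))).fst_pos h a1.2; linarith [hvm w ρ]
      · have := ang_down (hA (w, ρ, -(1/2))) (-1) (by rw [← h]; norm_num)
        linarith [hvm w ρ, this.1]
    have b1 := Hpos w ρ (1/2) (by norm_num) (by norm_num)
    have b2 : 0 < H (w, ρ, 1/2) := by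
      by_contra hh
      rcases lt_or_eq_of_le (not_lt.1 hh) with h | h
      · have := (hA (w, ρ, 1/2)).fst_pos b1.1 h; linarith [hv1 w ρ]
      · have := ang_up (hA (w, ρ, 1/2)) 0 (by rw [h]; norm_num)
        linarith [hv1 w ρ, this.1]
    rw [show -(1/2:ℝ) + 1 = 1/2 by norm_num] at hj this
    have : j = 1 := by
      have h1 : (0:ℝ) < j := by linarith [a1.1, b2]
      have h2 : (j:ℝ) < 2 := by linarith [a1.1, b1.2]
      have h1' : 0 < j := by exact_mod_cast h1
      have h2' : j < 2 := by exact_mod_cast h2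
      omega
    rw [this] at hj; push_cast at hj; linarith
  have Hperk : ∀ w ρ α, ∀ n : ℕ, H (w, ρ, α + n) = H (w, ρ, α) + n := by
    intro w ρ α n
    induction n with
    | zero => simp
    | succ n ih => push_cast; rw [← add_assoc, Hper, ih]; ring
  refine ⟨H, hH, fun w ρ α => hA (w, ρ, α), ?_, Hper, Hneg, Hpos⟩
  intro w ρ α hα
  obtain ⟨n, hn⟩ : ∃ n : ℕ, α + n ∈ Ioc (-(1/2):ℝ) (1/2) := by
    refine ⟨⌊1/2 - α⌋₊, ?_, ?_⟩
    · linarith [Nat.lt_floor_add_one (1/2 - α)]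
    · linarith [Nat.floor_le (a := 1/2 - α) (by linarith)]
  have h1 : H (w, ρ, α + n) < 1/2 := by
    rcases le_total (α + n) 0 with h | h
    · linarith [(Hneg w ρ _ hn.1.le h).2]
    · exact (Hpos w ρ _ h hn.2).2
  rw [Hperk] at h1
  have : (0:ℝ) ≤ n := Nat.cast_nonneg n
  linarith


end

section

/-- Euclidean norm -/
def nrm (w : Pl) : ℝ := Real.sqrt (w.1 ^ 2 + w.2 ^ 2)

lemma continuous_nrm : Continuous nrm := by unfold nrm; fun_prop

lemma nrm_pos {w : Pl} (h : w ≠ 0) : 0 < nrm w := by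
  apply Real.sqrt_pos.2
  by_contra hh
  apply h
  have h1 : w.1 = 0 := by nlinarith [sq_nonneg w.1, sq_nonneg w.2]
  have h2 : w.2 = 0 := by nlinarith [sq_nonneg w.1, sq_nonneg w.2]
  exact Prod.ext h1 h2

lemma IsAng.eq_exp {w : Pl} {θ : ℝ} (h : IsAng w θ) : w = Real.exp (Real.log (nrm w)) • dirv θ := by
  rw [Real.exp_log (nrm_pos h.ne)]
  obtain ⟨r, hr, rfl⟩ := h
  have : nrm (r • dirv θ) = r := by
    unfold nrm dirv
    simp only [Prod.smul_fst, Prod.smul_snd, smul_eq_mul]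
    have := Real.sin_sq_add_cos_sq (2 * Real.pi * θ)
    rw [show (r * -Real.sin (2 * Real.pi * θ)) ^ 2 + (r * Real.cos (2 * Real.pi * θ)) ^ 2
      = r ^ 2 * (Real.sin (2 * Real.pi * θ) ^ 2 + Real.cos (2 * Real.pi * θ) ^ 2) by ring, this,
      mul_one, Real.sqrt_sq hr.le]
  rw [this]

structure InvCurve (T : TH) (γ : ℝ → Pl) (φ : ℝ → ℝ) : Prop where
  line : LineCurve γ
  per : ∀ (k : ℤ) (s : ℝ), γ (s + k) = γ s + ((k:ℝ), 0)
  conj : ∀ s, T.F (γ s) = γ (φ s)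
  φc : Continuous φ
  φsurj : Surjective φ
  φbot : Tendsto φ atBot atBot
  φtop : Tendsto φ atTop atTop

namespace InvCurve
variable {T : TH} {γ : ℝ → Pl} {φ : ℝ → ℝ}

lemma mem_iff (I : InvCurve T γ φ) (z : Pl) : T.F z ∈ range γ ↔ z ∈ range γ := by
  constructor
  · rintro ⟨s, hs⟩
    obtain ⟨s', rfl⟩ := I.φsurj s
    rw [← I.conj] at hs
    exact ⟨s', T.F.injective hs⟩
  · rintro ⟨s, rfl⟩
    exact ⟨φ s, (I.conj s).symm⟩

lemma transfer (I : InvCurve T γ φ) {H : Pl × ℝ × ℝ → ℝ} (hH : Continuous H)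
    (hA : ∀ w ρ α, IsAng (T.F (w + Real.exp ρ • dirv α) - T.F w) (H (w, ρ, α)))
    (hneg : ∀ w ρ α, -(1/2) ≤ α → α ≤ 0 → H (w, ρ, α) ∈ Ioo (-1:ℝ) 0)
    {z : Pl} (hz : z ∉ range γ) (s : ℝ) :
    Aa γ (T.F z) (φ s) = H (γ s, Real.log (nrm (z - γ s)), Aa γ z s) := by
  have a1 := I.line.isA hz
  have a2 := I.line.isA (mt (I.mem_iff z).1 hz)
  have ang1 : ∀ s, IsAng (T.F z - T.F (γ s)) (Aa γ (T.F z) (φ s)) := by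
    intro s; rw [I.conj]; exact a2.ang (φ s)
  have ang2 : ∀ s, IsAng (T.F z - T.F (γ s)) (H (γ s, Real.log (nrm (z - γ s)), Aa γ z s)) := by
    intro s
    have := hA (γ s) (Real.log (nrm (z - γ s))) (Aa γ z s)
    rw [← (a1.ang s).eq_exp] at this
    simpa using this
  have c1 : Continuous (fun s => Aa γ (T.F z) (φ s)) := a2.cont.comp I.φc
  have c2 : Continuous (fun s => H (γ s, Real.log (nrm (z - γ s)), Aa γ z s)) := by
    have h1 : Continuous fun s => Real.log (nrm (z - γ s)) := by
      apply Continuous.log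
      · exact continuous_nrm.comp (continuous_const.sub I.line.cont)
      · intro s; exact (nrm_pos (a1.ang s).ne).ne'
    exact hH.comp (I.line.cont.prodMk (h1.prodMk a1.cont))
  obtain ⟨s0, h1, h2⟩ := (a1.bot.and (I.φbot.eventually a2.bot)).exists
  have key : H (γ s0, Real.log (nrm (z - γ s0)), Aa γ z s0) - Aa γ (T.F z) (φ s0) = 0 := by
    obtain ⟨k, hk⟩ := (ang1 s0).int_diff (ang2 s0)
    have := hneg (γ s0) (Real.log (nrm (z - γ s0))) (Aa γ z s0) h1.1.le h1.2.le
    have : k = 0 := int_zero_of_abs (by linarith [this.1, this.2, h2.1, h2.2])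
      (by linarith [this.1, this.2, h2.1, h2.2])
    rw [hk, this]; simp
  have := lifts_diff (isPreconnected_univ (α := ℝ)) c1.continuousOn c2.continuousOn
    (fun x _ => (ang1 x).int_diff (ang2 x)) (mem_univ s) (mem_univ s0)
  linarith

/-- consequences of the twist on the angle function -/
lemma tr (I : InvCurve T γ φ) : (∀ z ∉ range γ, ∀ s, Aa γ z s ≤ 1/2 → Aa γ (T.F z) (φ s) < 1/2) ∧
    (∀ z ∉ range γ, ∀ s, Aa γ z s ≤ -(1/2) → Aa γ (T.F z) (φ s) < -(1/2)) ∧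
    (∀ z, T.F z ∈ UpR γ ↔ z ∈ UpR γ) := by
  obtain ⟨H, hH, hA, h1, hp, hneg, hpos⟩ := T.exists_H
  refine ⟨?_, ?_, ?_⟩
  · intro z hz s hs
    rw [I.transfer hH hA hneg hz]; exact h1 _ _ _ hs
  · intro z hz s hs
    rw [I.transfer hH hA hneg hz]
    have := h1 (γ s) (Real.log (nrm (z - γ s))) (Aa γ z s + 1) (by linarith)
    rw [hp] at this; linarith
  · have hperk : ∀ w ρ α, ∀ k : ℤ, H (w, ρ, α + k) = H (w, ρ, α) + k := by
      intro w ρ α k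
      induction k using Int.induction_on with
      | zero => simp
      | succ n ih => push_cast at ih ⊢; rw [← add_assoc, hp, ih]; ring
      | pred n ih =>
        have := hp w ρ (α + ((-(n:ℤ) - 1 : ℤ) : ℝ))
        rw [show α + ((-(n:ℤ) - 1 : ℤ) : ℝ) + 1 = α + ((-(n:ℤ) : ℤ):ℝ) by push_cast; ring, ih] at this
        push_cast at this ⊢; linarith
    intro z
    by_cases hz : z ∈ range γ
    · have h1 := (I.mem_iff z).2 hz
      exact ⟨fun h => absurd h1 h.1, fun h => absurd hz h.1⟩
    have hz' := mt (I.mem_iff z).1 hz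
    obtain ⟨-, s1, -, hs1⟩ := I.line.far z.1
    obtain ⟨-, s2, -, hs2⟩ := I.line.far (T.F z).1
    obtain ⟨s3, hs3⟩ := (I.φtop.eventually (eventually_ge_atTop s2)).exists_forall_of_atTop
    let s0 := max s1 s3
    have g1 : ∀ s ≥ s0, z.1 < (γ s).1 := fun s hs => hs1 s (le_trans (le_max_left _ _) hs)
    have g2 : ∀ s ≥ φ s0, (T.F z).1 < (γ s).1 ∨ s < s2 := fun s hs => by
      rcases le_or_gt s2 s with h | h
      · exact Or.inl (hs2 s h)
      · exact Or.inr h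
    have hφ : s2 ≤ φ s0 := hs3 s0 (le_max_right _ _)
    have g3 : ∀ s ≥ φ s0, (T.F z).1 < (γ s).1 := fun s hs => hs2 s (le_trans hφ hs)
    rw [I.line.mem_UpR_iff hz g1, I.line.mem_UpR_iff hz' g3, I.transfer hH hA hneg hz]
    have hpos2 : ∀ k : ℤ, Aa γ z s0 + k ∈ Ioo (0:ℝ) (1/2) →
        H (γ s0, Real.log (nrm (z - γ s0)), Aa γ z s0) + k ∈ Ioo (0:ℝ) (1/2) := by
      intro k hk
      have h2 := hpos (γ s0) (Real.log (nrm (z - γ s0))) (Aa γ z s0 + k) hk.1.le hk.2.le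
      rw [hperk] at h2
      have h3 := ((I.line.isA hz').ang (φ s0))
      rw [I.transfer hH hA hneg hz] at h3
      obtain ⟨j, hj⟩ := ang_left h3 (by have := g3 _ le_rfl; simp; linarith)
      have hjk : j = k := by
        have : j - k = 0 := by
          apply int_zero_of_abs <;> push_cast
          · linarith [hj.1, hj.2, h2.1, h2.2]
          · linarith [hj.1, hj.2, h2.1, h2.2]
        omega
      rwa [hjk] at hj
    constructor
    · intro h
      obtain ⟨k, hk⟩ := ang_left ((I.line.isA hz).ang s0) (by have := g1 _ le_rfl; simp; linarith)
      have := hpos2 k hk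
      have k0 : k = 0 := int_zero_of_abs (by linarith [this.1, this.2, h.1, h.2])
        (by linarith [this.1, this.2, h.1, h.2])
      simpa [k0] using hk
    · intro h
      simpa using hpos2 0 (by simpa using h)

end InvCurve

/-- visible region -/
def Oo (γ : ℝ → Pl) : Set Pl := {z | z ∉ range γ ∧ ∀ s, Aa γ z s ∈ Ioo (-(1/2):ℝ) (1/2)}

lemma LineCurve.mem_Oo_iff {γ : ℝ → Pl} (hγ : LineCurve γ) (z : Pl) :
    z ∈ Oo γ ↔ ∀ y ≥ z.2, (z.1, y) ∉ range γ := by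
  constructor
  · rintro ⟨hz, h⟩ y hy ⟨s, hs⟩
    have ha := (hγ.isA hz).ang s
    have hw1 : (z - γ s).1 = 0 := by rw [hs]; simp
    have hw2 : (z - γ s).2 ≤ 0 := by rw [hs]; simpa using hy
    have h0 : Aa γ z s = 0 := by
      by_contra hne
      rcases lt_or_gt_of_ne hne with h' | h'
      · linarith [ha.fst_pos (h s).1 h']
      · linarith [ha.fst_neg h' (h s).2]
    have := ha.snd_pos (by rw [h0]; norm_num) (by rw [h0]; norm_num)
    linarith
  · intro h
    have hz : z ∉ range γ := h z.2 le_rfl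
    refine ⟨hz, fun s => ?_⟩
    obtain ⟨M, hM⟩ := hγ.bdd
    have hc : ContinuousOn (fun y => Aa γ (z.1, y) s) (Ici z.2) := by
      intro y hy
      have h1 := hγ.A_cont (h y hy) s
      have h2 : ContinuousAt (fun y : ℝ => (z.1, y)) y := by fun_prop
      exact (ContinuousAt.comp (f := fun y : ℝ => (z.1, y)) (g := fun z => Aa γ z s) h1 h2).continuousWithinAt
    have key : ∀ y ∈ Ici z.2, ∀ k : ℤ, Aa γ (z.1, y) s ≠ 1/2 + k := by
      intro y hy k hk
      have hd := ang_down ((hγ.isA (h y hy)).ang s) k hk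
      simp only [Prod.fst_sub, Prod.snd_sub] at hd
      refine h (γ s).2 (le_trans hy (by linarith [hd.2])) ⟨s, ?_⟩
      ext
      · simp; linarith [hd.1]
      · rfl
    refine stay_Ioo isPreconnected_Ici hc (fun y hy => ?_) (fun y hy => ?_)
      (x0 := max z.2 M) (mem_Ici.2 (le_max_left _ _)) ?_ (mem_Ici.2 (le_refl z.2))
    · have := key y hy (-1); push_cast at this; norm_num at this ⊢; exact this
    · simpa using key y hy 0
    · apply hγ.A_top (h _ (le_max_left _ _))
      intro s
      exact le_trans (le_trans (le_abs_self _) (hM s)) (le_max_right _ _)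

lemma LineCurve.Oo_sub {γ : ℝ → Pl} (hγ : LineCurve γ) : Oo γ ⊆ UpR γ :=
  fun _ hz => hγ.top_mem hz.1 hz.2

lemma LineCurve.isOpen_Oo {γ : ℝ → Pl} (hγ : LineCurve γ) : IsOpen (Oo γ) := by
  rw [isOpen_iff_mem_nhds]
  intro z0 hz0
  rw [hγ.mem_Oo_iff] at hz0
  obtain ⟨s1, -, h1, -⟩ := hγ.far (z0.1 - 1)
  obtain ⟨-, s2, -, h2⟩ := hγ.far (z0.1 + 1)
  -- project the relevant part of the curve with everything below it
  by_contra hcon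
  have : ∃ᶠ z in 𝓝 z0, z ∉ Oo γ := fun h => hcon (by simpa using h)
  have hfr : ∃ᶠ z in 𝓝 z0, ∃ s ∈ Icc s1 s2, (γ s).1 = z.1 ∧ z.2 ≤ (γ s).2 := by
    have e1 : ∀ᶠ z in 𝓝 z0, z0.1 - 1 < z.1 ∧ z.1 < z0.1 + 1 := by
      have : IsOpen {z : Pl | z0.1 - 1 < z.1 ∧ z.1 < z0.1 + 1} :=
        (isOpen_lt continuous_const continuous_fst).inter (isOpen_lt continuous_fst continuous_const)
      exact this.mem_nhds ⟨by linarith, by linarith⟩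
    refine (this.and_eventually e1).mono ?_
    rintro z ⟨hz, hz1, hz2⟩
    rw [hγ.mem_Oo_iff] at hz
    push Not at hz
    obtain ⟨y, hy, s, hs⟩ := hz
    have e : (γ s).1 = z.1 := by rw [hs]
    refine ⟨s, ⟨?_, ?_⟩, e, by rw [hs]; exact hy⟩
    · by_contra h; push Not at h; linarith [h1 s h.le]
    · by_contra h; push Not at h; linarith [h2 s h.le]
  obtain ⟨M, hM⟩ := hγ.bdd
  have hcl : IsClosed {z : Pl | ∃ s ∈ Icc s1 s2, (γ s).1 = z.1 ∧ z.2 ≤ (γ s).2} := by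
    have hS : IsClosed {q : ℝ × Pl | (γ q.1).1 = q.2.1 ∧ q.2.2 ≤ (γ q.1).2} := by
      have := hγ.cont
      exact IsClosed.inter (s₁ := {q : ℝ × Pl | (γ q.1).1 = q.2.1}) (s₂ := {q : ℝ × Pl | q.2.2 ≤ (γ q.1).2})
        (isClosed_eq (by fun_prop) (by fun_prop)) (isClosed_le (by fun_prop) (by fun_prop))
    have hS2 : IsClosed {q : Icc s1 s2 × Pl | (γ q.1).1 = q.2.1 ∧ q.2.2 ≤ (γ q.1).2} :=
      hS.preimage (f := fun q : Icc s1 s2 × Pl => ((q.1 : ℝ), q.2)) (by fun_prop)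
    have := isClosedMap_snd_of_compactSpace (X := Icc s1 s2) (Y := Pl) _ hS2
    convert this using 1
    ext z
    simp
    grind
  have := hcl.closure_eq ▸ (mem_closure_iff_frequently.2 hfr)
  obtain ⟨s, -, e1, e2⟩ := this
  exact hz0 _ e2 ⟨s, by rw [← e1]⟩

namespace InvCurve
variable {T : TH} {γ : ℝ → Pl} {φ : ℝ → ℝ}

lemma range_per (I : InvCurve T γ φ) (z : Pl) (k : ℤ) (hz : z ∉ range γ) : z + ((k:ℝ), 0) ∉ range γ := by
  rintro ⟨s, hs⟩
  apply hz
  refine ⟨s + ((-k : ℤ) : ℝ), ?_⟩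
  rw [I.per, hs]
  ext <;> simp

lemma A_per (I : InvCurve T γ φ) {z : Pl} (hz : z ∉ range γ) (k : ℤ) (s : ℝ) :
    Aa γ (z + ((k:ℝ), 0)) (s + k) = Aa γ z s := by
  have h1 := I.line.isA hz
  have h2 := I.line.isA (I.range_per z k hz)
  have : IsA γ z (fun s => Aa γ (z + ((k:ℝ), 0)) (s + k)) := by
    refine ⟨h2.cont.comp (by fun_prop), fun s => ?_, ?_⟩
    · have := h2.ang (s + k)
      rw [I.per] at this
      simpa using this
    · have ht : Tendsto (fun s : ℝ => s + k) atBot atBot := tendsto_atBot_add_const_right _ _ tendsto_id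
      exact ht.eventually h2.bot
  exact congrFun (this.unique h1) s

lemma UpR_per (I : InvCurve T γ φ) {z : Pl} (hz : z ∈ UpR γ) (k : ℤ) : z + ((k:ℝ), 0) ∈ UpR γ := by
  refine ⟨I.range_per z k hz.1, ?_⟩
  have ht : Tendsto (fun s : ℝ => s + ((-k : ℤ):ℝ)) atTop atTop :=
    tendsto_atTop_add_const_right _ _ tendsto_id
  filter_upwards [ht.eventually hz.2] with s hs
  rw [← I.A_per hz.1 k] at hs
  simpa using hs

lemma QR_bdd (I : InvCurve T γ φ) : ∃ M : ℝ, ∀ z ∈ UpR γ, (∃ s, Aa γ z s ≥ 1/2 ∨ Aa γ z s ≤ -(1/2)) → |z.2| ≤ M := by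
  obtain ⟨M, hM⟩ := I.line.bdd
  refine ⟨M, ?_⟩
  rintro z hz ⟨s, hs⟩
  by_contra h
  push Not at h
  rcases lt_abs.1 h with h | h
  · have := I.line.A_top hz.1 (fun s => by linarith [le_abs_self (γ s).2, hM s]) s
    rcases hs with hs | hs <;> linarith [this.1, this.2]
  · exact I.line.bottom_not_mem (fun s => by linarith [neg_abs_le (γ s).2, hM s]) hz

/-- perturbation making the angle inequality strict -/
lemma perturb (I : InvCurve T γ φ) {z : Pl} (hz : z ∉ range γ) {s : ℝ} {N : Set Pl} (hN : N ∈ 𝓝 z) :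
    (1/2 ≤ Aa γ z s → ∃ z' ∈ N, 1/2 < Aa γ z' s) ∧ (Aa γ z s ≤ -(1/2) → ∃ z' ∈ N, Aa γ z' s < -(1/2)) := by
  have hc := I.line.A_cont hz s
  have hp : ∀ e : ℝ, Tendsto (fun t : ℝ => z + (e * t, 0)) (𝓝[>] 0) (𝓝 z) := by
    intro e
    have : ContinuousAt (fun t : ℝ => z + (e * t, (0:ℝ))) 0 := by fun_prop
    have h2 := this.tendsto
    simp only [mul_zero] at h2
    rw [show z + ((0:ℝ), (0:ℝ)) = z by ext <;> simp] at h2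
    exact h2.mono_left nhdsWithin_le_nhds
  have hoff : ∀ᶠ z' in 𝓝 z, z' ∉ range γ := I.line.isClosed.isOpen_compl.mem_nhds hz
  constructor
  · intro h
    rcases eq_or_lt_of_le h with h | h
    · have e1 := hc.eventually (Ioo_mem_nhds (a := 1/4) (b := 3/4) (by beta_reduce; rw [← h]; norm_num) (by beta_reduce; rw [← h]; norm_num))
      have hd := ang_down ((I.line.isA hz).ang s) 0 (by rw [← h]; norm_num)
      obtain ⟨t, h1, h2, h3, h4⟩ := (((hp 1).eventually e1).and (((hp 1).eventually hN).and
        (((hp 1).eventually hoff).and self_mem_nhdsWithin))).exists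
      refine ⟨_, h2, ?_⟩
      have h4 : 0 < t := h4
      have ha := (I.line.isA h3).ang s
      by_contra hh
      rcases lt_or_eq_of_le (not_lt.1 hh) with h' | h'
      · have := ha.fst_neg (by linarith [h1.1]) h'
        simp at this hd; linarith [hd.1]
      · have := (ang_down ha 0 (by rw [h']; norm_num)).1
        simp at this hd; linarith [hd.1]
    · exact ⟨z, mem_of_mem_nhds hN, h⟩
  · intro h
    rcases eq_or_lt_of_le h with h | h
    · have e1 := hc.eventually (Ioo_mem_nhds (a := -(3/4)) (b := -(1/4)) (by beta_reduce; rw [h]; norm_num) (by beta_reduce; rw [h]; norm_num))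
      have hd := ang_down ((I.line.isA hz).ang s) (-1) (by rw [h]; norm_num)
      obtain ⟨t, h1, h2, h3, h4⟩ := (((hp (-1)).eventually e1).and (((hp (-1)).eventually hN).and
        (((hp (-1)).eventually hoff).and self_mem_nhdsWithin))).exists
      refine ⟨_, h2, ?_⟩
      have h4 : 0 < t := h4
      have ha := (I.line.isA h3).ang s
      by_contra hh
      rcases lt_or_eq_of_le (not_lt.1 hh) with h' | h'
      · have := ha.fst_pos h' (by linarith [h1.2])
        simp at this hd; linarith [hd.1]
      · have := (ang_down ha (-1) (by rw [← h']; norm_num)).1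
        simp at this hd; linarith [hd.1]
    · exact ⟨z, mem_of_mem_nhds hN, h⟩

lemma per_symm_k (I : InvCurve T γ φ) (p : Pl) (k : ℤ) : T.F.symm (p + ((k:ℝ), 0)) = T.F.symm p + ((k:ℝ), 0) :=
  per_int T.symm_per p k

/-- the visible region is invariant -/
lemma Oo_inv (I : InvCurve T γ φ) (z : Pl) : T.F z ∈ Oo γ ↔ z ∈ Oo γ := by
  obtain ⟨t1, t2, t3⟩ := I.tr
  obtain ⟨M, hM⟩ := I.QR_bdd
  -- the two bad sets
  let QR : Set Pl := {z | z ∈ UpR γ ∧ ∃ s, 1/2 ≤ Aa γ z s}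
  let QL : Set Pl := {z | z ∈ UpR γ ∧ ∃ s, Aa γ z s ≤ -(1/2)}
  have hQR : ∀ z, T.F z ∈ QR → z ∈ QR := by
    rintro z ⟨h1, s, hs⟩
    have hz := (t3 z).1 h1
    obtain ⟨s', rfl⟩ := I.φsurj s
    refine ⟨hz, s', ?_⟩
    by_contra h
    push Not at h
    linarith [t1 z hz.1 s' h.le]
  have hQL : ∀ z, z ∈ QL → T.F z ∈ QL := by
    rintro z ⟨h1, s, hs⟩
    exact ⟨(t3 z).2 h1, φ s, (t2 z h1.1 s hs).le⟩
  have hO : ∀ z, z ∈ Oo γ ↔ z ∈ UpR γ ∧ z ∉ QR ∧ z ∉ QL := by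
    intro z
    constructor
    · intro h
      refine ⟨I.line.Oo_sub h, ?_, ?_⟩
      · rintro ⟨-, s, hs⟩; linarith [(h.2 s).2]
      · rintro ⟨-, s, hs⟩; linarith [(h.2 s).1]
    · rintro ⟨h, h1, h2⟩
      refine ⟨h.1, fun s => ⟨?_, ?_⟩⟩
      · by_contra hh; exact h2 ⟨h, s, not_lt.1 hh⟩
      · by_contra hh; exact h1 ⟨h, s, not_lt.1 hh⟩
  have hQRper : ∀ z ∈ QR, ∀ k : ℤ, z + ((k:ℝ), 0) ∈ QR := by
    rintro z ⟨h, s, hs⟩ k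
    exact ⟨I.UpR_per h k, s + k, by rw [I.A_per h.1]; exact hs⟩
  have hQLper : ∀ z ∈ QL, ∀ k : ℤ, z + ((k:ℝ), 0) ∈ QL := by
    rintro z ⟨h, s, hs⟩ k
    exact ⟨I.UpR_per h k, s + k, by rw [I.A_per h.1]; exact hs⟩
  constructor
  · intro h
    obtain ⟨h1, h2, h3⟩ := (hO _).1 h
    have hU := (t3 z).1 h1
    refine (hO z).2 ⟨hU, ?_, fun h' => h3 (hQL z h')⟩
    rintro ⟨-, s, hs⟩
    -- neighbourhood inside
    let N0 : Set Pl := UpR γ ∩ T.F ⁻¹' (Oo γ)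
    have hN0 : IsOpen N0 := I.line.isOpen_UpR.inter (I.line.isOpen_Oo.preimage T.F.continuous)
    obtain ⟨z', hz', hA'⟩ := (I.perturb hU.1 (hN0.mem_nhds ⟨hU, h⟩)).1 hs
    have hev : ∀ᶠ w in 𝓝 z', w ∈ N0 ∧ 1/2 < Aa γ w s :=
      (hN0.eventually_mem hz').and
        ((I.line.A_cont hz'.1.1 s).eventually (isOpen_Ioi.mem_nhds hA'))
    obtain ⟨N, hNsub, hNo, hNz⟩ := eventually_nhds_iff.1 hev
    have hQ : ∀ n : ℕ, ∀ p ∈ QR, T.F.symm^[n] p ∈ QR := by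
      intro n
      induction n with
      | zero => intro p hp; exact hp
      | succ n ih =>
        intro p hp
        rw [iterate_succ_apply']
        apply hQR
        simpa using ih p hp
    have hNQ : ∀ p ∈ {x | x ∈ N}, p ∈ QR := fun p hp => ⟨(hNsub p hp).1.1, s, (hNsub p hp).2.le⟩
    obtain ⟨n, k, p, hp, hpk⟩ := T.nw' N hNo ⟨z', hNz⟩
      ⟨M, fun n p hp => by
        obtain ⟨a, s', b⟩ := hQ n p (hNQ p hp)
        exact hM _ a ⟨s', Or.inl b⟩⟩
    have h5 := (hNsub _ hpk).1.2
    simp only [mem_preimage] at h5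
    rw [iterate_succ_apply'] at h5
    have e : T.F (T.F.symm (T.F.symm^[n] p) - ((k:ℝ), (0:ℝ))) = T.F.symm^[n] p + (((-k:ℤ):ℝ), 0) := by
      apply T.F.symm.injective
      rw [I.per_symm_k]
      simp only [Homeomorph.symm_apply_apply]
      ext <;> simp; ring
    rw [e] at h5
    exact ((hO _).1 h5).2.1 (hQRper _ (hQ n p (hNQ p hp)) (-k))
  · intro h
    obtain ⟨h1, h2, h3⟩ := (hO _).1 h
    have hU := (t3 z).2 h1
    refine (hO _).2 ⟨hU, fun h' => h2 (hQR z h'), ?_⟩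
    rintro ⟨-, s, hs⟩
    let N0 : Set Pl := UpR γ ∩ T.F.symm ⁻¹' (Oo γ)
    have hN0 : IsOpen N0 := I.line.isOpen_UpR.inter (I.line.isOpen_Oo.preimage T.F.symm.continuous)
    obtain ⟨z', hz', hA'⟩ := (I.perturb hU.1 (hN0.mem_nhds ⟨hU, by simpa using h⟩)).2 hs
    have hev : ∀ᶠ w in 𝓝 z', w ∈ N0 ∧ Aa γ w s < -(1/2) :=
      (hN0.eventually_mem hz').and
        ((I.line.A_cont hz'.1.1 s).eventually (isOpen_Iio.mem_nhds hA'))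
    obtain ⟨N, hNsub, hNo, hNz⟩ := eventually_nhds_iff.1 hev
    have hQ : ∀ n : ℕ, ∀ p ∈ QL, T.F^[n] p ∈ QL := by
      intro n
      induction n with
      | zero => intro p hp; exact hp
      | succ n ih =>
        intro p hp
        rw [iterate_succ_apply']
        exact hQL _ (ih p hp)
    have hNQ : ∀ p ∈ {x | x ∈ N}, p ∈ QL := fun p hp => ⟨(hNsub p hp).1.1, s, (hNsub p hp).2.le⟩
    obtain ⟨n, k, p, hp, hpk⟩ := T.nw N hNo ⟨z', hNz⟩
      ⟨M, fun n p hp => by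
        obtain ⟨a, s', b⟩ := hQ n p (hNQ p hp)
        exact hM _ a ⟨s', Or.inr b⟩⟩
    have h5 := (hNsub _ hpk).1.2
    simp only [mem_preimage] at h5
    rw [iterate_succ_apply'] at h5
    have e : T.F.symm (T.F (T.F^[n] p) - ((k:ℝ), (0:ℝ))) = T.F^[n] p + (((-k:ℤ):ℝ), 0) := by
      apply T.F.injective
      rw [per_int T.per]
      simp only [Homeomorph.apply_symm_apply]
      ext <;> simp; ring
    rw [e] at h5
    exact ((hO _).1 h5).2.2 (hQLper _ (hQ n p (hNQ p hp)) (-k))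

end InvCurve

end

section

/-- continuity of implicit functions for monotone equations -/
lemma implicit_cont {X : Type*} [TopologicalSpace X] {g : X → ℝ → ℝ}
    (hg : Continuous fun q : X × ℝ => g q.1 q.2) (hm : ∀ x, StrictMono (g x)) {c h : X → ℝ}
    (hc : Continuous c) (hh : ∀ x, g x (h x) = c x) : Continuous h := by
  rw [continuous_iff_continuousAt]
  intro x0
  rw [ContinuousAt, tendsto_order]
  constructor
  · intro a ha
    have h1 : g x0 a < c x0 := by rw [← hh]; exact hm x0 ha
    have ca : Continuous fun x => g x a := hg.comp (by fun_prop : Continuous fun x : X => (x, a))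
    filter_upwards [ca.continuousAt.eventually_lt hc.continuousAt h1] with x hx
    rw [← hh] at hx; exact (hm x).lt_iff_lt.1 hx
  · intro b hb
    have h1 : c x0 < g x0 b := by rw [← hh]; exact hm x0 hb
    have cb : Continuous fun x => g x b := hg.comp (by fun_prop : Continuous fun x : X => (x, b))
    filter_upwards [hc.continuousAt.eventually_lt cb.continuousAt h1] with x hx
    rw [← hh] at hx; exact (hm x).lt_iff_lt.1 hx

/-- bounded periodic functions with invariant open epigraph -/
structure EpiInv (T : TH) (u : ℝ → ℝ) : Prop where
  per : ∀ x, u (x + 1) = u x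
  bdd : ∃ M : ℝ, ∀ x, |u x| ≤ M
  epi : ∀ p : Pl, u (T.F p).1 < (T.F p).2 ↔ u p.1 < p.2

/-- one sided barrier -/
lemma barrier (G : Pl ≃ₜ Pl) (e : ℝ) (hm : ∀ x, StrictMono fun y => e * (G (x, y)).1)
    (hs : ∀ x, Surjective fun y => e * (G (x, y)).1) (he : e * e = 1) :
    ∃ R : Pl × ℝ → ℝ, Continuous R ∧ (∀ P : Pl, R (P, P.1) = P.2) ∧
      ∀ u : ℝ → ℝ, (∀ p : Pl, u (G p).1 < (G p).2 ↔ u p.1 < p.2) →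
        ∀ x x', 0 ≤ e * (x' - x) → u x' ≤ R ((x, u x), x') := by
  have hex : ∀ q : Pl × ℝ, ∃ Y, e * (G ((G.symm q.1).1, Y)).1 = e * q.2 := fun q => hs _ _
  choose Y hY using hex
  have hYc : Continuous Y := implicit_cont (g := fun (q : Pl × ℝ) y => e * (G ((G.symm q.1).1, y)).1)
    (c := fun q => e * q.2) (by fun_prop) (fun q => hm _) (by fun_prop) hY
  have hee : ∀ a b : ℝ, e * a = e * b → a = b := by
    intro a b h
    have : (e * e) * a = (e * e) * b := by rw [mul_assoc, h, mul_assoc]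
    simpa [he] using this
  refine ⟨fun q => (G ((G.symm q.1).1, Y q)).2, by fun_prop, ?_, ?_⟩
  · intro P
    have h1 : Y (P, P.1) = (G.symm P).2 := by
      apply (hm (G.symm P).1).injective
      simp only [hY (P, P.1)]
      have : ((G.symm P).1, (G.symm P).2) = G.symm P := rfl
      rw [this]; simp
    simp only [h1]
    have : ((G.symm P).1, (G.symm P).2) = G.symm P := rfl
    rw [this]; simp
  · intro u hu x x' hx
    have key : ∀ y > u x, u x' ≤ (G ((G.symm (x, y)).1, Y ((x, y), x'))).2 := by
      intro y hy
      have h0 : u (G.symm (x, y)).1 < (G.symm (x, y)).2 := by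
        rw [← hu]; simpa using hy
      have h1 : (G.symm (x, y)).2 ≤ Y ((x, y), x') := by
        apply (hm (G.symm (x, y)).1).le_iff_le.1
        simp only [hY ((x, y), x')]
        have : ((G.symm (x, y)).1, (G.symm (x, y)).2) = G.symm (x, y) := rfl
        rw [this]; simp; linarith
      have h2 := (hu ((G.symm (x, y)).1, Y ((x, y), x'))).2 (lt_of_lt_of_le h0 h1)
      rw [hee _ _ (hY ((x, y), x'))] at h2
      exact h2.le
    have hc : Continuous fun y => (G ((G.symm (x, y)).1, Y ((x, y), x'))).2 := by fun_prop
    exact ge_of_tendsto (hc.continuousWithinAt (s := Ioi (u x)) (x := u x)).tendsto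
      (by filter_upwards [self_mem_nhdsWithin] with y hy using key y hy)

lemma modulus_one {R : Pl × ℝ → ℝ} (hR : Continuous R) (hR0 : ∀ P : Pl, R (P, P.1) = P.2) (M ε : ℝ) (hε : 0 < ε) :
    ∃ δ > 0, δ ≤ 1 ∧ ∀ x ∈ Icc (0:ℝ) 1, ∀ y ∈ Icc (-M) M, ∀ x', |x' - x| < δ → R ((x, y), x') < y + ε := by
  have hK : IsCompact ((Icc (0:ℝ) 1 ×ˢ Icc (-M) M) ×ˢ Icc (-1:ℝ) 2) :=
    (isCompact_Icc.prod isCompact_Icc).prod isCompact_Icc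
  have := Metric.uniformContinuousOn_iff.1 (hK.uniformContinuousOn_of_continuous hR.continuousOn) ε hε
  obtain ⟨δ, h0, h1⟩ := this
  refine ⟨min δ 1, by positivity, min_le_right _ _, ?_⟩
  intro x hx y hy x' hx'
  have hx1 : |x' - x| < 1 := lt_of_lt_of_le hx' (min_le_right _ _)
  have hx2 : |x' - x| < δ := lt_of_lt_of_le hx' (min_le_left _ _)
  rw [abs_lt] at hx1
  have := h1 ((x, y), x') ⟨⟨hx, hy⟩, by linarith [hx.1], by linarith [hx.2]⟩ ((x, y), x)
    ⟨⟨hx, hy⟩, by linarith [hx.1], by linarith [hx.2]⟩ (by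
      simp only [Prod.dist_eq, dist_self]
      simpa [Real.dist_eq] using hx2)
  rw [hR0 (x, y), Real.dist_eq, abs_lt] at this
  simp only at this
  linarith [this.2]

lemma EpiInv.per_int {T : TH} {u : ℝ → ℝ} (h : EpiInv T u) (x : ℝ) (k : ℤ) : u (x + k) = u x := by
  have := (show Function.Periodic u 1 from h.per).int_mul k
  simpa using this x

lemma TH.modulus (T : TH) (M ε : ℝ) (hε : 0 < ε) :
    ∃ δ > 0, ∀ u, EpiInv T u → (∀ x, |u x| ≤ M) → ∀ x x', |x' - x| < δ → |u x' - u x| < ε := by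
  obtain ⟨R, hR, hR0, hRu⟩ := barrier T.F 1 (fun x => by simpa using T.tw x) (fun x => by simpa using T.tws x) (by norm_num)
  obtain ⟨R', hR', hR0', hRu'⟩ := barrier T.F.symm (-1)
    (fun x => fun a b hab => by have := T.tw' x hab; simp at this ⊢; exact this)
    (fun x y => by obtain ⟨z, hz⟩ := T.tws' x (-y); refine ⟨z, ?_⟩; simp at hz ⊢; rw [hz]; ring) (by norm_num)
  obtain ⟨δ, d0, d1, hd⟩ := modulus_one hR hR0 M ε hε
  obtain ⟨δ', d0', d1', hd'⟩ := modulus_one hR' hR0' M ε hε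
  refine ⟨min δ δ', by positivity, ?_⟩
  intro u hu hM
  have one : ∀ x ∈ Icc (0:ℝ) 1, ∀ x', |x' - x| < min δ δ' → u x' < u x + ε := by
    intro x hx x' h
    have hy : u x ∈ Icc (-M) M := abs_le.1 (hM x)
    rcases le_total x x' with hh | hh
    · exact (hRu u hu.epi x x' (by linarith)).trans_lt (hd x hx _ hy x' (h.trans_le (min_le_left _ _)))
    · refine (hRu' u ?_ x x' (by linarith)).trans_lt (hd' x hx _ hy x' (h.trans_le (min_le_right _ _)))
      intro p
      rw [← hu.epi]; simp
  have two : ∀ x x', |x' - x| < min δ δ' → u x' < u x + ε := by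
    intro x x' h
    have h1 := one (x + ((-⌊x⌋ : ℤ):ℝ)) ⟨by push_cast; linarith [Int.floor_le x], by push_cast; linarith [Int.lt_floor_add_one x]⟩
      (x' + ((-⌊x⌋ : ℤ):ℝ)) (by simpa using h)
    rw [hu.per_int, hu.per_int] at h1
    exact h1
  intro x x' h
  rw [abs_lt]
  constructor
  · have := two x' x (by rw [abs_sub_comm]; exact h)
    linarith
  · have := two x x' h
    linarith

namespace EpiInv
variable {T : TH} {u : ℝ → ℝ}

lemma cont (h : EpiInv T u) : Continuous u := by
  obtain ⟨M, hM⟩ := h.bdd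
  rw [Metric.continuous_iff]
  intro b ε hε
  obtain ⟨δ, d0, hd⟩ := T.modulus M ε hε
  exact ⟨δ, d0, fun a ha => by
    rw [Real.dist_eq] at ha ⊢
    exact hd u h hM b a ha⟩

end EpiInv

lemma epi_closure {u : ℝ → ℝ} (hu : Continuous u) : closure {p : Pl | u p.1 < p.2} = {p : Pl | u p.1 ≤ p.2} := by
  apply subset_antisymm
  · apply closure_minimal
    · intro p (hp : u p.1 < p.2); exact le_of_lt hp
    · exact isClosed_le (by fun_prop) (by fun_prop)
  · intro p hp
    have hp : u p.1 ≤ p.2 := hp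
    have hc : Tendsto (fun t : ℝ => ((p.1, p.2 + t) : Pl)) (𝓝[>] 0) (𝓝 p) := by
      have : Continuous (fun t : ℝ => ((p.1, p.2 + t) : Pl)) := by fun_prop
      have := this.tendsto 0
      simp only [add_zero] at this
      exact this.mono_left nhdsWithin_le_nhds
    refine mem_closure_of_tendsto hc ?_
    filter_upwards [self_mem_nhdsWithin] with t ht
    have ht : 0 < t := ht
    simp; linarith

lemma epi_interior {u : ℝ → ℝ} (hu : Continuous u) : interior {p : Pl | u p.1 ≤ p.2} = {p : Pl | u p.1 < p.2} := by
  apply subset_antisymm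
  · intro p hp
    have hp' : p ∈ {p : Pl | u p.1 ≤ p.2} := interior_subset hp
    have hp' : u p.1 ≤ p.2 := hp'
    rcases eq_or_lt_of_le hp' with h | h
    · exfalso
      have hc : Tendsto (fun t : ℝ => ((p.1, p.2 - t) : Pl)) (𝓝[>] 0) (𝓝 p) := by
        have : Continuous (fun t : ℝ => ((p.1, p.2 - t) : Pl)) := by fun_prop
        have := this.tendsto 0
        simp only [sub_zero] at this
        exact this.mono_left nhdsWithin_le_nhds
      obtain ⟨t, h1, h2⟩ := ((hc.eventually (mem_interior_iff_mem_nhds.1 hp)).and self_mem_nhdsWithin).exists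
      have h2 : 0 < t := h2
      simp at h1; linarith
    · exact h
  · exact interior_maximal (fun p (hp : u p.1 < p.2) => le_of_lt hp) (isOpen_lt (by fun_prop) (by fun_prop))

lemma homeo_closure_iff (F : Pl ≃ₜ Pl) {s : Set Pl} (h : ∀ p, F p ∈ s ↔ p ∈ s) (p : Pl) :
    F p ∈ closure s ↔ p ∈ closure s := by
  have e : F ⁻¹' s = s := Set.ext h
  rw [← mem_preimage, F.preimage_closure, e]

lemma homeo_interior_iff (F : Pl ≃ₜ Pl) {s : Set Pl} (h : ∀ p, F p ∈ s ↔ p ∈ s) (p : Pl) :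
    F p ∈ interior s ↔ p ∈ interior s := by
  have e : F ⁻¹' s = s := Set.ext h
  rw [← mem_preimage, F.preimage_interior, e]

namespace EpiInv
variable {T : TH} {u : ℝ → ℝ}

lemma epi_le (h : EpiInv T u) (p : Pl) : u (T.F p).1 ≤ (T.F p).2 ↔ u p.1 ≤ p.2 := by
  have := homeo_closure_iff T.F (s := {p : Pl | u p.1 < p.2}) h.epi p
  rw [epi_closure h.cont] at this
  exact this

lemma hyp (h : EpiInv T u) (p : Pl) : (T.F p).2 < u (T.F p).1 ↔ p.2 < u p.1 := by
  have := h.epi_le p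
  rw [← not_le, ← not_le, this]

lemma hyp_le (h : EpiInv T u) (p : Pl) : (T.F p).2 ≤ u (T.F p).1 ↔ p.2 ≤ u p.1 := by
  rw [← not_lt, ← not_lt, h.epi]

lemma gr (h : EpiInv T u) (p : Pl) : (T.F p).2 = u (T.F p).1 ↔ p.2 = u p.1 := by
  rw [le_antisymm_iff, le_antisymm_iff, h.epi_le, h.hyp_le]

lemma of_closed (hc : Continuous u) (hp : ∀ x, u (x + 1) = u x) (hb : ∃ M : ℝ, ∀ x, |u x| ≤ M)
    (he : ∀ p : Pl, u (T.F p).1 ≤ (T.F p).2 ↔ u p.1 ≤ p.2) : EpiInv T u := by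
  refine ⟨hp, hb, fun p => ?_⟩
  have := homeo_interior_iff T.F (s := {p : Pl | u p.1 ≤ p.2}) he p
  rw [epi_interior hc] at this
  exact this

/-- infimum of a bounded family -/
lemma inf {ι : Type*} [Nonempty ι] {w : ι → ℝ → ℝ} (h : ∀ i, EpiInv T (w i)) {M : ℝ} (hM : ∀ i x, |w i x| ≤ M) :
    EpiInv T (fun x => ⨅ i, w i x) := by
  have hb : ∀ x, BddBelow (range fun i => w i x) := fun x => ⟨-M, by rintro _ ⟨i, rfl⟩; exact (abs_le.1 (hM i x)).1⟩
  refine ⟨fun x => ?_, ⟨M, fun x => ?_⟩, fun p => ?_⟩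
  · simp only [(h _).per]
  · rw [abs_le]
    constructor
    · exact le_ciInf fun i => (abs_le.1 (hM i x)).1
    · obtain ⟨i⟩ := ‹Nonempty ι›
      exact (ciInf_le (hb x) i).trans (abs_le.1 (hM i x)).2
  · simp only [ciInf_lt_iff (hb _), (h _).epi]

/-- supremum of a bounded family -/
lemma sup {ι : Type*} [Nonempty ι] {w : ι → ℝ → ℝ} (h : ∀ i, EpiInv T (w i)) {M : ℝ} (hM : ∀ i x, |w i x| ≤ M) :
    EpiInv T (fun x => ⨆ i, w i x) := by
  have hb : ∀ x, BddAbove (range fun i => w i x) := fun x => ⟨M, by rintro _ ⟨i, rfl⟩; exact (abs_le.1 (hM i x)).2⟩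
  refine of_closed ?_ (fun x => by simp only [(h _).per]) ⟨M, fun x => ?_⟩ (fun p => ?_)
  · rw [Metric.continuous_iff]
    intro b ε hε
    obtain ⟨δ, d0, hd⟩ := T.modulus M (ε / 2) (by linarith)
    refine ⟨δ, d0, fun a ha => ?_⟩
    rw [Real.dist_eq] at ha ⊢
    have h1 : (⨆ i, w i a) ≤ (⨆ i, w i b) + ε / 2 := ciSup_le fun i => by
      have := (abs_lt.1 (hd (w i) (h i) (hM i) b a ha)).2
      linarith [le_ciSup (hb b) i]
    have h2 : (⨆ i, w i b) ≤ (⨆ i, w i a) + ε / 2 := ciSup_le fun i => by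
      have := (abs_lt.1 (hd (w i) (h i) (hM i) b a ha)).1
      linarith [le_ciSup (hb a) i]
    rw [abs_lt]; constructor <;> linarith
  · rw [abs_le]
    constructor
    · obtain ⟨i⟩ := ‹Nonempty ι›
      exact (abs_le.1 (hM i x)).1.trans (le_ciSup (hb x) i)
    · exact ciSup_le fun i => (abs_le.1 (hM i x)).2
  · rw [ciSup_le_iff (hb _), ciSup_le_iff (hb _)]
    simp only [(h _).epi_le]

end EpiInv

/-- degree one maps have bounded deviation -/
lemma dev_bdd {g : ℝ → ℝ} (hg : Continuous g) (d : ℝ) (h : ∀ s, g (s + 1) = g s + d) :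
    ∃ C : ℝ, ∀ s, |g s - d * s| ≤ C := by
  have hp : Function.Periodic (fun s => g s - d * s) 1 := fun s => by simp only [h]; ring
  have hc : Continuous (fun s => g s - d * s) := by fun_prop
  obtain ⟨C, hC⟩ := isCompact_Icc.exists_bound_of_continuousOn (s := Icc (0:ℝ) 1) hc.continuousOn
  refine ⟨C, fun s => ?_⟩
  have := hp.sub_zsmul_eq (x := s) ⌊s⌋
  beta_reduce at this
  rw [← this]
  apply hC
  simp
  exact (Int.fract_lt_one s).le

lemma dev_top {g : ℝ → ℝ} (hg : Continuous g) {d : ℝ} (hd : 0 < d) (h : ∀ s, g (s + 1) = g s + d) :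
    Tendsto g atBot atBot ∧ Tendsto g atTop atTop := by
  obtain ⟨C, hC⟩ := dev_bdd hg d h
  constructor
  · refine tendsto_atBot_mono (g := g) (f := fun s => d * s + C) (fun s => ?_) ?_
    · linarith [(abs_le.1 (hC s)).2]
    · exact tendsto_atBot_add_const_right _ _ (tendsto_id.const_mul_atBot hd)
  · refine tendsto_atTop_mono (f := fun s => d * s + -C) (fun s => ?_) ?_
    · linarith [(abs_le.1 (hC s)).1]
    · exact tendsto_atTop_add_const_right _ _ (tendsto_id.const_mul_atTop hd)

lemma dev_surj {g : ℝ → ℝ} (hg : Continuous g) {d : ℝ} (hd : 0 < d) (h : ∀ s, g (s + 1) = g s + d) :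
    Surjective g := hg.surjective (dev_top hg hd h).2 (dev_top hg hd h).1

/-- periodic continuous graph which is invariant -/
lemma EpiInv.of_graph {T : TH} {u : ℝ → ℝ} (hc : Continuous u) (hp : ∀ x, u (x + 1) = u x)
    (hg : ∀ p : Pl, (T.F p).2 = u (T.F p).1 ↔ p.2 = u p.1) : EpiInv T u := by
  have hb : ∃ M : ℝ, ∀ x, |u x| ≤ M := by
    obtain ⟨C, hC⟩ := dev_bdd hc 0 (fun s => by simp [hp])
    exact ⟨C, by simpa using hC⟩
  have hper := (show Function.Periodic u 1 from hp)
  have hφ : ∀ s, (T.F (s + 1, u (s + 1))).1 = (T.F (s, u s)).1 + 1 := by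
    intro s
    have := T.per (s, u s)
    rw [hp]
    simp only [Prod.mk_add_mk, add_zero] at this
    rw [this]; simp
  have hφc : Continuous fun s => (T.F (s, u s)).1 := by fun_prop
  obtain ⟨t1, t2⟩ := dev_top hφc one_pos hφ
  have I : InvCurve T (fun s => (s, u s)) (fun s => (T.F (s, u s)).1) := by
    refine ⟨⟨by fun_prop, tendsto_id, tendsto_id, hb⟩, ?_, ?_, hφc, dev_surj hφc one_pos hφ, t1, t2⟩
    · intro k s
      have := hper.int_mul k s
      simp at this
      simp [this]
    · intro s
      exact Prod.ext rfl ((hg (s, u s)).2 rfl)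
  refine ⟨hp, hb, fun p => ?_⟩
  have key : ∀ p : Pl, p ∈ Oo (fun s => (s, u s)) ↔ u p.1 < p.2 := by
    intro p
    rw [I.line.mem_Oo_iff]
    constructor
    · intro h
      by_contra hh
      exact h (u p.1) (not_lt.1 hh) ⟨p.1, rfl⟩
    · rintro h y hy ⟨s, hs⟩
      simp at hs
      rw [← hs.1] at h
      linarith [hs.2]
  rw [← key, ← key, I.Oo_inv]


end

section

lemma curve_per {γ : ℝ → Pl} {d : ℤ} (hper : ∀ s, γ (s + 1) = γ s + ((d:ℝ), 0)) (k : ℤ) (s : ℝ) :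
    γ (s + k) = γ s + (((k * d : ℤ) : ℝ), 0) := by
  induction k using Int.induction_on with
  | zero => simp [Prod.mk_zero_zero]
  | succ n ih =>
    have e : s + (((n:ℤ) + 1 : ℤ) : ℝ) = (s + ((n:ℤ):ℝ)) + 1 := by push_cast; ring
    rw [e, hper, ih]; ext <;> simp; ring
  | pred n ih =>
    have e : s + ((-(n:ℤ) : ℤ) : ℝ) = (s + ((-(n:ℤ) - 1 : ℤ):ℝ)) + 1 := by push_cast; ring
    rw [e, hper] at ih
    rw [eq_sub_of_add_eq ih]; ext <;> simp; ring

lemma curve_line {γ : ℝ → Pl} (hc : Continuous γ) {d : ℤ} (hd : 0 < d)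
    (hper : ∀ s, γ (s + 1) = γ s + ((d:ℝ), 0)) : LineCurve γ := by
  obtain ⟨t1, t2⟩ := dev_top (g := fun s => (γ s).1) (d := d) (by fun_prop) (by exact_mod_cast hd)
    (fun s => by rw [hper]; simp)
  obtain ⟨C, hC⟩ := dev_bdd (g := fun s => (γ s).2) (d := 0) (by fun_prop) (fun s => by rw [hper]; simp)
  exact ⟨hc, t1, t2, C, by simpa using hC⟩

lemma curve_deg {γ : ℝ → Pl} (hc : Continuous γ) {d : ℤ} (hd : 0 < d)
    (hper : ∀ s, γ (s + 1) = γ s + ((d:ℝ), 0))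
    (hinj : ∀ s s' (k : ℤ), γ s = γ s' + ((k:ℝ), 0) → ∃ m : ℤ, s = s' + m) : d = 1 := by
  by_contra hd1
  have hL := curve_line hc hd hper
  have hdis : ∀ s, γ s + (1, 0) ∉ range γ := by
    rintro s ⟨s', hs⟩
    obtain ⟨m, hm⟩ := hinj s' s 1 (by simpa using hs)
    rw [hm, curve_per hper] at hs
    have h1 := congrArg Prod.fst hs
    simp at h1
    have h2 : m * d = 1 := by exact_mod_cast h1
    rcases Int.isUnit_iff.1 (IsUnit.of_mul_eq_one_right _ h2) with h | h
    · exact hd1 h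
    · omega
  -- extreme heights
  have hp2 : Function.Periodic (fun s => (γ s).2) 1 := fun s => by simp [hper]
  have hc2 : Continuous fun s => (γ s).2 := by fun_prop
  have ext : ∀ s, ∃ t ∈ Icc (0:ℝ) 1, (γ t).2 = (γ s).2 := by
    intro s
    refine ⟨Int.fract s, ⟨Int.fract_nonneg s, (Int.fract_lt_one s).le⟩, ?_⟩
    have := hp2.sub_zsmul_eq (x := s) ⌊s⌋
    simpa using this
  obtain ⟨a, ha, hmax⟩ := isCompact_Icc.exists_isMaxOn (s := Icc (0:ℝ) 1) ⟨0, by simp⟩ hc2.continuousOn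
  obtain ⟨b, hb, hmin⟩ := isCompact_Icc.exists_isMinOn (s := Icc (0:ℝ) 1) ⟨0, by simp⟩ hc2.continuousOn
  have m1 : γ a + (1, 0) ∈ UpR γ := by
    refine hL.top_mem (hdis a) (hL.A_top (hdis a) (fun s => ?_))
    obtain ⟨t, ht, e⟩ := ext s
    rw [← e]; simpa using hmax ht
  have m2 : γ b + (1, 0) ∉ UpR γ := by
    refine hL.bottom_not_mem (fun s => ?_)
    obtain ⟨t, ht, e⟩ := ext s
    rw [← e]; simpa using hmin ht
  have hconn : IsPreconnected (range fun s => γ s + (1, 0)) := isPreconnected_range (by fun_prop)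
  obtain ⟨z, -, hz1, hz2⟩ := hconn _ _ hL.isOpen_UpR hL.isOpen_not_UpR (by
    rintro _ ⟨s, rfl⟩
    by_cases h : γ s + (1, 0) ∈ UpR γ
    · exact Or.inl h
    · exact Or.inr ⟨hdis s, h⟩) ⟨_, ⟨a, rfl⟩, m1⟩ ⟨_, ⟨b, rfl⟩, hdis b, m2⟩
  exact hz2.2 hz1

lemma curve_core_pos (T : TH) {γ : ℝ → Pl} (hc : Continuous γ) {d : ℤ} (hd : 0 < d)
    (hper : ∀ s, γ (s + 1) = γ s + ((d:ℝ), 0))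
    (hinj : ∀ s s' (k : ℤ), γ s = γ s' + ((k:ℝ), 0) → ∃ m : ℤ, s = s' + m)
    (hinv : ∀ p, (∃ s, ∃ k : ℤ, T.F p = γ s + ((k:ℝ), 0)) ↔ (∃ s, ∃ k : ℤ, p = γ s + ((k:ℝ), 0))) :
    ∃ u, EpiInv T u ∧ ∀ p : Pl, (∃ s, ∃ k : ℤ, p = γ s + ((k:ℝ), 0)) ↔ p.2 = u p.1 := by
  have hL := curve_line hc hd hper
  obtain rfl := curve_deg hc hd hper hinj
  have hperk : ∀ (k : ℤ) s, γ (s + k) = γ s + ((k:ℝ), 0) := fun k s => by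
    rw [curve_per hper]; simp
  have hran : ∀ p : Pl, (∃ s, ∃ k : ℤ, p = γ s + ((k:ℝ), 0)) ↔ p ∈ range γ := by
    intro p
    constructor
    · rintro ⟨s, k, rfl⟩; exact ⟨s + k, hperk k s⟩
    · rintro ⟨s, rfl⟩; exact ⟨s, 0, by simp [Prod.mk_zero_zero]⟩
  simp only [hran] at hinv ⊢
  have inj : Injective γ := by
    intro s s' h
    obtain ⟨m, hm⟩ := hinj s s' 0 (by simp [h, Prod.mk_zero_zero])
    rw [hm, hperk] at h
    have := congrArg Prod.fst h
    simp at this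
    rw [hm, this]; simp
  have hemb : IsClosedEmbedding γ := by
    refine IsClosedEmbedding.of_continuous_injective_isClosedMap hc inj ?_
    refine IsProperMap.isClosedMap ?_
    have h1 : Tendsto (fun s => (γ s).1) (cocompact ℝ) (cocompact ℝ) := by
      rw [cocompact_eq_atBot_atTop]
      exact (hL.bot.mono_right le_sup_left).sup (hL.top.mono_right le_sup_right) |>.mono_left (by simp)
    exact isProperMap_of_comp_of_t2 (g := Prod.fst) hc continuous_fst
      (isProperMap_iff_tendsto_cocompact.2 ⟨by fun_prop, h1⟩)
  have hF : ∀ s, ∃ s', γ s' = T.F (γ s) := fun s => (hinv _).2 ⟨s, rfl⟩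
  choose φ hφ using hF
  have hφc : Continuous φ := by
    rw [hemb.isEmbedding.continuous_iff]
    have : γ ∘ φ = fun s => T.F (γ s) := funext hφ
    rw [this]; fun_prop
  have hφ1 : ∀ s, φ (s + 1) = φ s + 1 := by
    intro s
    apply inj
    rw [hφ, hper, hper, hφ]
    simpa using T.per (γ s)
  obtain ⟨t1, t2⟩ := dev_top hφc one_pos hφ1
  have I : InvCurve T γ φ := ⟨hL, hperk, fun s => (hφ s).symm, hφc, dev_surj hφc one_pos hφ1, t1, t2⟩
  obtain ⟨M, hM⟩ := hL.bdd
  -- top of the curve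
  have hS : ∀ x, ∃ y, (x, y) ∈ range γ ∧ ∀ y' > y, (x, y') ∉ range γ := by
    intro x
    have hne : {y : ℝ | (x, y) ∈ range γ}.Nonempty := by
      obtain ⟨s, hs⟩ := (show Continuous fun s => (γ s).1 by fun_prop).surjective hL.top hL.bot x
      exact ⟨(γ s).2, s, Prod.ext hs rfl⟩
    have hbd : BddAbove {y : ℝ | (x, y) ∈ range γ} := by
      refine ⟨M, ?_⟩
      rintro y ⟨s, hs⟩
      have := (abs_le.1 (hM s)).2
      rw [hs] at this; exact this
    have hcl : IsClosed {y : ℝ | (x, y) ∈ range γ} :=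
      hL.isClosed.preimage (by fun_prop : Continuous fun y : ℝ => (x, y))
    refine ⟨sSup {y : ℝ | (x, y) ∈ range γ}, hcl.csSup_mem hne hbd, ?_⟩
    intro y' hy' hh
    exact absurd (le_csSup hbd hh) (not_le.2 hy')
  choose u hu1 hu2 using hS
  have key : ∀ p : Pl, p ∈ Oo γ ↔ u p.1 < p.2 := by
    intro p
    rw [hL.mem_Oo_iff]
    constructor
    · intro h
      by_contra hh
      exact h _ (not_lt.1 hh) (hu1 _)
    · intro h y hy
      exact hu2 _ _ (lt_of_lt_of_le h hy)
  have hupt : ∀ x, u (x + 1) = u x := by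
    intro x
    have e : ∀ x y : ℝ, (x + 1, y) ∈ range γ ↔ (x, y) ∈ range γ := by
      intro x y
      constructor
      · rintro ⟨s, hs⟩
        refine ⟨s + ((-1:ℤ):ℝ), ?_⟩
        rw [hperk, hs]; simp
      · rintro ⟨s, hs⟩
        refine ⟨s + ((1:ℤ):ℝ), ?_⟩
        rw [hperk, hs]; simp
    apply le_antisymm
    · by_contra h
      exact hu2 x _ (not_le.1 h) ((e _ _).1 (hu1 (x + 1)))
    · by_contra h
      exact hu2 (x + 1) _ (not_le.1 h) ((e _ _).2 (hu1 x))
  have hE : EpiInv T u := by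
    refine ⟨hupt, ⟨M, fun x => ?_⟩, fun p => ?_⟩
    · obtain ⟨s, hs⟩ := hu1 x
      have := hM s
      rwa [hs] at this
    · rw [← key, ← key, I.Oo_inv]
  refine ⟨u, hE, ?_⟩
  choose σ hσ using hu1
  have hσc : Continuous σ := by
    rw [hemb.isEmbedding.continuous_iff]
    have : γ ∘ σ = fun x => (x, u x) := funext hσ
    rw [this]
    have := hE.cont
    fun_prop
  have hσ1 : ∀ x, σ (x + 1) = σ x + 1 := by
    intro x
    apply inj
    rw [hσ, hper, hσ, hupt]; simp
  intro p
  constructor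
  · rintro ⟨s, rfl⟩
    obtain ⟨x, rfl⟩ := dev_surj hσc one_pos hσ1 s
    rw [hσ]
  · intro h
    exact ⟨σ p.1, by rw [hσ, ← h]⟩

lemma curve_core (T : TH) {γ : ℝ → Pl} (hc : Continuous γ) {d : ℤ} (hd : d ≠ 0)
    (hper : ∀ s, γ (s + 1) = γ s + ((d:ℝ), 0))
    (hinj : ∀ s s' (k : ℤ), γ s = γ s' + ((k:ℝ), 0) → ∃ m : ℤ, s = s' + m)
    (hinv : ∀ p, (∃ s, ∃ k : ℤ, T.F p = γ s + ((k:ℝ), 0)) ↔ (∃ s, ∃ k : ℤ, p = γ s + ((k:ℝ), 0))) :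
    ∃ u, EpiInv T u ∧ ∀ p : Pl, (∃ s, ∃ k : ℤ, p = γ s + ((k:ℝ), 0)) ↔ p.2 = u p.1 := by
  rcases lt_or_gt_of_ne hd with h | h
  · have e : ∀ p : Pl, (∃ s, ∃ k : ℤ, p = γ (-s) + ((k:ℝ), 0)) ↔ (∃ s, ∃ k : ℤ, p = γ s + ((k:ℝ), 0)) := by
      intro p
      constructor
      · rintro ⟨s, h⟩; exact ⟨-s, h⟩
      · rintro ⟨s, h⟩; exact ⟨-s, by simpa using h⟩
    have := curve_core_pos T (γ := fun s => γ (-s)) (by fun_prop) (d := -d) (by omega) (by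
      intro s
      have := hper (-(s + 1))
      rw [show -(s + 1) + 1 = -s by ring] at this
      rw [this]; ext <;> simp) (by
      intro s s' k hk
      obtain ⟨m, hm⟩ := hinj _ _ _ hk
      exact ⟨-m, by push_cast; linarith⟩) (by simpa only [e] using hinv)
    simpa only [e] using this
  · exact curve_core_pos T hc h hper hinj hinv

lemma coe_eq_iff (a b : ℝ) : ((a : AddCircle (1:ℝ)) = b) ↔ ∃ k : ℤ, a = b + k := by
  rw [← sub_eq_zero, ← AddCircle.coe_sub, AddCircle.coe_eq_zero_iff]
  constructor
  · rintro ⟨n, hn⟩; exact ⟨n, by simp at hn; linarith⟩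
  · rintro ⟨n, hn⟩; exact ⟨n, by simp; linarith⟩

lemma pr_eq_iff (p q : Pl) : pr p = pr q ↔ ∃ k : ℤ, p = q + ((k:ℝ), 0) := by
  unfold pr
  rw [Prod.ext_iff]
  simp only
  rw [coe_eq_iff]
  constructor
  · rintro ⟨⟨k, hk⟩, h⟩; exact ⟨k, Prod.ext hk (by simpa using h)⟩
  · rintro ⟨k, rfl⟩; exact ⟨⟨k, by simp⟩, by simp⟩

lemma pr_surj : Surjective pr := by
  rintro ⟨a, b⟩
  obtain ⟨x, rfl⟩ := QuotientAddGroup.mk_surjective a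
  exact ⟨(x, b), rfl⟩

lemma continuous_pr : Continuous pr := by
  unfold pr
  exact (AddCircle.continuous_mk' 1 |>.comp continuous_fst).prodMk continuous_snd

/-- lifting a map from the line to the circle -/
lemma circle_lift {g : ℝ → AddCircle (1:ℝ)} (hg : Continuous g) : ∃ G : ℝ → ℝ, Continuous G ∧ ∀ s, (G s : AddCircle (1:ℝ)) = g s := by
  have cov := AddCircle.isCoveringMap_coe (1:ℝ)
  obtain ⟨x0, hx0⟩ := QuotientAddGroup.mk_surjective (g 0)
  obtain ⟨G, ⟨-, hG⟩, -⟩ := cov.existsUnique_continuousMap_lifts (A := ℝ) (f := ⟨g, hg⟩) (a₀ := 0) (e₀ := x0) hx0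
  exact ⟨G, G.continuous, fun s => congrFun hG s⟩

lemma int_cont_const {X : Type*} [TopologicalSpace X] [PreconnectedSpace X] {g : X → ℝ} (hg : Continuous g) (hz : ∀ x, ∃ k : ℤ, g x = k) (x y : X) : g x = g y := by
  choose k hk using hz
  have hc : Continuous k := by
    rw [Int.isClosedEmbedding_coe_real.isEmbedding.continuous_iff]
    have : (Int.cast ∘ k : X → ℝ) = g := funext fun x => (hk x).symm
    rw [this]; exact hg
  rw [hk, hk, PreconnectedSpace.constant ‹_› hc (x := x) (y := y)]

/-- lift of a closed curve -/
lemma curve_lift (γ : C(AddCircle (1:ℝ), Ann)) : ∃ Γ : ℝ → Pl, ∃ d : ℤ, Continuous Γ ∧ (∀ s, pr (Γ s) = γ s) ∧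
    ∀ s, Γ (s + 1) = Γ s + ((d:ℝ), 0) := by
  have h0 : Continuous fun s : ℝ => γ (s : AddCircle (1:ℝ)) := γ.continuous.comp (AddCircle.continuous_mk' 1)
  obtain ⟨G, hG, h⟩ := circle_lift (g := fun s : ℝ => (γ (s : AddCircle (1:ℝ))).1) (by fun_prop)
  have e : ∀ s : ℝ, ((s + 1 : ℝ) : AddCircle (1:ℝ)) = (s : AddCircle (1:ℝ)) := fun s => by simp
  have hz : ∀ s, ∃ k : ℤ, G (s + 1) - G s = k := by
    intro s
    have : (G (s + 1) : AddCircle (1:ℝ)) = G s := by rw [h, h, e]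
    obtain ⟨k, hk⟩ := (coe_eq_iff _ _).1 this
    exact ⟨k, by linarith⟩
  obtain ⟨d, hd⟩ := hz 0
  refine ⟨fun s => (G s, (γ (s : AddCircle (1:ℝ))).2), d, by fun_prop, fun s => Prod.ext (h s) rfl, fun s => ?_⟩
  have := int_cont_const (by fun_prop) hz s 0
  simp only [e]
  refine Prod.ext ?_ (by simp)
  simp only [Prod.fst_add]
  linarith

/-- a degree zero curve is null homotopic -/
lemma null_of_deg_zero (γ : C(AddCircle (1:ℝ), Ann)) {Γ : ℝ → Pl} (hc : Continuous Γ)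
    (hp : ∀ s : ℝ, pr (Γ s) = γ s) (h : ∀ s, Γ (s + 1) = Γ s) : ∃ z, γ.Homotopic (ContinuousMap.const _ z) := by
  have hper : Function.Periodic Γ 1 := h
  let G : AddCircle (1:ℝ) → Pl := hper.lift
  have hG : Continuous G := by
    apply continuous_quot_lift _ hc
  have hz : ContinuousMap.Nullhomotopic (⟨G, hG⟩ : C(AddCircle (1:ℝ), Pl)) := by
    obtain ⟨z, hz⟩ := id_nullhomotopic Pl
    refine ⟨z, ?_⟩
    have := ContinuousMap.Homotopic.comp hz (ContinuousMap.Homotopic.refl (⟨G, hG⟩ : C(AddCircle (1:ℝ), Pl)))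
    exact this
  obtain ⟨z, hz⟩ := hz
  refine ⟨pr z, ?_⟩
  have := ContinuousMap.Homotopic.comp (ContinuousMap.Homotopic.refl (⟨pr, continuous_pr⟩ : C(Pl, Ann))) hz
  convert this using 1
  · ext x : 1
    obtain ⟨s, rfl⟩ := QuotientAddGroup.mk_surjective x
    exact (hp s).symm
  · rfl

/-- the invariant essential curves are graphs -/
lemma curve_to_graph (T : TH) {f : Ann → Ann} (hf : ∀ p, pr (T.F p) = f (pr p)) (hfi : Injective f)
    (γ : C(AddCircle (1:ℝ), Ann)) (hγ : EssentialCurve γ) (hi : f '' range γ = range γ) :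
    ∃ u, EpiInv T u ∧ ∀ p : Pl, pr p ∈ range γ ↔ p.2 = u p.1 := by
  obtain ⟨Γ, d, hc, hp, hper⟩ := curve_lift γ
  have hd : d ≠ 0 := by
    rintro rfl
    obtain ⟨z, hz⟩ := null_of_deg_zero γ hc hp (fun s => by rw [hper]; simp [Prod.mk_zero_zero])
    exact hγ.2 z hz
  have hran : ∀ p : Pl, (∃ s, ∃ k : ℤ, p = Γ s + ((k:ℝ), 0)) ↔ pr p ∈ range γ := by
    intro p
    constructor
    · rintro ⟨s, hk⟩
      exact ⟨s, by rw [← hp]; exact ((pr_eq_iff _ _).2 hk).symm⟩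
    · rintro ⟨x, hx⟩
      obtain ⟨s, rfl⟩ := QuotientAddGroup.mk_surjective x
      exact ⟨s, (pr_eq_iff _ _).1 (by rw [hp]; exact hx.symm)⟩
  have := curve_core T hc hd hper (by
    intro s s' k hk
    have h1 : pr (Γ s) = pr (Γ s') := (pr_eq_iff _ _).2 ⟨k, hk⟩
    rw [hp, hp] at h1
    exact (coe_eq_iff _ _).1 (hγ.1.injective h1)) (by
    intro p
    rw [hran, hran, hf]
    constructor
    · intro h
      rw [← hi] at h
      obtain ⟨z, hz, e⟩ := h
      rwa [← hfi e]
    · intro h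
      rw [← hi]; exact ⟨_, h, rfl⟩)
  simpa only [hran] using this

/-- conversely invariant graphs are essential curves -/
lemma graph_to_curve (T : TH) {f : Ann → Ann} (hf : ∀ p, pr (T.F p) = f (pr p)) 
    {u : ℝ → ℝ} (hu : EpiInv T u) :
    ∃ γ : C(AddCircle (1:ℝ), Ann), EssentialCurve γ ∧ f '' range γ = range γ ∧ ∀ p : Pl, pr p ∈ range γ ↔ p.2 = u p.1 := by
  have hper : Function.Periodic u 1 := hu.per
  have huc := hu.cont
  have hU : Continuous (hper.lift : AddCircle (1:ℝ) → ℝ) := continuous_quot_lift _ huc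
  let γ : C(AddCircle (1:ℝ), Ann) := ⟨fun x => (x, hper.lift x), by fun_prop⟩
  have hγ : ∀ s : ℝ, γ (s : AddCircle (1:ℝ)) = pr (s, u s) := fun s => rfl
  have hran : ∀ p : Pl, pr p ∈ range γ ↔ p.2 = u p.1 := by
    intro p
    constructor
    · rintro ⟨x, hx⟩
      obtain ⟨s, rfl⟩ := QuotientAddGroup.mk_surjective x
      obtain ⟨k, hk⟩ := (pr_eq_iff _ _).1 ((hγ s).symm.trans hx)
      have h1 := congrArg Prod.fst hk
      have h2 := congrArg Prod.snd hk
      simp at h1 h2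
      rw [← h2, h1, hu.per_int]
    · intro h
      exact ⟨(p.1 : AddCircle (1:ℝ)), by rw [hγ, ← h]⟩
  refine ⟨γ, ⟨?_, ?_⟩, ?_, hran⟩
  · refine (γ.continuous.isClosedEmbedding ?_).isEmbedding
    intro a b h
    exact congrArg Prod.fst h
  · rintro z ⟨H⟩
    -- project to the circle
    have cov := AddCircle.isCoveringMap_coe (1:ℝ)
    let h : ℝ × ℝ → AddCircle (1:ℝ) := fun q => (H (⟨cl q.1, cl_mem q.1⟩, (q.2 : AddCircle (1:ℝ)))).1
    have hh : Continuous h := by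
      have : Continuous fun q : ℝ × ℝ => ((⟨cl q.1, cl_mem q.1⟩, (q.2 : AddCircle (1:ℝ))) : unitInterval × AddCircle (1:ℝ)) := by
        refine Continuous.prodMk ?_ ((AddCircle.continuous_mk' 1).comp continuous_snd)
        exact Continuous.subtype_mk (continuous_cl.comp continuous_fst) _
      exact continuous_fst.comp (H.continuous.comp this)
    obtain ⟨x0, hx0⟩ := QuotientAddGroup.mk_surjective (h (0, 0))
    obtain ⟨G, ⟨-, hG⟩, -⟩ := cov.existsUnique_continuousMap_lifts (A := ℝ × ℝ) (f := ⟨h, hh⟩) (a₀ := (0, 0)) (e₀ := x0) hx0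
    have hG : ∀ q, (G q : AddCircle (1:ℝ)) = h q := fun q => congrFun hG q
    have hGc := G.continuous
    have hz : ∀ t : ℝ, ∃ k : ℤ, G (t, 1) - G (t, 0) = k := by
      intro t
      have : (G (t, 1) : AddCircle (1:ℝ)) = G (t, 0) := by
        rw [hG, hG]; simp only [h]
        have e : ((1:ℝ) : AddCircle (1:ℝ)) = ((0:ℝ) : AddCircle (1:ℝ)) := by
          rw [coe_eq_iff]; exact ⟨1, by simp⟩
        rw [e]
      obtain ⟨k, hk⟩ := (coe_eq_iff _ _).1 this
      exact ⟨k, by linarith⟩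
    have c1 := int_cont_const (by fun_prop) hz 0 1
    -- at time 0
    have z0 : ∀ s : ℝ, ∃ k : ℤ, G (0, s) - s = k := by
      intro s
      have : (G (0, s) : AddCircle (1:ℝ)) = s := by
        rw [hG]; simp only [h]
        have : (⟨cl 0, cl_mem 0⟩ : unitInterval) = 0 := Subtype.ext (cl_eq (by simp))
        rw [this, H.apply_zero]; rfl
      obtain ⟨k, hk⟩ := (coe_eq_iff _ _).1 this
      exact ⟨k, by linarith⟩
    have d0 := int_cont_const (by fun_prop) z0 1 0
    obtain ⟨w, hw⟩ := QuotientAddGroup.mk_surjective z.1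
    have z1 : ∀ s : ℝ, ∃ k : ℤ, G (1, s) - w = k := by
      intro s
      have : (G (1, s) : AddCircle (1:ℝ)) = w := by
        rw [hG]; simp only [h]
        have : (⟨cl 1, cl_mem 1⟩ : unitInterval) = 1 := Subtype.ext (cl_eq (by simp))
        rw [this, H.apply_one]; exact hw.symm
      obtain ⟨k, hk⟩ := (coe_eq_iff _ _).1 this
      exact ⟨k, by linarith⟩
    have d1 := int_cont_const (by fun_prop) z1 1 0
    linarith
  · ext z
    obtain ⟨p, rfl⟩ := pr_surj z
    rw [hran]
    constructor
    · rintro ⟨w, hw, e⟩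
      obtain ⟨q, rfl⟩ := pr_surj w
      rw [← hf] at e
      rw [hran] at hw
      have := (hran (T.F q)).2 ((hu.gr q).2 hw)
      rw [e] at this
      exact (hran p).1 this
    · intro h
      refine ⟨pr (T.F.symm p), ?_, ?_⟩
      · rw [hran, ← hu.gr]; simpa using h
      · rw [← hf]; simp

/-- the union of invariant curves -/
lemma mem_invCurveUnion (T : TH) {f : Ann → Ann} (hf : ∀ p, pr (T.F p) = f (pr p)) (hfi : Injective f) (p : Pl) :
    pr p ∈ invCurveUnion f ↔ ∃ u, EpiInv T u ∧ p.2 = u p.1 := by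
  unfold invCurveUnion
  simp only [mem_iUnion, mem_setOf_eq]
  constructor
  · rintro ⟨γ, ⟨h1, h2⟩, h3⟩
    obtain ⟨u, hu, h⟩ := curve_to_graph T hf hfi γ h1 h2
    exact ⟨u, hu, (h p).1 h3⟩
  · rintro ⟨u, hu, h⟩
    obtain ⟨γ, h1, h2, h3⟩ := graph_to_curve T hf hu
    exact ⟨γ, ⟨h1, h2⟩, (h3 p).2 h⟩


end

section

/-- determinant of a linear map of the plane -/
def det2 (L : Pl →L[ℝ] Pl) : ℝ := (L (1, 0)).1 * (L (0, 1)).2 - (L (0, 1)).1 * (L (1, 0)).2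

lemma lin_exp (L : Pl →L[ℝ] Pl) (w : Pl) : L w = w.1 • L (1, 0) + w.2 • L (0, 1) := by
  rw [← map_smul, ← map_smul, ← map_add]; congr 1; ext <;> simp

lemma det2_comp (L M : Pl →L[ℝ] Pl) : det2 (L.comp M) = det2 L * det2 M := by
  unfold det2
  simp only [ContinuousLinearMap.comp_apply]
  rw [lin_exp L (M (1, 0)), lin_exp L (M (0, 1))]
  simp only [Prod.fst_add, Prod.snd_add, Prod.smul_fst, Prod.smul_snd, smul_eq_mul]
  ring

lemma det2_id : det2 (ContinuousLinearMap.id ℝ Pl) = 1 := by simp [det2]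

lemma continuous_det2 : Continuous det2 := by
  unfold det2
  fun_prop

lemma isOpenMap_pr : IsOpenMap pr := by
  have h : IsOpenMap ((↑) : ℝ → AddCircle (1:ℝ)) := QuotientAddGroup.isOpenMap_coe
  exact h.prodMap IsOpenMap.id

lemma isQuotientMap_pr : IsQuotientMap pr :=
  isOpenMap_pr.isQuotientMap continuous_pr pr_surj

/-- a homeomorphism of the plane commuting with translations descends -/
def descend (F : Pl ≃ₜ Pl) (hp : ∀ p, F (p + (1, 0)) = F p + (1, 0)) (f : Ann → Ann) (hf : ∀ p, pr (F p) = f (pr p)) :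
    Ann ≃ₜ Ann :=
  Equiv.toHomeomorphOfContinuousOpen (Equiv.ofBijective f (by
    constructor
    · intro a b h
      obtain ⟨p, rfl⟩ := pr_surj a
      obtain ⟨q, rfl⟩ := pr_surj b
      rw [← hf, ← hf, pr_eq_iff] at h
      obtain ⟨k, hk⟩ := h
      rw [← per_int hp] at hk
      exact (pr_eq_iff _ _).2 ⟨k, F.injective hk⟩
    · intro a
      obtain ⟨p, rfl⟩ := pr_surj a
      exact ⟨pr (F.symm p), by rw [← hf]; simp⟩)) (by
    rw [isQuotientMap_pr.continuous_iff]
    have : f ∘ pr = pr ∘ F := funext fun p => (hf p).symm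
    change Continuous (f ∘ pr)
    rw [this]; exact continuous_pr.comp F.continuous) (by
    intro O hO
    have : (f '' O) = pr '' (F '' (pr ⁻¹' O)) := by
      ext z
      constructor
      · rintro ⟨w, hw, rfl⟩
        obtain ⟨p, rfl⟩ := pr_surj w
        exact ⟨F p, ⟨p, hw, rfl⟩, hf p⟩
      · rintro ⟨_, ⟨p, hp, rfl⟩, rfl⟩
        exact ⟨pr p, hp, (hf p).symm⟩
    change IsOpen (f '' O)
    rw [this]
    exact isOpenMap_pr _ (F.isOpenMap _ (hO.preimage continuous_pr)))

lemma descend_coe (F : Pl ≃ₜ Pl) (hp) (f : Ann → Ann) (hf) : (descend F hp f hf : Ann → Ann) = f := rfl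

lemma iter_per {F : Pl → Pl} (hp : ∀ p, F (p + (1, 0)) = F p + (1, 0)) (n : ℕ) (p : Pl) :
    F^[n] (p + (1, 0)) = F^[n] p + (1, 0) := by
  induction n generalizing p with
  | zero => rfl
  | succ n ih => rw [iterate_succ_apply, hp, ih, ← iterate_succ_apply]

lemma iter_lift {F : Pl → Pl} {f : Ann → Ann} (hf : ∀ p, pr (F p) = f (pr p)) (n : ℕ) (p : Pl) :
    pr (F^[n] p) = f^[n] (pr p) := by
  induction n generalizing p with
  | zero => rfl
  | succ n ih => rw [iterate_succ_apply, ih, hf, ← iterate_succ_apply]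

lemma strip_finite (M : ℝ) : volume {z : Ann | |z.2| ≤ M} < ⊤ := by
  have : {z : Ann | |z.2| ≤ M} = univ ×ˢ Icc (-M) M := by
    ext z; simp [abs_le]
  rw [this, Measure.volume_eq_prod, Measure.prod_prod]
  exact ENNReal.mul_lt_top (measure_lt_top _ _) (by simp)

lemma image_iter_measure (h : Ann ≃ₜ Ann) (hm : MeasurePreserving h volume volume) (n : ℕ) (s : Set Ann) :
    volume (h^[n] '' s) = volume s := by
  induction n with
  | zero => simp
  | succ n ih =>
    rw [iterate_succ', image_comp, ← ih]
    have := hm.measure_preimage_emb h.measurableEmbedding (h '' (h^[n] '' s))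
    rw [← this, preimage_image_eq _ h.injective]

lemma nw_gen (F : Pl ≃ₜ Pl) (h : Ann ≃ₜ Ann) (hf : ∀ p, pr (F p) = h (pr p))
    (hm : MeasurePreserving h volume volume) (N : Set Pl) (hN : IsOpen N) (hne : N.Nonempty)
    (hb : ∃ M : ℝ, ∀ n : ℕ, ∀ p ∈ N, |(F^[n] p).2| ≤ M) :
    ∃ n : ℕ, ∃ k : ℤ, ∃ p ∈ N, F^[n + 1] p - ((k:ℝ), (0:ℝ)) ∈ N := by
  obtain ⟨M, hM⟩ := hb
  have hO : IsOpen (pr '' N) := isOpenMap_pr _ hN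
  have hpos : 0 < volume (pr '' N) := hO.measure_pos _ (hne.image _)
  have hopen : ∀ n, IsOpen (h^[n] '' (pr '' N)) := by
    intro n
    induction n with
    | zero => simpa using hO
    | succ n ih => rw [iterate_succ', image_comp]; exact h.isOpenMap _ ih
  have hsub : ∀ n, h^[n] '' (pr '' N) ⊆ {z : Ann | |z.2| ≤ M} := by
    rintro n _ ⟨_, ⟨p, hp, rfl⟩, rfl⟩
    have := hM n p hp
    rw [← iter_lift hf]; exact this
  obtain ⟨i, j, hij, z, hz1, hz2⟩ := exists_nonempty_inter_of_measure_univ_lt_tsum_measure (volume.restrict {z : Ann | |z.2| ≤ M})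
    (s := fun n => h^[n] '' (pr '' N)) (fun n => (hopen n).measurableSet.nullMeasurableSet) (by
      have : ∀ n, (volume.restrict {z : Ann | |z.2| ≤ M}) (h^[n] '' (pr '' N)) = volume (pr '' N) := by
        intro n
        rw [Measure.restrict_apply (hopen n).measurableSet, inter_eq_left.2 (hsub n), image_iter_measure h hm]
      simp only [this]
      rw [ENNReal.tsum_const_eq_top_of_ne_zero hpos.ne', Measure.restrict_apply_univ]
      exact strip_finite M)
  wlog hlt : i < j generalizing i j
  · exact this j i hij.symm hz2 hz1 (lt_of_le_of_ne (not_lt.1 hlt) hij.symm)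
  obtain ⟨_, ⟨p, hp, rfl⟩, e1⟩ := hz1
  obtain ⟨_, ⟨q, hq, rfl⟩, e2⟩ := hz2
  obtain ⟨m, rfl⟩ : ∃ m, j = i + (m + 1) := ⟨j - i - 1, by omega⟩
  rw [← e1, iterate_add_apply] at e2
  have e3 := (h.injective.iterate i) e2
  rw [← iter_lift hf, pr_eq_iff] at e3
  obtain ⟨k, hk⟩ := e3
  exact ⟨m, k, q, hq, by rw [hk]; simpa using hp⟩

namespace IsotopySetup
variable (S : IsotopySetup)

lemma contDiff_F : ContDiff ℝ 1 S.F := S.Ft_smooth 1 (by simp)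

lemma exists_inv : ∃ G : Pl → Pl, ContDiff ℝ 1 G ∧ LeftInverse G S.F ∧ RightInverse G S.F :=
  S.Ft_diffeo 1 (by simp)

/-- the lift as a homeomorphism -/
def FH : Pl ≃ₜ Pl where
  toFun := S.F
  invFun := S.exists_inv.choose
  left_inv := S.exists_inv.choose_spec.2.1
  right_inv := S.exists_inv.choose_spec.2.2
  continuous_toFun := S.contDiff_F.continuous
  continuous_invFun := S.exists_inv.choose_spec.1.continuous

lemma FH_coe : (S.FH : Pl → Pl) = S.F := rfl

lemma contDiff_symm : ContDiff ℝ 1 S.FH.symm := S.exists_inv.choose_spec.1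

lemma F_per (p : Pl) : S.F (p + (1, 0)) = S.F p + (1, 0) := S.Ft_periodic 1 p

lemma det_ne (t : ℝ) (ht : t ∈ Icc (0:ℝ) 1) (p : Pl) : det2 (fderiv ℝ (S.Ft t) p) ≠ 0 := by
  obtain ⟨G, hG, h1, -⟩ := S.Ft_diffeo t ht
  have hd : DifferentiableAt ℝ (S.Ft t) p := (S.Ft_smooth t ht).differentiable (by norm_num) p
  have hd' : DifferentiableAt ℝ G (S.Ft t p) := hG.differentiable (by norm_num) _
  have h2 := fderiv_comp p hd' hd
  have : G ∘ S.Ft t = id := funext h1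
  rw [this, fderiv_id] at h2
  have h3 := congrArg det2 h2
  rw [det2_id, det2_comp] at h3
  intro h
  rw [h] at h3; simp at h3

lemma cont_DFt_t (p : Pl) : ContinuousOn (fun t => fderiv ℝ (S.Ft t) p) (Icc 0 1) :=
  S.DFt_cont.comp (f := fun t : ℝ => (t, p)) (by fun_prop) (fun t ht => ⟨ht, mem_univ _⟩)

lemma det_pos (p : Pl) : 0 < det2 (fderiv ℝ S.F p) := by
  by_contra h
  have hc : ContinuousOn (fun t => det2 (fderiv ℝ (S.Ft t) p)) (Icc 0 1) := continuous_det2.comp_continuousOn (S.cont_DFt_t p)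
  have h0 : det2 (fderiv ℝ (S.Ft 0) p) = 1 := by rw [S.Ft_zero, fderiv_id, det2_id]
  obtain ⟨t, ht, h1⟩ := intermediate_value_Icc' (zero_le_one) hc (show (0:ℝ) ∈ _ from ⟨not_lt.1 h, by rw [h0]; norm_num⟩)
  exact S.det_ne t ht p h1

/-- the homeomorphism of the annulus -/
def fH : Ann ≃ₜ Ann := descend S.FH S.F_per S.f S.lift_f

lemma fH_coe : (S.fH : Ann → Ann) = S.f := rfl

lemma hasFDerivAt_F (p : Pl) : HasFDerivAt S.F (fderiv ℝ S.F p) p :=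
  (S.contDiff_F.differentiable (by norm_num) p).hasFDerivAt

lemma deriv_vert {G : Pl → Pl} {L : Pl →L[ℝ] Pl} {x y : ℝ} (h : HasFDerivAt G L (x, y)) :
    HasDerivAt (fun y => (G (x, y)).1) (L (0, 1)).1 y := by
  have h1 : HasDerivAt (fun y : ℝ => (x, y)) ((0:ℝ), (1:ℝ)) y := (hasDerivAt_const y x).prodMk (hasDerivAt_id y)
  have h2 := h.comp_hasDerivAt y h1
  exact (hasFDerivAt_fst (𝕜 := ℝ) (p := G (x, y))).comp_hasDerivAt y h2

variable {S}

lemma tw_pos (ht : S.PosTwist) (p : Pl) : 0 < (fderiv ℝ S.F p (0, 1)).1 := by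
  have h1 := (ht p.1).2.2 p.2
  rwa [(deriv_vert (S.hasFDerivAt_F (p.1, p.2))).deriv] at h1

lemma inv_fst {L M : Pl →L[ℝ] Pl} (h : L.comp M = ContinuousLinearMap.id ℝ Pl) :
    (M (0, 1)).1 * det2 L = - (L (0, 1)).1 := by
  have := congrArg (fun A : Pl →L[ℝ] Pl => A (0, 1)) h
  simp only [ContinuousLinearMap.comp_apply, ContinuousLinearMap.id_apply] at this
  rw [lin_exp L] at this
  have h1 := congrArg Prod.fst this
  have h2 := congrArg Prod.snd this
  simp only [Prod.fst_add, Prod.snd_add, Prod.smul_fst, Prod.smul_snd, smul_eq_mul] at h1 h2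
  unfold det2
  linear_combination (L (0, 1)).2 * h1 - (L (0, 1)).1 * h2

lemma symm_tw_neg (ht : S.PosTwist) (p : Pl) : (fderiv ℝ S.FH.symm p (0, 1)).1 < 0 := by
  have hd : DifferentiableAt ℝ S.FH.symm p := S.contDiff_symm.differentiable (by norm_num) p
  have h := fderiv_comp p (S.hasFDerivAt_F (S.FH.symm p)).differentiableAt hd
  have : S.F ∘ S.FH.symm = id := funext fun q => S.FH.apply_symm_apply q
  rw [this, fderiv_id] at h
  have := inv_fst h.symm
  have h1 := S.det_pos (S.FH.symm p)
  have h2 := tw_pos ht (S.FH.symm p)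
  nlinarith

lemma symm_preserving (hpres : MeasurePreserving S.f volume volume) : MeasurePreserving S.fH.symm volume volume := by
  have : MeasurePreserving S.fH.toMeasurableEquiv volume volume := hpres
  exact this.symm

lemma lift_symm (p : Pl) : pr (S.FH.symm p) = S.fH.symm (pr p) := by
  apply S.fH.injective
  rw [S.fH.apply_symm_apply, fH_coe, ← S.lift_f]
  exact congrArg pr (S.FH.apply_symm_apply p)

/-- the abstract twist homeomorphism -/
def th (ht : S.PosTwist) (hpres : MeasurePreserving S.f volume volume) : TH where
  F := S.FH
  per := S.F_per
  tw := fun x => (ht x).1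
  tws := fun x => (ht x).2.1
  tw' := fun x => strictAnti_of_deriv_neg fun y => by
    rw [(deriv_vert (S.contDiff_symm.differentiable (by norm_num) (x, y)).hasFDerivAt).deriv]
    exact symm_tw_neg ht _
  tws' := fun x x0 => by
    obtain ⟨Y, hY⟩ := (ht x0).2.1 x
    refine ⟨(S.F (x0, Y)).2, ?_⟩
    have : (x, (S.F (x0, Y)).2) = S.FH (x0, Y) := Prod.ext hY.symm rfl
    simp only [this, Homeomorph.symm_apply_apply]
  nw := nw_gen S.FH S.fH S.lift_f hpres
  nw' := nw_gen S.FH.symm S.fH.symm lift_symm (symm_preserving hpres)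

lemma th_F (ht : S.PosTwist) (hpres : MeasurePreserving S.f volume volume) : ((th ht hpres).F : Pl → Pl) = S.F := rfl

lemma mem_inv_iff (ht : S.PosTwist) (hpres : MeasurePreserving S.f volume volume) (p : Pl) :
    pr p ∈ invCurveUnion S.f ↔ ∃ u, EpiInv (th ht hpres) u ∧ p.2 = u p.1 :=
  mem_invCurveUnion (th ht hpres) S.lift_f S.fH.injective p

end IsotopySetup


end

section

lemma det2_inj {L : Pl →L[ℝ] Pl} (h : det2 L ≠ 0) {w : Pl} (hw : L w = 0) : w = 0 := by
  rw [lin_exp] at hw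
  have h1 := congrArg Prod.fst hw
  have h2 := congrArg Prod.snd hw
  simp only [Prod.fst_add, Prod.snd_add, Prod.smul_fst, Prod.smul_snd, smul_eq_mul, Prod.fst_zero, Prod.snd_zero] at h1 h2
  have e1 : w.1 * det2 L = 0 := by unfold det2; linear_combination (L (0,1)).2 * h1 - (L (0,1)).1 * h2
  have e2 : w.2 * det2 L = 0 := by unfold det2; linear_combination (L (1,0)).1 * h2 - (L (1,0)).2 * h1
  exact Prod.ext ((mul_eq_zero.1 e1).resolve_right h) ((mul_eq_zero.1 e2).resolve_right h)

/-- two continuous angles which agree at time zero agree at time one -/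
lemma ang_unique {X : ℝ → Pl} {a b : ℝ → ℝ} (ha : ContinuousOn a (Icc 0 1)) (hb : ContinuousOn b (Icc 0 1))
    (h1 : ∀ t ∈ Icc (0:ℝ) 1, IsAng (X t) (a t)) (h2 : ∀ t ∈ Icc (0:ℝ) 1, IsAng (X t) (b t)) (h0 : a 0 = b 0) :
    a 1 = b 1 := by
  have := lifts_diff (isPreconnected_Icc (a := (0:ℝ)) (b := 1)) ha hb (fun t ht => (h1 t ht).int_diff (h2 t ht))
    (x := 0) (y := 1) (by simp) (by simp)
  linarith

namespace IsotopySetup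
variable (S : IsotopySetup)

lemma cont_DF : Continuous fun q : ℝ × Pl => fderiv ℝ (S.Ft (cl q.1)) q.2 := by
  have h : Continuous fun q : ℝ × Pl => (cl q.1, q.2) := (continuous_cl.comp continuous_fst).prodMk continuous_snd
  have := S.DFt_cont.comp_continuous h (fun q => ⟨cl_mem _, mem_univ _⟩)
  exact this

lemma cont_Ft : Continuous fun q : ℝ × Pl => S.Ft (cl q.1) q.2 := by
  have h : Continuous fun q : ℝ × Pl => (cl q.1, q.2) := (continuous_cl.comp continuous_fst).prodMk continuous_snd
  have := S.Ft_cont.comp_continuous h (fun q => ⟨cl_mem _, mem_univ _⟩)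
  exact this

lemma Ft_inj (t : ℝ) (ht : t ∈ Icc (0:ℝ) 1) : Injective (S.Ft t) := by
  obtain ⟨G, -, h, -⟩ := S.Ft_diffeo t ht
  exact h.injective

lemma exists_vth : ∃ Θ : ℝ × Pl × ℝ → ℝ, Continuous Θ ∧ (∀ p θ, Θ (0, p, θ) = θ) ∧
    ∀ t p θ, IsAng (fderiv ℝ (S.Ft (cl t)) p (dirv θ)) (Θ (t, p, θ)) := by
  obtain ⟨Θ, hc, h0, h⟩ := angle_lift (X := ℝ × Pl × ℝ) (fun q => fderiv ℝ (S.Ft (cl q.1)) q.2.1 (dirv q.2.2))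
    (by
      have h1 : Continuous fun q : ℝ × Pl × ℝ => fderiv ℝ (S.Ft (cl q.1)) q.2.1 :=
        S.cont_DF.comp (by fun_prop : Continuous fun q : ℝ × Pl × ℝ => (q.1, q.2.1))
      exact h1.clm_apply (continuous_dirv.comp (by fun_prop)))
    (fun q h => dirv_ne _ (det2_inj (S.det_ne _ (cl_mem _) _) h)) (0, 0, 0) 0 (by
      simp only [cl_eq (show (0:ℝ) ∈ Icc (0:ℝ) 1 by simp), S.Ft_zero, fderiv_id]
      exact isAng_dirv 0)
  refine ⟨Θ, hc, ?_, fun t p θ => h (t, p, θ)⟩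
  intro p θ
  have := int_cont_const (X := Pl × ℝ) (g := fun q => Θ (0, q.1, q.2) - q.2) (by fun_prop) (by
    intro q
    have h1 := h (0, q.1, q.2)
    simp only [cl_eq (show (0:ℝ) ∈ Icc (0:ℝ) 1 by simp), S.Ft_zero, fderiv_id] at h1
    obtain ⟨k, hk⟩ := (isAng_dirv q.2).int_diff h1
    exact ⟨k, by linarith⟩) (p, θ) (0, 0)
  simp only at this
  rw [h0] at this
  linarith

/-- the lifted angle -/
def vth : ℝ × Pl × ℝ → ℝ := S.exists_vth.choose
lemma cont_vth : Continuous S.vth := S.exists_vth.choose_spec.1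
lemma vth_zero (p : Pl) (θ : ℝ) : S.vth (0, p, θ) = θ := S.exists_vth.choose_spec.2.1 p θ
lemma vth_ang (t : ℝ) (p : Pl) (θ : ℝ) : IsAng (fderiv ℝ (S.Ft (cl t)) p (dirv θ)) (S.vth (t, p, θ)) :=
  S.exists_vth.choose_spec.2.2 t p θ

lemma vth_half (t : ℝ) (p : Pl) (θ : ℝ) : S.vth (t, p, θ + 1/2) = S.vth (t, p, θ) + 1/2 := by
  have hc := S.cont_vth
  have := int_cont_const (X := ℝ) (g := fun t => S.vth (t, p, θ + 1/2) - (S.vth (t, p, θ) + 1/2)) (by fun_prop) (by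
    intro t
    have h1 := (S.vth_ang t p θ).neg
    rw [← map_neg, ← dirv_half] at h1
    obtain ⟨k, hk⟩ := h1.int_diff (S.vth_ang t p (θ + 1/2))
    exact ⟨k, by linarith⟩) t 0
  simp only [vth_zero] at this
  linarith

lemma vth_int (t : ℝ) (p : Pl) (θ : ℝ) (k : ℤ) : S.vth (t, p, θ + k / 2) = S.vth (t, p, θ) + k / 2 := by
  induction k using Int.induction_on with
  | zero => simp
  | succ n ih =>
    have : θ + (((n:ℤ) + 1 : ℤ) : ℝ) / 2 = (θ + ((n:ℤ):ℝ) / 2) + 1/2 := by push_cast; ring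
    rw [this, vth_half, ih]; push_cast; ring
  | pred n ih =>
    have : θ + ((-(n:ℤ) : ℤ) : ℝ) / 2 = (θ + ((-(n:ℤ) - 1 : ℤ):ℝ) / 2) + 1/2 := by push_cast; ring
    rw [this, vth_half] at ih
    have e : ((-(n:ℤ) - 1 : ℤ):ℝ) / 2 = ((-(n:ℤ) : ℤ) : ℝ) / 2 - 1/2 := by push_cast; ring
    rw [e] at ih ⊢
    linarith

lemma vth_per (t : ℝ) (p : Pl) (θ : ℝ) : S.vth (t, p + (1, 0), θ) = S.vth (t, p, θ) := by
  have hc := S.cont_vth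
  have hD : ∀ t, fderiv ℝ (S.Ft t) (p + (1, 0)) = fderiv ℝ (S.Ft t) p := by
    intro t
    have h1 : (fun q => S.Ft t (q + (1, 0))) = fun q => S.Ft t q + (1, 0) := funext (S.Ft_periodic t)
    have h2 := congrArg (fun g => fderiv ℝ g p) h1
    simp only [fderiv_comp_add_right, fderiv_add_const] at h2
    exact h2
  have := int_cont_const (X := ℝ) (g := fun t => S.vth (t, p + (1, 0), θ) - S.vth (t, p, θ)) (by fun_prop) (by
    intro t
    have h1 := S.vth_ang t (p + (1, 0)) θ
    rw [hD] at h1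
    obtain ⟨k, hk⟩ := (S.vth_ang t p θ).int_diff h1
    exact ⟨k, by linarith⟩) t 0
  simp only [vth_zero] at this
  linarith

lemma vth_mono (t : ℝ) (p : Pl) : StrictMono fun θ => S.vth (t, p, θ) := by
  have hc := S.cont_vth
  have hinj : Injective fun θ => S.vth (t, p, θ) := by
    intro a b h
    simp only at h
    obtain ⟨r, hr, e1⟩ := S.vth_ang t p a
    obtain ⟨r', hr', e2⟩ := S.vth_ang t p b
    rw [h] at e1
    have e3 : fderiv ℝ (S.Ft (cl t)) p (r' • dirv a - r • dirv b) = 0 := by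
      rw [map_sub, map_smul, map_smul, e1, e2, smul_comm, sub_self]
    have e4 := sub_eq_zero.1 (det2_inj (S.det_ne _ (cl_mem _) _) e3)
    have i1 : IsAng (r' • dirv a) a := (isAng_dirv a).smul hr'
    have i2 : IsAng (r' • dirv a) b := by rw [e4]; exact (isAng_dirv b).smul hr
    obtain ⟨k, hk⟩ := i1.int_diff i2
    have := S.vth_int t p a (2 * k)
    rw [show a + ((2 * k : ℤ) : ℝ) / 2 = b by rw [hk]; push_cast; ring, ← h] at this
    push_cast at this
    rw [hk]; linarith
  rcases Continuous.strictMono_of_inj (f := fun θ => S.vth (t, p, θ)) (by fun_prop) hinj with h | h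
  · exact h
  · exfalso
    have := h (show (0:ℝ) < 0 + 1/2 by norm_num)
    simp only [vth_half] at this
    linarith

/-- the skew product -/
def Psi (q : Pl × ℝ) : Pl × ℝ := (S.F q.1, S.vth (1, q.1, q.2))

/-- the angle after `n` steps -/
def ang (n : ℕ) (p : Pl) (θ : ℝ) : ℝ := (S.Psi^[n] (p, θ)).2

lemma Psi_fst (n : ℕ) (q : Pl × ℝ) : (S.Psi^[n] q).1 = S.F^[n] q.1 := by
  induction n with
  | zero => rfl
  | succ n ih => rw [iterate_succ_apply', iterate_succ_apply', ← ih]; rfl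

lemma ang_zero (p : Pl) (θ : ℝ) : S.ang 0 p θ = θ := rfl

lemma ang_succ (n : ℕ) (p : Pl) (θ : ℝ) : S.ang (n + 1) p θ = S.vth (1, S.F^[n] p, S.ang n p θ) := by
  unfold ang
  rw [iterate_succ_apply']
  have : S.F^[n] p = (S.Psi^[n] (p, θ)).1 := (S.Psi_fst n (p, θ)).symm
  rw [this]; rfl

lemma ang_add (m n : ℕ) (p : Pl) (θ : ℝ) : S.ang (m + n) p θ = S.ang m (S.F^[n] p) (S.ang n p θ) := by
  unfold ang
  rw [iterate_add_apply]
  have : S.F^[n] p = (S.Psi^[n] (p, θ)).1 := (S.Psi_fst n (p, θ)).symm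
  rw [this]

lemma ang_int (n : ℕ) (p : Pl) (θ : ℝ) (k : ℤ) : S.ang n p (θ + k / 2) = S.ang n p θ + k / 2 := by
  induction n with
  | zero => rfl
  | succ n ih => rw [ang_succ, ih, vth_int, ang_succ]

lemma ang_mono (n : ℕ) (p : Pl) : StrictMono (S.ang n p) := by
  induction n with
  | zero => exact fun a b h => h
  | succ n ih =>
    intro a b h
    rw [ang_succ, ang_succ]; exact S.vth_mono _ _ (ih h)

lemma cont_ang (n : ℕ) : Continuous fun q : Pl × ℝ => S.ang n q.1 q.2 := by
  have h1 := S.cont_vth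
  have h2 := S.contDiff_F.continuous
  have : Continuous S.Psi := by unfold Psi; fun_prop
  exact continuous_snd.comp (this.iterate n)

lemma ang_per (n : ℕ) (p : Pl) (θ : ℝ) : S.ang n (p + (1, 0)) θ = S.ang n p θ := by
  induction n with
  | zero => rfl
  | succ n ih => rw [ang_succ, ang_succ, ih, iter_per S.F_per, vth_per]

lemma contDiff_iter (n : ℕ) : ContDiff ℝ 1 (S.F^[n]) := by
  induction n with
  | zero => exact contDiff_id
  | succ n ih => rw [iterate_succ']; exact S.contDiff_F.comp ih

lemma fderiv_iter_succ (n : ℕ) (p : Pl) :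
    fderiv ℝ (S.F^[n + 1]) p = (fderiv ℝ S.F (S.F^[n] p)).comp (fderiv ℝ (S.F^[n]) p) := by
  rw [iterate_succ']
  exact fderiv_comp p (S.contDiff_F.differentiable (by norm_num) _) ((S.contDiff_iter n).differentiable (by norm_num) _)

lemma isAng_lin {L : Pl →L[ℝ] Pl} {w : Pl} {θ α : ℝ} (h : IsAng w θ) (h' : IsAng (L (dirv θ)) α) : IsAng (L w) α := by
  obtain ⟨r, hr, rfl⟩ := h
  rw [map_smul]; exact h'.smul hr

lemma cl_one : cl 1 = 1 := cl_eq (by simp)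
lemma cl_zero : cl 0 = 0 := cl_eq (by simp)

lemma ang_isAng (n : ℕ) (p : Pl) {w : Pl} {θ : ℝ} (h : IsAng w θ) : IsAng (fderiv ℝ (S.F^[n]) p w) (S.ang n p θ) := by
  induction n with
  | zero => simpa [ang_zero] using h
  | succ n ih =>
    rw [fderiv_iter_succ, ang_succ]
    have := S.vth_ang 1 (S.F^[n] p) (S.ang n p θ)
    rw [cl_one] at this
    exact isAng_lin (L := fderiv ℝ S.F (S.F^[n] p)) ih this

lemma angleVar_self (p : Pl) {w : Pl} {θ : ℝ} (h : IsAng w θ) (n : ℕ) : S.AngleVar p w n (S.ang n p θ - θ) := by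
  have hc := S.cont_vth
  let Θ : ℕ → ℝ → ℝ := fun N t => θ + ∑ k ∈ Finset.range N, (S.vth (cl (t - k), S.F^[k] p, S.ang k p θ) - S.ang k p θ)
  have hΘc : Continuous (Θ (n + 1)) := by
    have := continuous_cl
    fun_prop
  have full : ∀ (m : ℕ) (t : ℝ), (m:ℝ) ≤ t → Θ m t = S.ang m p θ := by
    intro m
    induction m with
    | zero => intro t _; simp [Θ, ang_zero]
    | succ m ih =>
      intro t ht
      push_cast at ht
      have h1 := ih t (by linarith)
      simp only [Θ] at h1 ⊢
      rw [Finset.sum_range_succ, ← add_assoc, h1, ang_succ]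
      have : cl (t - m) = 1 := by unfold cl; rw [min_eq_left (by linarith)]; norm_num
      rw [this]; ring
  have val : ∀ (m N : ℕ), m < N → ∀ t : ℝ, (m:ℝ) ≤ t → t ≤ m + 1 → Θ N t = S.vth (t - m, S.F^[m] p, S.ang m p θ) := by
    intro m N hN
    induction N, (show m + 1 ≤ N from hN) using Nat.le_induction with
    | base =>
      intro t h1 h2
      have h3 := full m t h1
      simp only [Θ] at h3 ⊢
      rw [Finset.sum_range_succ, ← add_assoc, h3, cl_eq ⟨by linarith, by linarith⟩]; ring
    | succ N hN' ih =>
      intro t h1 h2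
      have h3 := ih hN' t h1 h2
      simp only [Θ] at h3 ⊢
      have hNm : (m:ℝ) + 1 ≤ N := by exact_mod_cast hN'
      have : cl (t - N) = 0 := by
        unfold cl; rw [min_eq_right (by linarith), max_eq_left (by linarith)]
      rw [Finset.sum_range_succ, ← add_assoc, h3, this, vth_zero]; ring
  refine ⟨Θ (n + 1), hΘc.continuousOn, ?_, ?_⟩
  · intro t ht
    have hm : ⌊t⌋₊ ≤ n := by
      have := Nat.floor_le ht.1
      exact_mod_cast (this.trans ht.2)
    have hv := val ⌊t⌋₊ (n + 1) (by omega) t (Nat.floor_le ht.1) (Nat.lt_floor_add_one t).le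
    rw [hv]
    have hfr : Int.fract t = t - ⌊t⌋₊ := by
      rw [Int.fract, ← natCast_floor_eq_intCast_floor ht.1]
    have h1 := S.ang_isAng ⌊t⌋₊ p h
    have h2 := S.vth_ang (t - ⌊t⌋₊) (S.F^[⌊t⌋₊] p) (S.ang ⌊t⌋₊ p θ)
    rw [← hfr, cl_eq ⟨Int.fract_nonneg t, (Int.fract_lt_one t).le⟩] at h2
    have h3 := isAng_lin h1 h2
    rw [← hfr]
    exact h3
  · rw [val n (n + 1) (by omega) n le_rfl (by linarith), val 0 (n + 1) (by omega) 0 (by simp) (by simp)]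
    simp [vth_zero, ang_zero]

lemma angleVar_iff (p : Pl) {w : Pl} {θ : ℝ} (h : IsAng w θ) (n : ℕ) (a : ℝ) :
    S.AngleVar p w n a ↔ a = S.ang n p θ - θ := by
  constructor
  · rintro ⟨Θ, h1, h2, rfl⟩
    obtain ⟨Θ', h1', h2', e⟩ := S.angleVar_self p h n
    rw [e]
    have := lifts_diff (isPreconnected_Icc (a := (0:ℝ)) (b := n)) h1 h1'
      (fun t ht => IsAng.int_diff (w := S.D t p w) (h2 t ht) (h2' t ht))
      (x := 0) (y := n) (by simp) (by simp)
    linarith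
  · rintro rfl; exact S.angleVar_self p h n

end IsotopySetup


end

section

namespace IsotopySetup
variable (S : IsotopySetup)

/-- averaged derivative in the vertical direction -/
def Mv (p : Pl) (q : ℝ × ℝ) : Pl := ∫ s in (0:ℝ)..1, fderiv ℝ (S.Ft (cl q.1)) (p + (0, s * cl q.2)) (0, 1)

lemma cont_Mv (p : Pl) : Continuous (S.Mv p) := by
  unfold Mv
  apply intervalIntegral.continuous_parametric_intervalIntegral_of_continuous' (f := fun (q : ℝ × ℝ) s => fderiv ℝ (S.Ft (cl q.1)) (p + (0, s * cl q.2)) (0, 1))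
  have h1 := continuous_cl
  have h : Continuous fun q : (ℝ × ℝ) × ℝ => (q.1.1, p + (0, q.2 * cl q.1.2)) := by fun_prop
  exact (S.cont_DF.comp h).clm_apply continuous_const

lemma Mv_eq (p : Pl) (t h : ℝ) : (cl h) • S.Mv p (t, h) = S.Ft (cl t) (p + (0, cl h)) - S.Ft (cl t) p := by
  have hd : ∀ s ∈ uIcc (0:ℝ) 1, HasDerivAt (fun s => S.Ft (cl t) (p + (0, s * cl h)))
      ((cl h) • fderiv ℝ (S.Ft (cl t)) (p + (0, s * cl h)) (0, 1)) s := by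
    intro s _
    have h0 := ((S.Ft_smooth _ (cl_mem t)).differentiable (by norm_num) (p + (0, s * cl h))).hasFDerivAt
    have h1 : HasDerivAt (fun s : ℝ => p + ((0:ℝ), s * cl h)) ((0:ℝ), cl h) s := by
      have : HasDerivAt (fun s : ℝ => ((0:ℝ), s * cl h)) ((0:ℝ), 1 * cl h) s :=
        (hasDerivAt_const s (0:ℝ)).prodMk ((hasDerivAt_id s).mul_const (cl h))
      rw [one_mul] at this
      exact this.const_add p
    have h2 := h0.comp_hasDerivAt s h1
    rw [show ((0:ℝ), cl h) = cl h • ((0:ℝ), (1:ℝ)) by simp, map_smul] at h2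
    exact h2
  have hc : Continuous fun s : ℝ => (cl h) • fderiv ℝ (S.Ft (cl t)) (p + (0, s * cl h)) (0, 1) := by
    have h5 : Continuous fun s : ℝ => (t, p + (0, s * cl h)) := by fun_prop
    exact ((S.cont_DF.comp h5).clm_apply continuous_const).const_smul (cl h)
  have := intervalIntegral.integral_eq_sub_of_hasDerivAt hd (hc.intervalIntegrable _ _)
  rw [intervalIntegral.integral_smul] at this
  have e0 : p + ((0:ℝ), (0:ℝ)) = p := add_zero p
  simpa [Mv, e0] using this

lemma Mv_zero (p : Pl) (t : ℝ) : S.Mv p (t, 0) = fderiv ℝ (S.Ft (cl t)) p (0, 1) := by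
  have e0 : p + ((0:ℝ), (0:ℝ)) = p := add_zero p
  simp [Mv, cl_zero, e0]

lemma cl_pos_of {h : ℝ} (h0 : cl h ≠ 0) : 0 < cl h := lt_of_le_of_ne (cl_mem h).1 (Ne.symm h0)

lemma Mv_cl (p : Pl) (t h : ℝ) (h0 : cl h = 0) : S.Mv p (t, h) = fderiv ℝ (S.Ft (cl t)) p (0, 1) := by
  have e0 : p + ((0:ℝ), (0:ℝ)) = p := add_zero p
  simp [Mv, h0, e0]

lemma Mv_ne (p : Pl) (q : ℝ × ℝ) : S.Mv p q ≠ 0 := by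
  intro h
  by_cases h0 : cl q.2 = 0
  · rw [show q = (q.1, q.2) from rfl, Mv_cl _ _ _ _ h0] at h
    have := det2_inj (S.det_ne _ (cl_mem _) _) h
    simp at this
  · have h1 := S.Mv_eq p q.1 q.2
    rw [show (q.1, q.2) = q from rfl, h, smul_zero, eq_comm, sub_eq_zero] at h1
    have := S.Ft_inj _ (cl_mem _) h1
    have e := congrArg Prod.snd this
    simp only [Prod.snd_add] at e
    exact h0 (by linarith)

lemma vth_first {S : IsotopySetup} (ht : S.PosTwist) (hpres : MeasurePreserving S.f volume volume) (p : Pl) :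
    S.vth (1, p, 0) ∈ Ioo (-(1/2):ℝ) 0 := by
  have hv : IsAng ((0:ℝ), (1:ℝ)) 0 := by rw [← dirv_zero]; exact isAng_dirv 0
  have hM0 : ∀ h, S.Mv p (0, h) = (0, 1) := by
    intro h
    simp [Mv, cl_zero, S.Ft_zero]
  obtain ⟨Θ, hc, h0, hA⟩ := angle_lift (S.Mv p) (S.cont_Mv p) (S.Mv_ne p) (0, 0) 0 (by rw [hM0]; exact hv)
  have hΘ0 : ∀ h, Θ (0, h) = 0 := by
    intro h
    have := int_cont_const (X := ℝ) (g := fun h => Θ (0, h)) (by fun_prop) (by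
      intro h
      have h1 := hA (0, h)
      rw [hM0] at h1
      obtain ⟨k, hk⟩ := hv.int_diff h1
      exact ⟨k, by linarith⟩) h 0
    rw [this, h0]
  have e1 : S.vth (1, p, 0) = Θ (1, 0) := by
    have hcv := S.cont_vth
    refine ang_unique (X := fun t => S.Mv p (t, 0)) (a := fun t => S.vth (t, p, 0)) (b := fun t => Θ (t, 0)) (by fun_prop) (by fun_prop) ?_ (fun t _ => hA _) ?_
    · intro t _
      have := S.vth_ang t p 0
      rw [dirv_zero] at this
      simp only [Mv_zero]; exact this
    · simp only [vth_zero, hΘ0]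
  have hpos : ∀ h, 0 < (S.Mv p (1, h)).1 := by
    intro h
    by_cases hh : cl h = 0
    · rw [Mv_cl _ _ _ _ hh, cl_one]; exact tw_pos ht p
    · have h1 := congrArg Prod.fst (S.Mv_eq p 1 h)
      have hp := cl_pos_of hh
      have h2 := (ht p.1).1 (show p.2 < p.2 + cl h by linarith)
      simp only [Prod.smul_fst, smul_eq_mul, Prod.fst_sub, cl_one] at h1
      have e : p + (0, cl h) = (p.1, p.2 + cl h) := by ext <;> simp
      have e' : (S.Ft 1 (p.1, p.2)) = S.Ft 1 p := rfl
      simp only [F, e'] at h2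
      rw [e] at h1
      have : 0 < cl h * (S.Mv p (1, h)).1 := by linarith
      exact (mul_pos_iff_of_pos_left hp).1 this
  -- second family
  let N : ℝ × ℝ → Pl := fun q => S.Ft (cl q.1) (p + (cl q.2, 1 - cl q.2)) - S.Ft (cl q.1) p
  have hNc : Continuous N := by
    have h1 := continuous_cl
    have a1 : Continuous fun q : ℝ × ℝ => (q.1, p + (cl q.2, 1 - cl q.2)) := by fun_prop
    have a2 : Continuous fun q : ℝ × ℝ => (q.1, p) := by fun_prop
    exact (S.cont_Ft.comp a1).sub (S.cont_Ft.comp a2)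
  have hN0 : ∀ q, N q ≠ 0 := by
    intro q h
    have := S.Ft_inj _ (cl_mem _) (sub_eq_zero.1 h)
    have e1 := congrArg Prod.fst this
    have e2 := congrArg Prod.snd this
    simp only [Prod.snd_add, Prod.fst_add] at e1 e2
    linarith
  have hNt0 : ∀ s, N (0, s) = (cl s, 1 - cl s) := by
    intro s; simp [N, cl_zero, S.Ft_zero]
  have hNs1 : ∀ t, N (t, 1) = (1, 0) := by
    intro t
    simp only [N, cl_one]
    rw [show (1:ℝ) - 1 = 0 by ring, S.Ft_periodic]; simp
  obtain ⟨Λ, hcΛ, hΛ0, hB⟩ := angle_lift N hNc hN0 (0, 0) 0 (by rw [hNt0, cl_zero, sub_zero]; exact hv)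
  have hq : IsAng ((1:ℝ), (0:ℝ)) (-(1/4)) := by
    have := isAng_dirv (-(1/4))
    have e : dirv (-(1/4)) = (1, 0) := by
      unfold dirv
      rw [show 2 * Real.pi * (-(1/4)) = -(Real.pi/2) by ring]; simp
    rwa [e] at this
  have hu := isPreconnected_univ (α := ℝ)
  have hΛ01 : Λ (0, 1) = -(1/4) := by
    have h1 := stay_Ioo hu (g := fun s => Λ (0, s)) (by fun_prop) (a := -(1/2)) (b := 1/2)
      (by
        intro s _ he
        have := (ang_down (hB (0, s)) (-1) (by push_cast; rw [he]; norm_num))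
        rw [hNt0] at this; simp only at this; linarith [this.1, this.2])
      (by
        intro s _ he
        have := (ang_down (hB (0, s)) 0 (by push_cast; rw [he]; norm_num))
        rw [hNt0] at this; simp only at this; linarith [this.1, this.2])
      (mem_univ 0) (by simp only [hΛ0]; constructor <;> norm_num) (mem_univ 1)
    have h2 := hB (0, 1)
    rw [hNs1] at h2
    obtain ⟨k, hk⟩ := hq.int_diff h2
    rw [hk] at h1
    have a1 : (-1:ℝ) < k := by linarith [h1.1]
    have a2 : (k:ℝ) < 1 := by linarith [h1.2]
    have b1 : -1 < k := by exact_mod_cast a1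
    have b2 : k < 1 := by exact_mod_cast a2
    have : k = 0 := by omega
    rw [hk, this]; simp
  have hΛ11 : Λ (1, 1) = -(1/4) := by
    have := int_cont_const (X := ℝ) (g := fun t => Λ (t, 1) + 1/4) (by fun_prop) (by
      intro t
      have h1 := hB (t, 1)
      rw [hNs1] at h1
      obtain ⟨k, hk⟩ := hq.int_diff h1
      exact ⟨k, by linarith⟩) 1 0
    linarith
  have hup : ∀ s, ∀ k : ℤ, Λ (1, s) ≠ k := by
    intro s k he
    have := ang_up (hB (1, s)) k he
    simp only [N, cl_one, Prod.fst_sub, Prod.snd_sub] at this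
    have h1 := (th ht hpres).up_left (p := p) (q := p + (cl s, 1 - cl s)) (by
      rw [th_F]; simp only [F]; linarith [this.1]) (by rw [th_F]; simp only [F]; linarith [this.2])
    simp only [Prod.fst_add] at h1
    linarith [(cl_mem s).1]
  have hΛ10 := stay_Ioo hu (g := fun s => Λ (1, s)) (by fun_prop) (a := -1) (b := 0)
      (by intro s _; simpa using hup s (-1)) (by intro s _; simpa using hup s 0) (mem_univ 1)
      (by simp only [hΛ11]; constructor <;> norm_num) (mem_univ 0)
  have hag : Θ (1, 1) = Λ (1, 0) := by
    refine ang_unique (X := fun t => S.Mv p (t, 1)) (a := fun t => Θ (t, 1)) (b := fun t => Λ (t, 0)) (by fun_prop) (by fun_prop) (fun t _ => hA _) ?_ ?_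
    · intro t _
      have h1 := hB (t, 0)
      have h2 := S.Mv_eq p t 1
      rw [cl_one, one_smul] at h2
      simp only [h2]
      simpa [N, cl_zero] using h1
    · simp only [hΛ0, hΘ0]
  have h11 : Θ (1, 1) ∈ Ioo (-(1/2):ℝ) 0 := by
    rw [hag]
    refine ⟨?_, hΛ10.2⟩
    by_contra hh
    have h2 := (hA (1, 1)).add_int 1
    push_cast at h2
    rw [hag] at h2
    rcases lt_or_eq_of_le (not_lt.1 hh) with h | h
    · have := h2.fst_neg (by linarith [hΛ10.1]) (by linarith)
      linarith [hpos 1]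
    · have := ang_down h2 0 (by rw [h]; norm_num)
      linarith [hpos 1, this.1]
  rw [e1]
  exact stay_Ioo hu (g := fun h => Θ (1, h)) (by fun_prop)
    (fun x _ => by have := (hA (1,x)).ne_half (hpos x).ne' (-1); norm_num at this ⊢; exact this)
    (fun x _ => by simpa using (hA (1,x)).ne_half (hpos x).ne' 0) (mem_univ 1) h11 (mem_univ 0)

end IsotopySetup

end

section

namespace IsotopySetup
variable (S : IsotopySetup)

lemma ang_per_int (n : ℕ) (p : Pl) (θ : ℝ) (k : ℤ) : S.ang n (p + ((k:ℝ), 0)) θ = S.ang n p θ := by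
  induction k using Int.induction_on with
  | zero => 
    have e0 : p + (((0:ℤ):ℝ), (0:ℝ)) = p := by ext <;> simp
    rw [e0]
  | succ m ih =>
    have e : p + ((((m:ℤ) + 1 : ℤ) : ℝ), (0:ℝ)) = p + (((m:ℤ):ℝ), 0) + (1, 0) := by ext <;> simp; ring
    rw [e, ang_per, ih]
  | pred m ih =>
    have e : p + (((-(m:ℤ) : ℤ) : ℝ), (0:ℝ)) = p + (((-(m:ℤ) - 1 : ℤ):ℝ), 0) + (1, 0) := by ext <;> simp; ring
    rw [e, ang_per] at ih
    exact ih

/-- angular cocycle on the annulus -/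
def aa (n : ℕ) (z : Ann) : ℝ := S.ang n (surjInv pr_surj z) 0

lemma aa_pr (n : ℕ) (p : Pl) : S.aa n (pr p) = S.ang n p 0 := by
  unfold aa
  obtain ⟨k, hk⟩ := (pr_eq_iff _ _).1 (surjInv_eq pr_surj (pr p))
  rw [hk, ang_per_int]

lemma cont_aa (n : ℕ) : Continuous (S.aa n) := by
  rw [isQuotientMap_pr.continuous_iff]
  have : S.aa n ∘ pr = fun p => S.ang n p 0 := funext fun p => S.aa_pr n p
  rw [this]
  have := S.cont_ang n
  fun_prop

lemma ang_near (m : ℕ) (p : Pl) (θ : ℝ) : |S.ang m p θ - θ - S.ang m p 0| ≤ 1/2 := by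
  have h1 := Int.floor_le (2 * θ)
  have h2 := Int.lt_floor_add_one (2 * θ)
  set k := ⌊2 * θ⌋
  have a1 := (S.ang_mono m p).monotone (show 0 + (k:ℝ)/2 ≤ θ by linarith)
  have a2 := (S.ang_mono m p).monotone (show θ ≤ 0 + ((k+1:ℤ):ℝ)/2 by push_cast; linarith)
  rw [ang_int] at a1 a2
  push_cast at a2
  rw [abs_le]; constructor <;> linarith

lemma aa_add (m n : ℕ) (z : Ann) : |S.aa (m + n) z - S.aa n z - S.aa m (S.f^[n] z)| ≤ 1/2 := by
  obtain ⟨p, rfl⟩ := pr_surj z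
  rw [← iter_lift (F := S.F) S.lift_f, aa_pr, aa_pr, aa_pr, ang_add]
  exact S.ang_near _ _ _

variable {S} in
lemma aa_bd (ht : S.PosTwist) (hpres : MeasurePreserving S.f volume volume) (n : ℕ) (z : Ann) :
    -(n:ℝ)/2 ≤ S.aa n z ∧ S.aa n z ≤ 0 := by
  obtain ⟨p, rfl⟩ := pr_surj z
  rw [aa_pr]
  induction n with
  | zero => simp [ang_zero]
  | succ n ih =>
    rw [ang_succ]
    have h := vth_first ht hpres (S.F^[n] p)
    have a1 := (S.vth_mono 1 (S.F^[n] p)).monotone ih.2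
    have a2 := (S.vth_mono 1 (S.F^[n] p)).monotone (show 0 + ((-n:ℤ):ℝ)/2 ≤ S.ang n p 0 by push_cast; linarith [ih.1])
    simp only [vth_int] at a1 a2
    push_cast at a2 ⊢
    constructor <;> linarith [h.1, h.2]

variable {S} in
lemma aa_drop (ht : S.PosTwist) (hpres : MeasurePreserving S.f volume volume) (m n : ℕ) (z : Ann) :
    S.aa (m + n) z ≤ S.aa m (S.f^[n] z) ∧ (S.aa n z ≤ -(1/2) → S.aa (m + n) z ≤ S.aa m (S.f^[n] z) - 1/2) := by
  have h := (aa_bd ht hpres n z).2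
  obtain ⟨p, rfl⟩ := pr_surj z
  rw [← iter_lift (F := S.F) S.lift_f, aa_pr, aa_pr, ang_add] at *
  constructor
  · exact (S.ang_mono _ _).monotone h
  · rw [aa_pr]
    intro h1
    have := (S.ang_mono m (S.F^[n] p)).monotone (show S.ang n p 0 ≤ 0 + ((-1:ℤ):ℝ)/2 by push_cast; linarith)
    rw [ang_int] at this
    push_cast at this
    linarith

/-- torsion through the cocycle -/
lemma torsion_iff (z : Ann) (L : ℝ) : S.Torsion z L ↔ Tendsto (fun n : ℕ => S.aa n z / n) atTop (𝓝 L) := by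
  constructor
  · rintro ⟨p, rfl, h⟩
    obtain ⟨a, h1, h2⟩ := h (0, 1) (by simp)
    refine h2.congr' ?_
    filter_upwards [eventually_ge_atTop 1] with n hn
    rw [(S.angleVar_iff p (θ := 0) (by rw [← dirv_zero]; exact isAng_dirv 0) n _).1 (h1 n hn), aa_pr, sub_zero]
  · intro h
    obtain ⟨p, rfl⟩ := pr_surj z
    refine ⟨p, rfl, fun w hw => ?_⟩
    obtain ⟨θ, hθ⟩ := exists_isAng hw
    refine ⟨fun n => S.ang n p θ - θ, fun n _ => S.angleVar_self p hθ n, ?_⟩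
    have hz : Tendsto (fun n : ℕ => (S.ang n p θ - θ - S.aa n (pr p)) / n) atTop (𝓝 0) := by
      refine squeeze_zero_norm (a := fun n : ℕ => (1/2:ℝ) / n) ?_ (tendsto_const_div_atTop_nhds_zero_nat _)
      intro n
      rw [norm_div, Real.norm_eq_abs, aa_pr, Real.norm_natCast]
      gcongr
      exact S.ang_near _ _ _
    have := h.add hz
    rw [add_zero] at this
    refine this.congr fun n => ?_
    ring

lemma torsion_unique {z : Ann} {L L' : ℝ} (h : S.Torsion z L) (h' : S.Torsion z L') : L = L' :=
  tendsto_nhds_unique ((S.torsion_iff z L).1 h) ((S.torsion_iff z L').1 h')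

lemma torsionFun_eq {z : Ann} {L : ℝ} (h : S.Torsion z L) : S.torsionFun z = L := by
  unfold torsionFun
  have h0 : ∃ L, S.Torsion z L := ⟨L, h⟩
  rw [dif_pos h0]
  exact S.torsion_unique h0.choose_spec h

lemma torsion_f (z : Ann) (L : ℝ) : S.Torsion (S.f z) L ↔ S.Torsion z L := by
  rw [torsion_iff, torsion_iff]
  have hz : Tendsto (fun n : ℕ => (S.aa (n+1) z - S.aa n (S.f z)) / ((n + 1 : ℕ):ℝ)) atTop (𝓝 0) := by
    have h1 : Tendsto (fun n : ℕ => (|S.aa 1 z| + 1/2) / ((n+1 : ℕ):ℝ)) atTop (𝓝 0) :=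
      (tendsto_add_atTop_iff_nat 1).2 (tendsto_const_div_atTop_nhds_zero_nat (|S.aa 1 z| + 1/2))
    refine squeeze_zero_norm ?_ h1
    intro n
    rw [norm_div, Real.norm_eq_abs, Real.norm_natCast]
    gcongr
    have := S.aa_add n 1 z
    rw [iterate_one, abs_le] at this
    have h2 := neg_abs_le (S.aa 1 z)
    have h3 := le_abs_self (S.aa 1 z)
    rw [abs_le]; constructor <;> linarith [this.1, this.2]
  have hr : Tendsto (fun n : ℕ => ((n:ℝ)) / ((n + 1 : ℕ):ℝ)) atTop (𝓝 1) := by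
    have := tendsto_natCast_div_add_atTop (𝕜 := ℝ) 1
    refine this.congr fun n => by push_cast; rfl
  rw [← tendsto_add_atTop_iff_nat 1 (f := fun n : ℕ => S.aa n z / n)]
  constructor
  · intro h
    have := (h.mul hr).add hz
    rw [mul_one, add_zero] at this
    refine this.congr' ?_
    filter_upwards [eventually_ge_atTop 1] with n hn
    have h1 : (n:ℝ) ≠ 0 := by positivity
    have h2 : ((n+1:ℕ):ℝ) ≠ 0 := by positivity
    field_simp
    ring
  · intro h
    have := (h.sub hz).div hr one_ne_zero
    rw [div_one, sub_zero] at this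
    refine this.congr' ?_
    filter_upwards [eventually_ge_atTop 1] with n hn
    have h1 : (n:ℝ) ≠ 0 := by positivity
    have h2 : ((n+1:ℕ):ℝ) ≠ 0 := by positivity
    simp only [Pi.div_apply]
    field_simp
    ring

end IsotopySetup

end

section

section KW
set_option linter.unusedSectionVars false
variable {X : Type*} [MeasurableSpace X] {μ : Measure X} [IsFiniteMeasure μ] {T : X → X}
  {b : ℕ → X → ℝ} {A C : ℝ}

/-- pointwise covering estimate -/
lemma kw_point (hA : 0 ≤ A) (hC : 0 ≤ C) (hbd : ∀ n x, |b n x| ≤ A * n)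
    (hsup : ∀ n m x, b n x + b m (T^[n] x) - C ≤ b (m + n) x)
    {c : X → ℝ} (hc : ∀ x, c (T x) = c x) (hcA : ∀ x, c x ≤ A) {R : ℕ} (hR : 1 ≤ R) {B : Set X}
    (hB : ∀ x ∉ B, ∃ n : ℕ, 1 ≤ n ∧ n ≤ R ∧ n * c x ≤ b n x - C) (L : ℕ) (x : X) :
    L * c x - (2 * A + C) * ∑ i ∈ Finset.range L, B.indicator (fun _ => (1:ℝ)) (T^[i] x) - 2 * A * R ≤ b L x := by
  have hcn : ∀ n x, c (T^[n] x) = c x := by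
    intro n
    induction n with
    | zero => intro x; rfl
    | succ n ih => intro x; rw [iterate_succ_apply, ih, hc]
  have hnn : ∀ n x, 0 ≤ ∑ i ∈ Finset.range n, B.indicator (fun _ => (1:ℝ)) (T^[i] x) := by
    intro n x
    exact Finset.sum_nonneg fun i _ => indicator_nonneg (fun _ _ => zero_le_one) _
  induction L using Nat.strong_induction_on generalizing x with
  | _ L ih =>
    by_cases hL : L ≤ R
    · have h1 := (abs_le.1 (hbd L x)).1
      have h2 := hnn L x
      have h3 : (L:ℝ) * c x ≤ L * A := by gcongr; exact hcA x
      have h4 : A * (L:ℝ) ≤ A * R := by gcongr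
      have h5 := mul_nonneg (by linarith : 0 ≤ 2 * A + C) h2
      nlinarith
    · push Not at hL
      have step : ∀ n, 1 ≤ n → n ≤ L → 
          b n x - C + ((L - n : ℕ):ℝ) * c x - (2 * A + C) * ∑ i ∈ Finset.range (L - n), B.indicator (fun _ => (1:ℝ)) (T^[i] (T^[n] x)) - 2 * A * R ≤ b L x := by
        intro n hn hnL
        have h1 := ih (L - n) (by omega) (T^[n] x)
        rw [hcn] at h1
        have h2 := hsup n (L - n) x
        rw [Nat.sub_add_cancel hnL] at h2
        linarith
      have hsum : ∀ n, n ≤ L → ∑ i ∈ Finset.range L, B.indicator (fun _ => (1:ℝ)) (T^[i] x) =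
          ∑ i ∈ Finset.range n, B.indicator (fun _ => (1:ℝ)) (T^[i] x) +
          ∑ i ∈ Finset.range (L - n), B.indicator (fun _ => (1:ℝ)) (T^[i] (T^[n] x)) := by
        intro n hn
        conv_lhs => rw [← Nat.add_sub_cancel' hn, Finset.sum_range_add]
        congr 1
        refine Finset.sum_congr rfl fun i _ => ?_
        rw [add_comm, iterate_add_apply]
      by_cases hx : x ∈ B
      · have h1 := step 1 le_rfl (by omega)
        rw [hsum 1 (by omega)]
        rw [Finset.sum_range_one, iterate_zero, id, indicator_of_mem hx]
        have h2 := (abs_le.1 (hbd 1 x)).1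
        have h3 := hcA x
        rw [Nat.cast_sub (by omega)] at h1
        push_cast at h1 h2
        linarith
      · obtain ⟨n, hn1, hnR, hn⟩ := hB x hx
        have h1 := step n hn1 (by omega)
        rw [hsum n (by omega)]
        have h2 := mul_nonneg (by linarith : 0 ≤ 2 * A + C) (hnn n x)
        rw [Nat.cast_sub (by omega)] at h1
        linarith

lemma kw_int (hT : MeasurePreserving T μ μ) (hA : 0 ≤ A) (hC : 0 ≤ C) (hbm : ∀ n, Measurable (b n))
    (hbd : ∀ n x, |b n x| ≤ A * n)
    (hsup : ∀ n m x, b n x + b m (T^[n] x) - C ≤ b (m + n) x)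
    {c : X → ℝ} (hcm : Measurable c) (hc : ∀ x, c (T x) = c x) (hcA : ∀ x, |c x| ≤ A)
    (hfr : ∀ x, ∀ ε > 0, ∃ᶠ n : ℕ in atTop, n * (c x - ε) ≤ b n x) {ε : ℝ} (hε : 0 < ε) :
    ∀ᶠ L : ℕ in atTop, ∫ x, c x ∂μ - ε ≤ (∫ x, b L x ∂μ) / L := by
  set m : ℝ := μ.real univ with hm
  have hm0 : 0 ≤ m := measureReal_nonneg
  obtain ⟨δ, hδ, hδε⟩ : ∃ δ : ℝ, 0 < δ ∧ δ * (2 * m + (2 * A + C)) ≤ ε / 2 := by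
    refine ⟨ε / 2 / (2 * m + (2 * A + C) + 1), by positivity, ?_⟩
    rw [div_mul_eq_mul_div, div_le_iff₀ (by positivity)]
    nlinarith
  -- good times
  let G : ℕ → Set X := fun n => {x | 1 ≤ n ∧ n * (c x - 2 * δ) ≤ b n x - C}
  have hGm : ∀ n, MeasurableSet (G n) := by
    intro n
    have h1 := hbm n
    exact (MeasurableSet.const (1 ≤ n)).inter (measurableSet_le (f := fun x => n * (c x - 2 * δ)) (g := fun x => b n x - C) (by fun_prop) (by fun_prop))
  let B : ℕ → Set X := fun R => ⋂ n ∈ Finset.range (R + 1), (G n)ᶜ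
  have hBm : ∀ R, MeasurableSet (B R) := fun R => Finset.measurableSet_biInter _ fun n _ => (hGm n).compl
  have hBanti : Antitone B := by
    intro R R' h x hx
    simp only [B, mem_iInter, Finset.mem_range] at hx ⊢
    exact fun n hn => hx n (by omega)
  have hBempty : ⋂ R, B R = ∅ := by
    rw [eq_empty_iff_forall_notMem]
    intro x hx
    obtain ⟨M, hM⟩ := exists_nat_gt (C / δ)
    obtain ⟨n, hn, hbn⟩ := (hfr x δ hδ).forall_exists_of_atTop (M + 1)
    have h1 := mem_iInter.1 hx n
    simp only [B, mem_iInter, Finset.mem_range] at h1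
    refine h1 n (by omega) ⟨by omega, ?_⟩
    have h2 : C < M * δ := by rwa [div_lt_iff₀ hδ] at hM
    have h3 : (M:ℝ) + 1 ≤ n := by exact_mod_cast hn
    nlinarith
  have hlim : Tendsto (fun R => μ.real (B R)) atTop (𝓝 0) := by
    have := tendsto_measure_iInter_atTop (μ := μ) (fun R => (hBm R).nullMeasurableSet) hBanti ⟨0, measure_ne_top _ _⟩
    rw [hBempty, measure_empty] at this
    exact (ENNReal.tendsto_toReal ENNReal.zero_ne_top).comp this
  obtain ⟨R, hR1, hRδ⟩ := ((eventually_ge_atTop 1).and (hlim.eventually (gt_mem_nhds hδ))).exists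
  have hpt := fun L x => kw_point (T := T) (b := b) hA hC hbd hsup (c := fun x => c x - 2 * δ) (fun x => by simp only [hc])
    (fun x => by linarith [le_of_abs_le (hcA x)]) hR1 (B := B R) (by
      intro x hx
      simp only [B, mem_iInter, Finset.mem_range, not_forall, mem_compl_iff, not_not] at hx
      obtain ⟨n, hn, hn1, hn2⟩ := hx
      exact ⟨n, hn1, by omega, hn2⟩) L x
  have hci : Integrable c μ := Integrable.of_bound hcm.aestronglyMeasurable A (ae_of_all _ hcA)
  have hbi : ∀ n, Integrable (b n) μ := fun n =>
    Integrable.of_bound (hbm n).aestronglyMeasurable (A * n) (ae_of_all _ (hbd n))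
  have hTn : ∀ i, MeasurePreserving (T^[i]) μ μ := fun i => hT.iterate i
  have hindi : ∀ i, Integrable (fun x => (B R).indicator (fun _ => (1:ℝ)) (T^[i] x)) μ := fun i =>
    (hTn i).integrable_comp_of_integrable ((integrable_const _).indicator (hBm R))
  have hindv : ∀ i, ∫ x, (B R).indicator (fun _ => (1:ℝ)) (T^[i] x) ∂μ = μ.real (B R) := by
    intro i
    have h1 : (fun x => (B R).indicator (fun _ => (1:ℝ)) (T^[i] x)) = ((T^[i]) ⁻¹' (B R)).indicator (fun _ => (1:ℝ)) := rfl
    rw [h1, integral_indicator_const _ ((hTn i).measurable (hBm R)), smul_eq_mul, mul_one]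
    simp only [Measure.real, (hTn i).measure_preimage (hBm R).nullMeasurableSet]
  have hI : ∀ L : ℕ, L * (∫ x, c x ∂μ - 2 * δ * m) - (2 * A + C) * (L * μ.real (B R)) - 2 * A * R * m ≤ ∫ x, b L x ∂μ := by
    intro L
    have h1 : Integrable (fun x => L * (c x - 2 * δ)) μ := (hci.sub (integrable_const _)).const_mul _
    have h2 : Integrable (fun x => (2 * A + C) * ∑ i ∈ Finset.range L, (B R).indicator (fun _ => (1:ℝ)) (T^[i] x)) μ :=
      (integrable_finsetSum _ fun i _ => hindi i).const_mul _
    have := integral_mono ((h1.sub h2).sub (integrable_const (2 * A * R))) (hbi L) (hpt L)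
    have e := integral_sub (h1.sub h2) (integrable_const (μ := μ) (2 * A * (R:ℝ)))
    simp only [Pi.sub_apply] at e
    have e1 : ∫ x, L * (c x - 2 * δ) ∂μ = L * (∫ x, c x ∂μ - 2 * δ * m) := by
      rw [integral_const_mul, integral_sub hci (integrable_const _), integral_const, smul_eq_mul]; ring
    have e2 : ∫ x, (2 * A + C) * ∑ i ∈ Finset.range L, (B R).indicator (fun _ => (1:ℝ)) (T^[i] x) ∂μ =
        (2 * A + C) * ∑ i ∈ Finset.range L, μ.real (B R) := by
      rw [integral_const_mul, integral_finsetSum _ fun i _ => hindi i]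
      simp only [hindv]
    rw [integral_sub h1 h2, e1, e2, integral_const] at e
    simp only [Finset.sum_const, Finset.card_range, nsmul_eq_mul, smul_eq_mul] at e
    simp only [Pi.sub_apply] at this
    rw [e] at this
    refine le_trans (le_of_eq ?_) this
    ring
  have htail : Tendsto (fun L : ℕ => (2 * A * R * m) / (L:ℝ)) atTop (𝓝 0) := tendsto_const_div_atTop_nhds_zero_nat _
  filter_upwards [eventually_ge_atTop 1, htail.eventually (gt_mem_nhds (half_pos hε))] with L hL1 hL2
  have hL0 : (0:ℝ) < L := by exact_mod_cast hL1
  rw [le_div_iff₀ hL0]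
  rw [div_lt_iff₀ hL0] at hL2
  have h1 := hI L
  have h2 : (2 * A + C) * (L * μ.real (B R)) ≤ (2 * A + C) * (L * δ) := by gcongr
  have h3 := mul_le_mul_of_nonneg_right hδε hL0.le
  nlinarith

/-- subadditive-type theorem for quasi-cocycles -/
lemma kw_main (hT : MeasurePreserving T μ μ) (hA : 0 ≤ A) (hC : 0 ≤ C) (hbm : ∀ n, Measurable (b n))
    (hbd : ∀ n x, |b n x| ≤ A * n)
    (hq : ∀ n m x, |b (m + n) x - b n x - b m (T^[n] x)| ≤ C) :
    ∃ c : X → ℝ, Measurable c ∧ (∀ᵐ x ∂μ, Tendsto (fun n : ℕ => b n x / n) atTop (𝓝 (c x))) ∧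
      Tendsto (fun n : ℕ => (∫ x, b n x ∂μ) / n) atTop (𝓝 (∫ x, c x ∂μ)) := by
  have hub : ∀ x, ∀ n : ℕ, |b n x / n| ≤ A := by
    intro x n
    rcases Nat.eq_zero_or_pos n with h | h
    · simp [h, hA]
    · have : (0:ℝ) < n := by exact_mod_cast h
      rw [abs_div, Nat.abs_cast, div_le_iff₀ this]; exact hbd n x
  -- general one-sided
  have key : ∀ b : ℕ → X → ℝ, (∀ n, Measurable (b n)) → (∀ x, ∀ n : ℕ, |b n x / n| ≤ A) → (∀ n x, |b n x| ≤ A * n) →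
      (∀ n m x, |b (m + n) x - b n x - b m (T^[n] x)| ≤ C) →
      Measurable (fun x => limsup (fun n : ℕ => b n x / n) atTop) ∧ (∀ x, |limsup (fun n : ℕ => b n x / n) atTop| ≤ A) ∧
      ∀ ε > 0, ∀ᶠ L : ℕ in atTop, ∫ x, limsup (fun n : ℕ => b n x / n) atTop ∂μ - ε ≤ (∫ x, b L x ∂μ) / L := by
    intro b hbm hub hbd hq
    have bdd : ∀ x, IsBoundedUnder (· ≤ ·) atTop (fun n : ℕ => b n x / n) := fun x =>
      isBoundedUnder_of ⟨A, fun n => (abs_le.1 (hub x n)).2⟩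
    have cbd : ∀ x, IsBoundedUnder (· ≥ ·) atTop (fun n : ℕ => b n x / n) := fun x =>
      isBoundedUnder_of ⟨-A, fun n => (abs_le.1 (hub x n)).1⟩
    have hm : Measurable (fun x => limsup (fun n : ℕ => b n x / n) atTop) := Measurable.limsup fun n => (hbm n).div_const _
    have ha : ∀ x, |limsup (fun n : ℕ => b n x / n) atTop| ≤ A := by
      intro x
      rw [abs_le]
      exact ⟨le_limsup_of_frequently_le (Eventually.of_forall fun n => (abs_le.1 (hub x n)).1).frequently (bdd x),
        limsup_le_of_le (cbd x).isCoboundedUnder_le (Eventually.of_forall fun n => (abs_le.1 (hub x n)).2)⟩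
    refine ⟨hm, ha, fun ε hε => ?_⟩
    refine kw_int hT hA hC hbm hbd (fun n m x => by linarith [(abs_le.1 (hq n m x)).1]) hm ?_ ha ?_ hε
    · intro x
      -- invariance of the limsup
      have hz : Tendsto (fun n : ℕ => b n (T x) / n - b (n+1) x / ((n+1:ℕ):ℝ)) atTop (𝓝 0) := by
        have h1 : Tendsto (fun n : ℕ => (2 * A + C) / ((n+1 : ℕ):ℝ)) atTop (𝓝 0) :=
          (tendsto_add_atTop_iff_nat 1).2 (tendsto_const_div_atTop_nhds_zero_nat (2 * A + C))
        refine squeeze_zero_norm ?_ h1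
        intro n
        have hp : (0:ℝ) < ((n+1:ℕ):ℝ) := by positivity
        rw [Real.norm_eq_abs, le_div_iff₀ hp, ← abs_of_pos hp, ← abs_mul, abs_of_pos hp]
        have e : (b n (T x) / n - b (n+1) x / ((n+1:ℕ):ℝ)) * ((n+1:ℕ):ℝ) = b n (T x) / n + (b n (T x) - b (n+1) x) := by
          rcases Nat.eq_zero_or_pos n with h | h
          · have h0 := hbd 0 (T x)
            simp at h0
            subst h; simp [h0]
          · have : (0:ℝ) < n := by exact_mod_cast h
            field_simp; push_cast; ring
        rw [e]
        have q := abs_le.1 (hq 1 n x)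
        rw [iterate_one] at q
        have q1 := abs_le.1 (hub (T x) n)
        have q2 := abs_le.1 (hbd 1 x)
        push_cast at q2
        rw [abs_le]; constructor <;> linarith [q.1, q.2, q1.1, q1.2, q2.1, q2.2]
      have e2 : limsup (fun n : ℕ => b n x / n) atTop = limsup (fun n : ℕ => b (n+1) x / ((n+1:ℕ):ℝ)) atTop :=
        (limsup_nat_add (fun n : ℕ => b n x / n) 1).symm
      rw [e2]
      have bdd1 : IsBoundedUnder (· ≤ ·) atTop (fun n : ℕ => b (n+1) x / ((n+1:ℕ):ℝ)) :=
        isBoundedUnder_of ⟨A, fun n => (abs_le.1 (hub x (n+1))).2⟩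
      have cbd1 : IsBoundedUnder (· ≥ ·) atTop (fun n : ℕ => b (n+1) x / ((n+1:ℕ):ℝ)) :=
        isBoundedUnder_of ⟨-A, fun n => (abs_le.1 (hub x (n+1))).1⟩
      apply le_antisymm
      · refine le_of_forall_pos_lt_add fun ε hε => ?_
        have f1 : ∀ᶠ n : ℕ in atTop, b n (T x) / n ≤ limsup (fun n : ℕ => b (n+1) x / ((n+1:ℕ):ℝ)) atTop + ε/2 := by
          filter_upwards [hz.eventually (gt_mem_nhds (show (0:ℝ) < ε/4 by linarith)),
            eventually_lt_of_limsup_lt (lt_add_of_pos_right _ (show (0:ℝ) < ε/4 by linarith)) bdd1] with n h1 h2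
          linarith
        have := limsup_le_of_le (cbd (T x)).isCoboundedUnder_le f1
        linarith
      · refine le_of_forall_pos_lt_add fun ε hε => ?_
        have f1 : ∀ᶠ n : ℕ in atTop, b (n+1) x / ((n+1:ℕ):ℝ) ≤ limsup (fun n : ℕ => b n (T x) / n) atTop + ε/2 := by
          filter_upwards [hz.eventually (lt_mem_nhds (show -(ε/4) < (0:ℝ) by linarith)),
            eventually_lt_of_limsup_lt (lt_add_of_pos_right _ (show (0:ℝ) < ε/4 by linarith)) (bdd (T x))] with n h1 h2
          linarith
        have := limsup_le_of_le cbd1.isCoboundedUnder_le f1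
        linarith
    · intro x ε hε
      have := frequently_lt_of_lt_limsup (cbd x).isCoboundedUnder_le (sub_lt_self (limsup (fun n : ℕ => b n x / n) atTop) hε)
      refine (this.and_eventually (eventually_ge_atTop 1)).mono ?_
      rintro n ⟨h1, h2⟩
      have : (0:ℝ) < n := by exact_mod_cast h2
      rw [lt_div_iff₀ this] at h1
      linarith
  obtain ⟨m1, a1, k1⟩ := key b hbm hub hbd hq
  obtain ⟨m2, a2, k2⟩ := key (fun n x => - b n x) (fun n => (hbm n).neg) (fun x n => by rw [neg_div, abs_neg]; exact hub x n)
    (fun n x => by rw [abs_neg]; exact hbd n x) (fun n m x => by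
      rw [← abs_neg]; refine le_trans (le_of_eq ?_) (hq n m x); congr 1; ring)
  set cs : X → ℝ := fun x => limsup (fun n : ℕ => b n x / n) atTop with hcs
  set ci : X → ℝ := fun x => limsup (fun n : ℕ => - b n x / n) atTop with hci
  have i1 : Integrable cs μ := Integrable.of_bound m1.aestronglyMeasurable A (ae_of_all _ a1)
  have i2 : Integrable ci μ := Integrable.of_bound m2.aestronglyMeasurable A (ae_of_all _ a2)
  have bdd : ∀ x, IsBoundedUnder (· ≤ ·) atTop (fun n : ℕ => b n x / n) := fun x =>
      isBoundedUnder_of ⟨A, fun n => (abs_le.1 (hub x n)).2⟩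
  have cbd : ∀ x, IsBoundedUnder (· ≥ ·) atTop (fun n : ℕ => b n x / n) := fun x =>
      isBoundedUnder_of ⟨-A, fun n => (abs_le.1 (hub x n)).1⟩
  have bdd' : ∀ x, IsBoundedUnder (· ≤ ·) atTop (fun n : ℕ => - b n x / n) := fun x =>
      isBoundedUnder_of ⟨A, fun n => by rw [neg_div]; linarith [(abs_le.1 (hub x n)).1]⟩
  have up : ∀ x, ∀ ε > 0, ∀ᶠ n : ℕ in atTop, b n x / n < cs x + ε := fun x ε hε =>
    eventually_lt_of_limsup_lt (lt_add_of_pos_right _ hε) (bdd x)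
  have dn : ∀ x, ∀ ε > 0, ∀ᶠ n : ℕ in atTop, - ci x - ε < b n x / n := fun x ε hε => by
    filter_upwards [eventually_lt_of_limsup_lt (lt_add_of_pos_right _ hε) (bdd' x)] with n hn
    rw [neg_div] at hn; linarith
  have hnn : ∀ x, 0 ≤ cs x + ci x := by
    intro x
    refine le_of_forall_pos_le_add fun ε hε => ?_
    obtain ⟨n, h1, h2⟩ := ((up x (ε/2) (by linarith)).and (dn x (ε/2) (by linarith))).exists
    linarith
  have hInt : ∫ x, (cs x + ci x) ∂μ ≤ 0 := by
    refine le_of_forall_pos_le_add fun ε hε => ?_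
    obtain ⟨n, h1, h2⟩ := ((k1 (ε/2) (by linarith)).and (k2 (ε/2) (by linarith))).exists
    rw [integral_add i1 i2]
    rw [integral_neg, neg_div] at h2
    linarith
  have hae : ∀ᵐ x ∂μ, cs x + ci x = 0 := by
    have h0 : ∫ x, (cs x + ci x) ∂μ = 0 := le_antisymm hInt (integral_nonneg hnn)
    exact (integral_eq_zero_iff_of_nonneg hnn (i1.add i2)).1 h0
  refine ⟨cs, m1, ?_, ?_⟩
  · filter_upwards [hae] with x hx
    rw [Metric.tendsto_nhds]
    intro ε hε
    filter_upwards [up x ε hε, dn x ε hε] with n h1 h2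
    rw [Real.dist_eq, abs_lt]; constructor <;> linarith
  · have e : ∫ x, ci x ∂μ = - ∫ x, cs x ∂μ := by
      have := integral_congr_ae hae
      rw [integral_add i1 i2] at this
      simp at this
      linarith
    rw [Metric.tendsto_nhds]
    intro ε hε
    filter_upwards [k1 (ε/2) (by linarith), k2 (ε/2) (by linarith)] with n h1 h2
    rw [integral_neg, neg_div, e] at h2
    rw [Real.dist_eq, abs_lt]; constructor <;> linarith

end KW

end

section

namespace IsotopySetup
variable {S : IsotopySetup}

lemma torsion_neg (ht : S.PosTwist) (hpres : MeasurePreserving S.f volume volume) {V : Set Ann}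
    (hVm : MeasurableSet V) (hVi : S.f ⁻¹' V = V) (hVf : volume V < ⊤) {D : Set Ann} (hDV : D ⊆ V)
    (hDo : IsOpen D) (hDn : D.Nonempty) {N : ℕ} (hN : ∀ z ∈ D, S.aa N z ≤ -(1/2)) :
    ∫ z in V, S.torsionFun z < 0 := by
  set μ : Measure Ann := volume.restrict V with hμ
  have : IsFiniteMeasure μ := ⟨by rw [hμ, Measure.restrict_apply_univ]; exact hVf⟩
  have hT : MeasurePreserving S.f μ μ := by
    have := hpres.restrict_preimage hVm
    rwa [hVi] at this
  have hbd : ∀ n z, |S.aa n z| ≤ (1/2:ℝ) * n := by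
    intro n z
    have := aa_bd ht hpres n z
    rw [abs_le]; constructor <;> linarith [this.1, this.2, (Nat.cast_nonneg n : (0:ℝ) ≤ n)]
  have hInt : ∀ n, Integrable (S.aa n) μ := fun n =>
    Integrable.of_bound (S.cont_aa n).measurable.aestronglyMeasurable _ (ae_of_all _ (hbd n))
  obtain ⟨c, hcm, hca, hci⟩ := kw_main (μ := μ) (T := S.f) (b := S.aa) (A := 1/2) (C := 1/2) hT (by norm_num) (by norm_num)
    (fun n => (S.cont_aa n).measurable) hbd (fun n m z => S.aa_add m n z)
  have e : ∫ z, S.torsionFun z ∂μ = ∫ z, c z ∂μ := by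
    apply integral_congr_ae
    filter_upwards [hca] with z hz
    exact S.torsionFun_eq ((S.torsion_iff z _).2 hz)
  have hN1 : 1 ≤ N := by
    by_contra h
    obtain ⟨z, hz⟩ := hDn
    have := hN z hz
    rw [show N = 0 by omega] at this
    unfold aa at this; rw [ang_zero] at this; norm_num at this
  have hD0 : 0 < μ.real D := by
    have h1 : μ D = volume D := by rw [hμ, Measure.restrict_apply hDo.measurableSet, inter_eq_left.2 hDV]
    rw [Measure.real, ENNReal.toReal_pos_iff, h1]
    exact ⟨hDo.measure_pos _ hDn, lt_of_le_of_lt (measure_mono hDV) hVf⟩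
  have hI : ∀ n : ℕ, ∫ z, S.aa (n * N) z ∂μ ≤ - (n * μ.real D / 2) := by
    intro n
    induction n with
    | zero => simp [aa, ang_zero]
    | succ n ih =>
      have hi1 : Integrable (fun z => S.aa (n * N) (S.f^[N] z)) μ := (hT.iterate N).integrable_comp_of_integrable (hInt _)
      have hi2 : Integrable (D.indicator fun _ => (1/2:ℝ)) μ := (integrable_const _).indicator hDo.measurableSet
      have h1 := integral_mono (hInt ((n + 1) * N)) (hi1.sub hi2) (fun z => by
        rw [add_mul, one_mul, Pi.sub_apply]
        have := aa_drop ht hpres (n * N) N z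
        by_cases hz : z ∈ D
        · rw [indicator_of_mem hz]; exact this.2 (hN z hz)
        · rw [indicator_of_notMem hz, sub_zero]; exact this.1)
      have h2 := integral_sub hi1 hi2
      have h3 : ∫ z, S.aa (n * N) (S.f^[N] z) ∂μ = ∫ z, S.aa (n * N) z ∂μ := by
        have hme : MeasurableEmbedding (S.f^[N]) := by
          have : (S.f^[N]) = (S.fH^[N]) := rfl
          rw [this]
          clear * -
          induction N with
          | zero => exact MeasurableEmbedding.id
          | succ k ih => rw [iterate_succ']; exact S.fH.measurableEmbedding.comp ih
        exact (hT.iterate N).integral_comp hme _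
      rw [h3, integral_indicator_const _ hDo.measurableSet, smul_eq_mul] at h2
      simp only [Pi.sub_apply] at h1
      rw [h2] at h1
      push_cast
      linarith
  rw [e]
  have hN0 : (0:ℝ) < N := by exact_mod_cast hN1
  have hsub : Tendsto (fun n : ℕ => (n + 1) * N) atTop atTop :=
    Tendsto.atTop_mul_const' (by omega) (tendsto_add_atTop_nat 1)
  have hl := hci.comp hsub
  have hle : ∫ z, c z ∂μ ≤ - (μ.real D / (2 * N)) := by
    refine le_of_tendsto hl (Eventually.of_forall fun n => ?_)
    simp only [comp_apply]
    have h1 := hI (n + 1)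
    rw [div_le_iff₀ (by positivity)]
    refine h1.trans (le_of_eq ?_)
    push_cast
    field_simp
  have : 0 < μ.real D / (2 * N) := by positivity
  linarith

lemma iterZ_ofNat (n : ℕ) : iterZ S.f (n : ℤ) = S.fH^[n] := rfl
lemma iterZ_negSucc (n : ℕ) : iterZ S.f (Int.negSucc n) = S.fH.symm^[n + 1] := by
  have : invFun S.f = S.fH.symm := by
    funext z
    apply S.fH.injective
    rw [S.fH.apply_symm_apply]
    exact invFun_eq ⟨S.fH.symm z, S.fH.apply_symm_apply z⟩
  show (invFun S.f)^[n + 1] = _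
  rw [this]

/-- the saturation of U -/
def sat (S : IsotopySetup) (U : Set Ann) : Set Ann := ⋃ i : ℤ, iterZ S.f i '' U

lemma subset_sat (U : Set Ann) : U ⊆ sat S U := by
  intro z hz
  refine mem_iUnion.2 ⟨0, z, hz, rfl⟩

lemma sat_inv (U : Set Ann) : S.f ⁻¹' (sat S U) = sat S U := by
  have key : ∀ (i : ℤ) z, S.fH (iterZ S.f i z) = iterZ S.f (i + 1) z := by
    intro i z
    cases i with
    | ofNat n => 
      show S.fH (S.fH^[n] z) = S.fH^[n + 1] z
      rw [iterate_succ_apply']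
    | negSucc n =>
      rw [iterZ_negSucc]
      cases n with
      | zero => 
        show S.fH (S.fH.symm z) = z
        exact S.fH.apply_symm_apply z
      | succ n =>
        have : Int.negSucc (n + 1) + 1 = Int.negSucc n := rfl
        rw [this, iterZ_negSucc, iterate_succ_apply', S.fH.apply_symm_apply]
  ext z
  simp only [sat, mem_preimage, mem_iUnion, mem_image]
  constructor
  · rintro ⟨i, x, hx, e⟩
    refine ⟨i - 1, x, hx, S.fH.injective ?_⟩
    rw [key, sub_add_cancel, e]; rfl
  · rintro ⟨i, x, hx, rfl⟩
    exact ⟨i + 1, x, hx, (key i x).symm⟩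

lemma sat_open {U : Set Ann} (hU : IsOpen U) : IsOpen (sat S U) := by
  have hit : ∀ (h : Ann ≃ₜ Ann) (n : ℕ), IsOpenMap (h^[n]) := by
    intro h n
    induction n with
    | zero => exact IsOpenMap.id
    | succ n ih => rw [iterate_succ']; exact h.isOpenMap.comp ih
  refine isOpen_iUnion fun i => ?_
  cases i with
  | ofNat n => exact hit S.fH n U hU
  | negSucc n => rw [iterZ_negSucc]; exact hit S.fH.symm (n+1) U hU

lemma sat_null (hpres : MeasurePreserving S.f volume volume) {A : Set Ann} (hA : volume A = 0) : volume (sat S A) = 0 := by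
  refine measure_iUnion_null fun i => ?_
  cases i with
  | ofNat n => exact (image_iter_measure S.fH hpres n A).trans hA
  | negSucc n =>
    rw [iterZ_negSucc]
    exact (image_iter_measure S.fH.symm (S.symm_preserving hpres) (n+1) A).trans hA

/-- final assembly from an over-conjugate point -/
lemma final (ht : S.PosTwist) (hpres : MeasurePreserving S.f volume volume) {U : Set Ann}
    (hU : IsOpen U) (hVf : volume (sat S U) < ⊤) {N : ℕ} {z₀ : Ann} (hz : z₀ ∈ sat S U) (hN : S.aa N z₀ < -(1/2)) :
    0 < volume {z ∈ U | ∃ L : ℝ, S.Torsion z L ∧ L ≠ 0} ∧ ∫ z in sat S U, S.torsionFun z < 0 := by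
  have hO := sat_open (S := S) hU
  have hI : ∫ z in sat S U, S.torsionFun z < 0 :=
    torsion_neg ht hpres (D := sat S U ∩ {z | S.aa N z < -(1/2)}) hO.measurableSet (sat_inv U) hVf inter_subset_left
      (hO.inter (isOpen_lt (S.cont_aa N) continuous_const)) ⟨z₀, hz, hN⟩ (N := N) (fun z hz => le_of_lt hz.2)
  refine ⟨?_, hI⟩
  rw [pos_iff_ne_zero]
  intro h0
  have h1 := sat_null hpres h0
  have hinvS : ∀ (n : ℕ) z L, S.Torsion (S.fH^[n] z) L ↔ S.Torsion z L := by
    intro n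
    induction n with
    | zero => intro z L; rfl
    | succ n ih => intro z L; rw [iterate_succ_apply', ← ih z]; exact S.torsion_f _ L
  have hinvS' : ∀ (n : ℕ) z L, S.Torsion (S.fH.symm^[n] z) L ↔ S.Torsion z L := by
    intro n
    induction n with
    | zero => intro z L; rfl
    | succ n ih =>
      intro z L
      rw [iterate_succ_apply', ← ih z, ← S.torsion_f]
      have : S.f (S.fH.symm (S.fH.symm^[n] z)) = S.fH.symm^[n] z := S.fH.apply_symm_apply _
      rw [this]
  have h2 : ∫ z in sat S U, S.torsionFun z = 0 := by
    refine (integral_congr_ae (g := fun _ => (0:ℝ)) ?_).trans (by simp)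
    rw [EventuallyEq, ae_restrict_iff' hO.measurableSet]
    filter_upwards [compl_mem_ae_iff.2 h1] with z hz hzU
    by_contra hne
    apply hz
    have hex : ∃ L, S.Torsion z L ∧ L ≠ 0 := by
      by_cases h : ∃ L, S.Torsion z L
      · obtain ⟨L, hL⟩ := h
        refine ⟨L, hL, ?_⟩
        rwa [S.torsionFun_eq hL] at hne
      · exfalso; apply hne; unfold torsionFun; rw [dif_neg h]
    obtain ⟨i, x, hx, e⟩ := mem_iUnion.1 hzU
    refine mem_iUnion.2 ⟨i, x, ⟨hx, ?_⟩, e⟩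
    obtain ⟨L, hL, hL0⟩ := hex
    refine ⟨L, ?_, hL0⟩
    rw [← e] at hL
    cases i with
    | ofNat n => exact (hinvS n x L).1 hL
    | negSucc n => rw [iterZ_negSucc] at hL; exact (hinvS' _ x L).1 hL
  linarith

end IsotopySetup

end

section

/-! ## Part C: the wall around U -/

namespace EpiInv
variable {T : TH} {u v : ℝ → ℝ}

lemma max2 (hu : EpiInv T u) (hv : EpiInv T v) : EpiInv T (fun x => max (u x) (v x)) := by
  obtain ⟨M1, h1⟩ := hu.bdd
  obtain ⟨M2, h2⟩ := hv.bdd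
  have := EpiInv.sup (T := T) (w := fun b : Bool => if b then u else v) (M := max M1 M2)
    (by intro b; cases b <;> simpa) (by
      intro b x; cases b
      · exact (h2 x).trans (le_max_right _ _)
      · exact (h1 x).trans (le_max_left _ _))
  convert this using 2 with x
  apply le_antisymm
  · exact max_le (le_ciSup (f := fun i : Bool => (if i = true then u else v) x) (Set.finite_range _).bddAbove true)
      (le_ciSup (f := fun i : Bool => (if i = true then u else v) x) (Set.finite_range _).bddAbove false)
  · refine ciSup_le fun i => ?_
    cases i <;> simp

lemma min2 (hu : EpiInv T u) (hv : EpiInv T v) : EpiInv T (fun x => min (u x) (v x)) := by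
  obtain ⟨M1, h1⟩ := hu.bdd
  obtain ⟨M2, h2⟩ := hv.bdd
  have := EpiInv.inf (T := T) (w := fun b : Bool => if b then u else v) (M := max M1 M2)
    (by intro b; cases b <;> simpa) (by
      intro b x; cases b
      · exact (h2 x).trans (le_max_right _ _)
      · exact (h1 x).trans (le_max_left _ _))
  convert this using 2 with x
  apply le_antisymm
  · refine le_ciInf fun i => ?_
    cases i <;> simp
  · exact le_min (ciInf_le (f := fun i : Bool => (if i = true then u else v) x) (Set.finite_range _).bddBelow true)
      (ciInf_le (f := fun i : Bool => (if i = true then u else v) x) (Set.finite_range _).bddBelow false)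
end EpiInv

/-- a gap between two invariant graphs -/
structure Wall (T : TH) (um up : ℝ → ℝ) : Prop where
  hm : EpiInv T um
  hp : EpiInv T up
  le : ∀ x, um x ≤ up x
  no : ∀ w, EpiInv T w → ∀ x, um x < w x → w x < up x → False

lemma exists_wall (T : TH) {x0 y0 : ℝ} (hn : ∀ u, EpiInv T u → u x0 ≠ y0) {v0 v1 : ℝ → ℝ}
    (h0 : EpiInv T v0) (h1 : EpiInv T v1) (l0 : v0 x0 < y0) (l1 : y0 < v1 x0) :
    ∃ um up, Wall T um up ∧ um x0 < y0 ∧ y0 < up x0 := by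
  wlog hle : ∀ x, v0 x ≤ v1 x generalizing v1
  · exact this (h0.max2 h1) (l1.trans_le (le_max_right _ _)) (fun x => le_max_left _ _)
  obtain ⟨M0, hM0⟩ := h0.bdd
  obtain ⟨M1, hM1⟩ := h1.bdd
  have hbd : ∀ x c, v0 x ≤ c → c ≤ v1 x → |c| ≤ max M0 M1 := by
    intro x c a b
    have := abs_le.1 (hM0 x); have := abs_le.1 (hM1 x)
    rw [abs_le]
    constructor
    · linarith [le_max_left M0 M1]
    · linarith [le_max_right M0 M1]
  let I := {u : ℝ → ℝ // EpiInv T u ∧ (∀ x, v0 x ≤ u x ∧ u x ≤ v1 x) ∧ u x0 < y0}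
  have : Nonempty I := ⟨⟨v0, h0, fun x => ⟨le_rfl, hle x⟩, l0⟩⟩
  obtain ⟨um, hum⟩ : ∃ um : ℝ → ℝ, um = fun x => ⨆ i : I, i.1 x := ⟨_, rfl⟩
  have bI : ∀ (i : I) x, |i.1 x| ≤ max M0 M1 := fun i x => hbd x _ (i.2.2.1 x).1 (i.2.2.1 x).2
  have EM : EpiInv T um := hum ▸ EpiInv.sup (fun i : I => i.2.1) bI
  have bdI : ∀ x, BddAbove (range fun i : I => i.1 x) := fun x =>
    ⟨max M0 M1, by rintro _ ⟨i, rfl⟩; exact (abs_le.1 (bI i x)).2⟩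
  have geI : ∀ (i : I) x, i.1 x ≤ um x := fun i x => by rw [hum]; exact le_ciSup (bdI x) i
  have um0 : ∀ x, v0 x ≤ um x := fun x => geI ⟨v0, h0, fun x => ⟨le_rfl, hle x⟩, l0⟩ x
  have um1 : ∀ x, um x ≤ v1 x := fun x => by rw [hum]; exact ciSup_le fun i => (i.2.2.1 x).2
  have umx : um x0 < y0 := lt_of_le_of_ne (by rw [hum]; exact ciSup_le fun i => i.2.2.2.le) (hn um EM)
  let K := {u : ℝ → ℝ // EpiInv T u ∧ (∀ x, um x ≤ u x ∧ u x ≤ v1 x) ∧ y0 < u x0}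
  have : Nonempty K := ⟨⟨v1, h1, fun x => ⟨um1 x, le_rfl⟩, l1⟩⟩
  obtain ⟨up, hup⟩ : ∃ up : ℝ → ℝ, up = fun x => ⨅ i : K, i.1 x := ⟨_, rfl⟩
  have bK : ∀ (i : K) x, |i.1 x| ≤ max M0 M1 := fun i x =>
    hbd x _ ((um0 x).trans (i.2.2.1 x).1) (i.2.2.1 x).2
  have EP : EpiInv T up := hup ▸ EpiInv.inf (fun i : K => i.2.1) bK
  have bdK : ∀ x, BddBelow (range fun i : K => i.1 x) := fun x =>
    ⟨-max M0 M1, by rintro _ ⟨i, rfl⟩; exact (abs_le.1 (bK i x)).1⟩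
  have leK : ∀ (i : K) x, up x ≤ i.1 x := fun i x => by rw [hup]; exact ciInf_le (bdK x) i
  have up1 : ∀ x, up x ≤ v1 x := fun x => leK ⟨v1, h1, fun x => ⟨um1 x, le_rfl⟩, l1⟩ x
  have upm : ∀ x, um x ≤ up x := fun x => by rw [hup]; exact le_ciInf fun i => (i.2.2.1 x).1
  have upx : y0 < up x0 := lt_of_le_of_ne (by rw [hup]; exact le_ciInf fun i => i.2.2.2.le) (hn up EP).symm
  refine ⟨um, up, ⟨EM, EP, upm, ?_⟩, umx, upx⟩
  intro w hw x a b
  have hw' := (hw.max2 EM).min2 EP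
  have e : min (max (w x) (um x)) (up x) = w x := by rw [max_eq_left a.le, min_eq_left b.le]
  have c1 : ∀ x, um x ≤ min (max (w x) (um x)) (up x) := fun x => le_min (le_max_right _ _) (upm x)
  have c2 : ∀ x, min (max (w x) (um x)) (up x) ≤ up x := fun x => min_le_right _ _
  rcases lt_or_gt_of_ne (hn _ hw') with h | h
  · have := geI ⟨_, hw', fun x => ⟨(um0 x).trans (c1 x), (c2 x).trans (up1 x)⟩, h⟩ x
    simp only [e] at this
    linarith
  · have := leK ⟨_, hw', fun x => ⟨c1 x, (c2 x).trans (up1 x)⟩, h⟩ x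
    simp only [e] at this
    linarith

def wall (um up : ℝ → ℝ) : Set Pl := {p | um p.1 < p.2 ∧ p.2 < up p.1}

namespace Wall
variable {T : TH} {um up : ℝ → ℝ}

lemma isOpen_wall (W : Wall T um up) : IsOpen (wall um up) :=
  (isOpen_lt (W.hm.cont.comp continuous_fst) continuous_snd).inter
    (isOpen_lt continuous_snd (W.hp.cont.comp continuous_fst))

lemma mem_F (W : Wall T um up) (p : Pl) : T.F p ∈ wall um up ↔ p ∈ wall um up := by
  simp only [wall, Set.mem_ofPred_eq, W.hm.epi p, W.hp.hyp p]

lemma mem_add (W : Wall T um up) (p : Pl) (k : ℤ) : p + ((k:ℝ), 0) ∈ wall um up ↔ p ∈ wall um up := by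
  simp only [wall, Set.mem_ofPred_eq, Prod.fst_add, Prod.snd_add, W.hm.per_int, W.hp.per_int, add_zero]

lemma mem_pr (W : Wall T um up) (p : Pl) : pr p ∈ pr '' wall um up ↔ p ∈ wall um up := by
  constructor
  · rintro ⟨q, hq, h⟩
    obtain ⟨k, hk⟩ := (pr_eq_iff _ _).1 h.symm
    rw [hk, W.mem_add]; exact hq
  · exact fun h => ⟨p, h, rfl⟩

end Wall

instance locConnPl : LocallyConnectedSpace Ann :=
  isQuotientMap_pr.locallyConnectedSpace

namespace IsotopySetup
variable {S : IsotopySetup}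

lemma setup (ht : S.PosTwist) (hpres : MeasurePreserving S.f volume volume) {U : Set Ann}
    (hUbdd : Bornology.IsBounded U)
    (hUcc : ∃ z : Ann, z ∉ invCurveUnion S.f ∧ U = connectedComponentIn (invCurveUnion S.f)ᶜ z) :
    ∃ um up x0 y0, Wall (th ht hpres) um up ∧ um x0 < y0 ∧ y0 < up x0 ∧ IsOpen U ∧
      volume (sat S U) < ⊤ ∧ sat S U ⊆ pr '' wall um up ∧ pr (x0, y0) ∈ U ∧
      (∀ B : Set Pl, IsPreconnected B → B ⊆ wall um up → (∃ b ∈ B, pr b ∈ U) → pr '' B ⊆ U) := by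
  obtain ⟨z, hz, rfl⟩ := hUcc
  obtain ⟨⟨x0, y0⟩, rfl⟩ := pr_surj z
  have hmem := mem_inv_iff ht hpres
  have hn : ∀ u, EpiInv (th ht hpres) u → u x0 ≠ y0 := fun u hu h =>
    hz ((hmem _).2 ⟨u, hu, h.symm⟩)
  have hray : ∀ R : Set Pl, IsPreconnected R → (x0, y0) ∈ R → (∀ p ∈ R, ∀ u, EpiInv (th ht hpres) u → p.2 ≠ u p.1) →
      pr '' R ⊆ connectedComponentIn (invCurveUnion S.f)ᶜ (pr (x0, y0)) := by
    intro R hR h0 h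
    refine (hR.image _ continuous_pr.continuousOn).subset_connectedComponentIn ⟨_, h0, rfl⟩ ?_
    rintro _ ⟨p, hp, rfl⟩ hc
    obtain ⟨u, hu, e⟩ := (hmem p).1 hc
    exact h p hp u hu e
  obtain ⟨M, hM⟩ := hUbdd.exists_norm_le
  have hMy : ∀ p : Pl, pr p ∈ connectedComponentIn (invCurveUnion S.f)ᶜ (pr (x0, y0)) → |p.2| ≤ M := by
    intro p hp
    have := (norm_snd_le (pr p)).trans (hM _ hp)
    simpa [pr] using this
  have hex1 : ∃ v1, EpiInv (th ht hpres) v1 ∧ y0 < v1 x0 := by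
    by_contra! hcon
    have := hray ((fun y => (x0, y)) '' Ici y0) (isPreconnected_Ici.image _ (by fun_prop)) ⟨y0, mem_Ici.2 le_rfl, rfl⟩ (by
      rintro _ ⟨y, hy, rfl⟩ u hu e
      simp only at e
      have := hcon u hu
      have := hn u hu
      simp only [mem_Ici] at hy
      apply this; linarith)
    have := hMy (x0, max y0 (M + 1)) (this ⟨_, ⟨max y0 (M + 1), mem_Ici.2 (le_max_left _ _), rfl⟩, rfl⟩)
    have := (abs_le.1 this).2
    have := le_max_right y0 (M + 1)
    simp only at *
    linarith
  have hex0 : ∃ v1, EpiInv (th ht hpres) v1 ∧ v1 x0 < y0 := by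
    by_contra! hcon
    have := hray ((fun y => (x0, y)) '' Iic y0) (isPreconnected_Iic.image _ (by fun_prop)) ⟨y0, mem_Iic.2 le_rfl, rfl⟩ (by
      rintro _ ⟨y, hy, rfl⟩ u hu e
      simp only at e
      have := hcon u hu
      have := hn u hu
      simp only [mem_Iic] at hy
      apply this; linarith)
    have := hMy (x0, min y0 (-M - 1)) (this ⟨_, ⟨min y0 (-M - 1), mem_Iic.2 (min_le_left _ _), rfl⟩, rfl⟩)
    have := (abs_le.1 this).1
    have := min_le_right y0 (-M - 1)
    simp only at *
    linarith
  obtain ⟨v1, hv1, l1⟩ := hex1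
  obtain ⟨v0, hv0, l0⟩ := hex0
  obtain ⟨um, up, W, a, b⟩ := exists_wall (th ht hpres) hn hv0 hv1 l0 l1
  have hWo : IsOpen (pr '' wall um up) := isOpenMap_pr _ W.isOpen_wall
  have hsub : pr '' wall um up ⊆ (invCurveUnion S.f)ᶜ := by
    rintro _ ⟨p, hp, rfl⟩ hc
    obtain ⟨u, hu, e⟩ := (hmem p).1 hc
    exact W.no u hu p.1 (e ▸ hp.1) (e ▸ hp.2)
  have h0 : ((x0, y0) : Pl) ∈ wall um up := ⟨a, b⟩
  have hUW : connectedComponentIn (invCurveUnion S.f)ᶜ (pr (x0, y0)) ⊆ pr '' wall um up := by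
    have o2 : IsOpen {p : Pl | p.2 < um p.1 ∨ up p.1 < p.2} :=
      (isOpen_lt continuous_snd (W.hm.cont.comp continuous_fst)).union
      (isOpen_lt (W.hp.cont.comp continuous_fst) continuous_snd)
    refine isPreconnected_connectedComponentIn.subset_left_of_subset_union hWo (isOpenMap_pr _ o2) ?_ ?_ ?_
    · rw [Set.disjoint_left]
      rintro _ hp ⟨p, hp', rfl⟩
      rw [W.mem_pr] at hp
      rcases hp' with h | h
      · exact lt_asymm h hp.1
      · exact lt_asymm h hp.2
    · refine (connectedComponentIn_subset _ _).trans ?_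
      intro q hq
      obtain ⟨p, rfl⟩ := pr_surj q
      have n1 : p.2 ≠ um p.1 := fun e => hq ((hmem p).2 ⟨um, W.hm, e⟩)
      have n2 : p.2 ≠ up p.1 := fun e => hq ((hmem p).2 ⟨up, W.hp, e⟩)
      by_cases c : p ∈ wall um up
      · exact Or.inl ⟨p, c, rfl⟩
      · refine Or.inr ⟨p, ?_, rfl⟩
        simp only [wall, Set.mem_ofPred_eq, not_and_or, not_lt] at c
        rcases c with c | c
        · exact Or.inl (lt_of_le_of_ne c n1)
        · exact Or.inr (lt_of_le_of_ne c n2.symm)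
    · exact ⟨_, mem_connectedComponentIn hz, ⟨_, h0, rfl⟩⟩
  have hUe : connectedComponentIn (invCurveUnion S.f)ᶜ (pr (x0, y0)) = connectedComponentIn (pr '' wall um up) (pr (x0, y0)) :=
    Subset.antisymm (isPreconnected_connectedComponentIn.subset_connectedComponentIn (mem_connectedComponentIn hz) hUW)
      (connectedComponentIn_mono _ hsub)
  have hinvW : ∀ q, S.f q ∈ pr '' wall um up ↔ q ∈ pr '' wall um up := by
    intro q
    obtain ⟨p, rfl⟩ := pr_surj q
    rw [← S.lift_f, W.mem_pr, W.mem_pr]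
    exact W.mem_F p
  have hsat : sat S (connectedComponentIn (invCurveUnion S.f)ᶜ (pr (x0, y0))) ⊆ pr '' wall um up := by
    intro q hq
    simp only [sat, mem_iUnion] at hq
    obtain ⟨i, r, hr, rfl⟩ := hq
    have hr := hUW hr
    have itn : ∀ (n : ℕ) (g : Ann → Ann), (∀ q ∈ pr '' wall um up, g q ∈ pr '' wall um up) → g^[n] r ∈ pr '' wall um up := by
      intro n g hg
      induction n with
      | zero => exact hr
      | succ n ih => rw [iterate_succ_apply']; exact hg _ ih
    cases i with
    | ofNat n => exact itn n _ fun q hq => (hinvW q).2 hq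
    | negSucc n =>
      rw [iterZ_negSucc]
      refine itn (n+1) _ fun q hq => ?_
      rw [← hinvW, ← fH_coe, Homeomorph.apply_symm_apply]; exact hq
  refine ⟨um, up, x0, y0, W, a, b, ?_, ?_, hsat, mem_connectedComponentIn hz, ?_⟩
  · rw [hUe]; exact hWo.connectedComponentIn
  · obtain ⟨M1, h1⟩ := W.hm.bdd
    obtain ⟨M2, h2⟩ := W.hp.bdd
    refine (measure_mono ?_).trans_lt (strip_finite (max M1 M2))
    refine hsat.trans ?_
    rintro _ ⟨p, hp, rfl⟩
    have e1 := abs_le.1 (h1 p.1); have e2 := abs_le.1 (h2 p.1)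
    have := le_max_left M1 M2
    have := le_max_right M1 M2
    show |p.2| ≤ _
    rw [abs_le]
    constructor
    · linarith [hp.1]
    · linarith [hp.2]
  · rintro B hB hBW ⟨b, hb, hbU⟩
    rw [hUe] at hbU ⊢
    rw [connectedComponentIn_eq hbU]
    exact (hB.image _ continuous_pr.continuousOn).subset_connectedComponentIn ⟨_, hb, rfl⟩ (image_mono hBW)

end IsotopySetup

end

section

/-! ## Part D: dynamics without conjugate points -/

/-- induced circle map on an invariant graph -/
def bm (T : TH) (u : ℝ → ℝ) (x : ℝ) : ℝ := (T.F (x, u x)).1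

namespace EpiInv
variable {T : TH} {u : ℝ → ℝ}

lemma bm_eq (h : EpiInv T u) (x : ℝ) : T.F (x, u x) = (bm T u x, u (bm T u x)) := by
  apply Prod.ext
  · rfl
  · exact (h.gr (x, u x)).2 rfl

lemma bm_cont (h : EpiInv T u) : Continuous (bm T u) := by
  have := h.cont
  unfold bm
  exact continuous_fst.comp (T.F.continuous.comp (by fun_prop))

lemma bm_per (h : EpiInv T u) (x : ℝ) : bm T u (x + 1) = bm T u x + 1 := by
  have := congrArg Prod.fst (T.per (x, u x))
  simp only [Prod.mk_add_mk, add_zero, Prod.fst_add] at this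
  unfold bm
  rw [h.per]; exact this

lemma bm_mono (h : EpiInv T u) : StrictMono (bm T u) := by
  have inj : Injective (bm T u) := by
    intro x y e
    have : T.F (x, u x) = T.F (y, u y) := by rw [h.bm_eq, h.bm_eq, e]
    exact congrArg Prod.fst (T.F.injective this)
  rcases h.bm_cont.strictMono_of_inj inj with H | H
  · exact H
  · exfalso
    have := H (show (0:ℝ) < 0 + 1 by norm_num)
    rw [h.bm_per] at this
    linarith

lemma bm_iter (h : EpiInv T u) (n : ℕ) (x : ℝ) : T.F^[n] (x, u x) = ((bm T u)^[n] x, u ((bm T u)^[n] x)) := by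
  induction n with
  | zero => rfl
  | succ n ih => rw [iterate_succ_apply', ih, h.bm_eq, iterate_succ_apply']

end EpiInv

/-- a union of components of the wall where all iterates twist -/
structure Reg (T : TH) (um up : ℝ → ℝ) (D : Set Pl) : Prop where
  W : Wall T um up
  op : IsOpen D
  sub : D ⊆ wall um up
  memF : ∀ p, T.F p ∈ D ↔ p ∈ D
  add : ∀ p, ∀ k : ℤ, p + ((k:ℝ), 0) ∈ D ↔ p ∈ D
  conn : ∀ B : Set Pl, IsPreconnected B → B ⊆ wall um up → (B ∩ D).Nonempty → B ⊆ D
  tw : ∀ n : ℕ, ∀ x y, (x, y) ∈ D → StrictMonoOn (fun y => (T.F^[n + 1] (x, y)).1) (Icc (um x) (up x))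

namespace Reg
variable {T : TH} {um up : ℝ → ℝ} {D : Set Pl}

lemma fib (R : Reg T um up D) {p : Pl} (hp : p ∈ D) {y : ℝ} (h1 : um p.1 < y) (h2 : y < up p.1) : (p.1, y) ∈ D := by
  have := R.conn ((fun y => (p.1, y)) '' Ioo (um p.1) (up p.1)) (isPreconnected_Ioo.image _ (by fun_prop))
    (by rintro _ ⟨y, hy, rfl⟩; exact hy) ⟨p, ⟨p.2, R.sub hp, rfl⟩, hp⟩
  exact this ⟨y, ⟨h1, h2⟩, rfl⟩

lemma twist (R : Reg T um up D) (n : ℕ) {p q : Pl} (hp : p ∈ D) (hq : q ∈ D) (h1 : p.1 = q.1) (h2 : p.2 < q.2) :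
    (T.F^[n + 1] p).1 < (T.F^[n + 1] q).1 := by
  have a := R.sub hp
  have b := R.sub hq
  have e : q = (p.1, q.2) := by rw [h1]
  rw [e] at b
  have := R.tw n p.1 p.2 hp ⟨a.1.le, a.2.le⟩ ⟨b.1.le, b.2.le⟩ h2
  rw [e]; exact this

lemma crossing (R : Reg T um up D) {z w : Pl} (hz : z ∈ D) (hw : w ∈ D) (h1 : z.1 ≤ w.1)
    (h2 : (T.F w).1 < (T.F z).1) (n : ℕ) : (T.F^[n + 1] w).1 < (T.F^[n + 1] z).1 := by
  rcases h1.eq_or_lt with h1 | h1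
  · have : w.2 < z.2 := by
      by_contra hc
      rcases (not_lt.1 hc).eq_or_lt with h | h
      · rw [Prod.ext h1 h] at h2; exact lt_irrefl _ h2
      · exact lt_asymm h2 (T.vert h1 h)
    exact R.twist n hw hz h1.symm this
  · have hzw := R.sub hz
    have a1 : bm T um z.1 < bm T um w.1 := R.W.hm.bm_mono h1
    have a2 : bm T um w.1 < (T.F w).1 := T.vert (p := (w.1, um w.1)) (q := w) rfl (R.sub hw).1
    have hc : ContinuousOn (fun y => (T.F (z.1, y)).1) (Icc (um z.1) z.2) :=
      (continuous_fst.comp (T.F.continuous.comp (by fun_prop))).continuousOn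
    obtain ⟨y, hy, hye⟩ := intermediate_value_Ioo hzw.1.le hc (show (T.F w).1 ∈ Ioo _ _ from ⟨a1.trans a2, h2⟩)
    have hz' : (z.1, y) ∈ D := R.fib hz hy.1 (hy.2.trans hzw.2)
    have hye : (T.F (z.1, y)).1 = (T.F w).1 := hye
    have hlt : (T.F w).2 < (T.F (z.1, y)).2 := by
      by_contra hc
      rcases (not_lt.1 hc).eq_or_lt with h | h
      · have := T.F.injective (Prod.ext hye h)
        rw [← this] at h1; exact lt_irrefl _ h1
      · exact lt_asymm h1 (T.up_left (p := (z.1, y)) (q := w) hye h)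
    cases n with
    | zero => exact h2
    | succ n =>
      have b1 := R.twist (n + 1) hz' hz rfl hy.2
      have b2 := R.twist n ((R.memF _).2 hw) ((R.memF _).2 hz') hye.symm hlt
      rw [← iterate_succ_apply, ← iterate_succ_apply] at b2
      exact b2.trans b1

/-- return map with deck correction -/
def Gm (T : TH) (q : ℕ) (k : ℤ) (p : Pl) : Pl := T.F^[q] p - ((k:ℝ), 0)

lemma Gm_cont (q : ℕ) (k : ℤ) : Continuous (Gm T q k) := by
  have := T.F.continuous.iterate q
  unfold Gm; fun_prop

lemma F_sub (p : Pl) (k : ℤ) : T.F (p - ((k:ℝ), 0)) = T.F p - ((k:ℝ), 0) := by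
  have := per_int T.per p (-k)
  simpa [sub_eq_add_neg] using this

lemma Fi_add (n : ℕ) (p : Pl) (k : ℤ) : T.F^[n] (p + ((k:ℝ), 0)) = T.F^[n] p + ((k:ℝ), 0) :=
  per_int (iter_per T.per n) p k

lemma Gm_F (q : ℕ) (k : ℤ) (p : Pl) : Gm T q k (T.F p) = T.F (Gm T q k p) := by
  unfold Gm
  rw [F_sub, ← iterate_succ_apply, iterate_succ_apply' T.F]

lemma Gm_Fi (q : ℕ) (k : ℤ) (n : ℕ) (p : Pl) : Gm T q k (T.F^[n] p) = T.F^[n] (Gm T q k p) := by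
  induction n generalizing p with
  | zero => rfl
  | succ n ih => rw [iterate_succ_apply, ih, Gm_F, iterate_succ_apply]

lemma Gm_add (q : ℕ) (k j : ℤ) (p : Pl) : Gm T q k (p + ((j:ℝ), 0)) = Gm T q k p + ((j:ℝ), 0) := by
  unfold Gm
  rw [Fi_add]; abel

lemma Gm_sub (q : ℕ) (k j : ℤ) (p : Pl) : Gm T q k (p - ((j:ℝ), 0)) = Gm T q k p - ((j:ℝ), 0) := by
  have := Gm_add (T := T) q k (-j) p
  simpa [sub_eq_add_neg] using this

lemma memFi (R : Reg T um up D) (n : ℕ) (p : Pl) : T.F^[n] p ∈ D ↔ p ∈ D := by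
  induction n with
  | zero => rfl
  | succ n ih => rw [iterate_succ_apply', R.memF, ih]

lemma sub_mem (R : Reg T um up D) (p : Pl) (k : ℤ) : p - ((k:ℝ), 0) ∈ D ↔ p ∈ D := by
  have := R.add p (-k)
  simpa [sub_eq_add_neg] using this

lemma Gm_mem (R : Reg T um up D) (q : ℕ) (k : ℤ) (p : Pl) : Gm T q k p ∈ D ↔ p ∈ D := by
  unfold Gm; rw [R.sub_mem, R.memFi]

lemma Gm_tw (R : Reg T um up D) (q : ℕ) (k : ℤ) {a b : Pl} (ha : a ∈ D) (hb : b ∈ D) (h1 : a.1 = b.1) (h2 : a.2 < b.2) :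
    (Gm T (q + 1) k a).1 < (Gm T (q + 1) k b).1 := by
  have := R.twist q ha hb h1 h2
  simp only [Gm, Prod.fst_sub]; linarith

lemma D_bdd (R : Reg T um up D) : ∃ M : ℝ, ∀ p ∈ D, |p.2| ≤ M := by
  obtain ⟨M1, h1⟩ := R.W.hm.bdd
  obtain ⟨M2, h2⟩ := R.W.hp.bdd
  refine ⟨max M1 M2, fun p hp => ?_⟩
  have hp := R.sub hp
  have e1 := abs_le.1 (h1 p.1); have e2 := abs_le.1 (h2 p.1)
  have := le_max_left M1 M2
  have := le_max_right M1 M2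
  rw [abs_le]
  constructor
  · linarith [hp.1]
  · linarith [hp.2]

lemma ret (R : Reg T um up D) {N : Set Pl} (hN : IsOpen N) (hne : N.Nonempty) (hs : N ⊆ D) :
    ∃ n : ℕ, ∃ k : ℤ, ∃ p ∈ N, T.F^[n + 1] p - ((k:ℝ), (0:ℝ)) ∈ N := by
  obtain ⟨M, hM⟩ := R.D_bdd
  exact T.nw N hN hne ⟨M, fun n p hp => hM _ ((R.memFi n p).2 (hs hp))⟩

lemma oL (q : ℕ) (k : ℤ) : IsOpen {z : Pl | z.1 < (Gm T q k z).1} :=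
  isOpen_lt continuous_fst (continuous_fst.comp (Gm_cont q k))
lemma oG (q : ℕ) (k : ℤ) : IsOpen {z : Pl | (Gm T q k z).1 < z.1} :=
  isOpen_lt (continuous_fst.comp (Gm_cont q k)) continuous_fst

lemma no_pm (R : Reg T um up D) (q : ℕ) (k : ℤ) {z : Pl} (hz : z ∈ D) (h1 : z.1 < (Gm T q k z).1)
    (h2 : (Gm T q k (T.F z)).1 < (T.F z).1) : False := by
  obtain ⟨n, j, p, ⟨⟨hp, hp1⟩, hp2⟩, hp3⟩ := R.ret
    (N := (D ∩ {z : Pl | z.1 < (Gm T q k z).1}) ∩ T.F ⁻¹' {z : Pl | (Gm T q k z).1 < z.1})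
    ((R.op.inter (oL q k)).inter ((oG q k).preimage T.F.continuous)) ⟨z, ⟨hz, h1⟩, h2⟩ (fun x hx => hx.1.1)
  have hp2 : (Gm T q k (T.F p)).1 < (T.F p).1 := hp2
  have hp1 : p.1 < (Gm T q k p).1 := hp1
  rw [Gm_F] at hp2
  have c := R.crossing hp ((R.Gm_mem q k p).2 hp) hp1.le hp2 n
  rw [← Gm_Fi] at c
  have d : (T.F^[n + 1] p - ((j:ℝ), (0:ℝ))).1 < (Gm T q k (T.F^[n + 1] p - ((j:ℝ), (0:ℝ)))).1 := hp3.1.2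
  rw [Gm_sub] at d
  simp only [Prod.fst_sub] at d
  linarith

lemma no_mp (R : Reg T um up D) (q : ℕ) (k : ℤ) {z : Pl} (hz : z ∈ D) (h1 : (Gm T q k z).1 < z.1)
    (h2 : (T.F z).1 < (Gm T q k (T.F z)).1) : False := by
  obtain ⟨n, j, p, ⟨⟨hp, hp1⟩, hp2⟩, hp3⟩ := R.ret
    (N := (D ∩ {z : Pl | (Gm T q k z).1 < z.1}) ∩ T.F ⁻¹' {z : Pl | z.1 < (Gm T q k z).1})
    ((R.op.inter (oG q k)).inter ((oL q k).preimage T.F.continuous)) ⟨z, ⟨hz, h1⟩, h2⟩ (fun x hx => hx.1.1)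
  have hp2 : (T.F p).1 < (Gm T q k (T.F p)).1 := hp2
  have hp1 : (Gm T q k p).1 < p.1 := hp1
  rw [Gm_F] at hp2
  have c := R.crossing ((R.Gm_mem q k p).2 hp) hp hp1.le hp2 n
  rw [← Gm_Fi] at c
  have d : (Gm T q k (T.F^[n + 1] p - ((j:ℝ), (0:ℝ)))).1 < (T.F^[n + 1] p - ((j:ℝ), (0:ℝ))).1 := hp3.1.2
  rw [Gm_sub] at d
  simp only [Prod.fst_sub] at d
  linarith

/-- vertical perturbation -/
lemma near {N : Set Pl} (hN : IsOpen N) {z : Pl} (hz : z ∈ N) :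
    ∃ a b : Pl, a ∈ N ∧ b ∈ N ∧ a.1 = z.1 ∧ b.1 = z.1 ∧ a.2 < z.2 ∧ z.2 < b.2 := by
  have hc : Continuous fun t : ℝ => z + ((0:ℝ), t) := by fun_prop
  have ho := hN.preimage hc
  have h0 : (0:ℝ) ∈ (fun t : ℝ => z + ((0:ℝ), t)) ⁻¹' N := by
    show z + ((0:ℝ), (0:ℝ)) ∈ N
    rw [Prod.mk_zero_zero, add_zero]; exact hz
  obtain ⟨ε, hε, hb⟩ := Metric.isOpen_iff.1 ho 0 h0
  refine ⟨z + (0, -(ε/2)), z + (0, ε/2), hb ?_, hb ?_, by simp, by simp, by simp; linarith, by simp; linarith⟩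
  · rw [Metric.mem_ball, Real.dist_eq, sub_zero, abs_neg, abs_of_pos (by linarith)]; linarith
  · rw [Metric.mem_ball, Real.dist_eq, sub_zero, abs_of_pos (by linarith)]; linarith

lemma inv_lt (R : Reg T um up D) (q : ℕ) (k : ℤ) {z : Pl} (hz : z ∈ D) (h : z.1 < (Gm T (q + 1) k z).1) :
    (T.F z).1 < (Gm T (q + 1) k (T.F z)).1 := by
  by_contra hc
  rcases (not_lt.1 hc).lt_or_eq with h' | h'
  · exact R.no_pm _ _ hz h h'
  · obtain ⟨a, -, ⟨ha, ha1⟩, -, e, -, l, -⟩ := near (N := D ∩ T.F.symm ⁻¹' {z : Pl | z.1 < (Gm T (q + 1) k z).1})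
      (R.op.inter ((oL _ _).preimage T.F.symm.continuous)) (z := T.F z) ⟨(R.memF z).2 hz, by
        show T.F.symm (T.F z) ∈ {z : Pl | z.1 < (Gm T (q + 1) k z).1}
        rw [T.F.symm_apply_apply]; exact h⟩
    refine R.no_pm (q + 1) k (z := T.F.symm a) ?_ ha1 ?_
    · rw [← R.memF, T.F.apply_symm_apply]; exact ha
    · rw [T.F.apply_symm_apply]
      have := R.Gm_tw q k ha ((R.memF z).2 hz) e l
      linarith

lemma inv_gt (R : Reg T um up D) (q : ℕ) (k : ℤ) {z : Pl} (hz : z ∈ D) (h : (Gm T (q + 1) k z).1 < z.1) :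
    (Gm T (q + 1) k (T.F z)).1 < (T.F z).1 := by
  by_contra hc
  rcases (not_lt.1 hc).lt_or_eq with h' | h'
  · exact R.no_mp _ _ hz h h'
  · obtain ⟨-, a, -, ⟨ha, ha1⟩, -, e, -, l⟩ := near (N := D ∩ T.F.symm ⁻¹' {z : Pl | (Gm T (q + 1) k z).1 < z.1})
      (R.op.inter ((oG _ _).preimage T.F.symm.continuous)) (z := T.F z) ⟨(R.memF z).2 hz, by
        show T.F.symm (T.F z) ∈ {z : Pl | (Gm T (q + 1) k z).1 < z.1}
        rw [T.F.symm_apply_apply]; exact h⟩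
    refine R.no_mp (q + 1) k (z := T.F.symm a) ?_ ha1 ?_
    · rw [← R.memF, T.F.apply_symm_apply]; exact ha
    · rw [T.F.apply_symm_apply]
      have := R.Gm_tw q k ((R.memF z).2 hz) ha e.symm l
      linarith

lemma inv_eq (R : Reg T um up D) (q : ℕ) (k : ℤ) {z : Pl} (hz : z ∈ D) (h : (Gm T (q + 1) k z).1 = z.1) :
    (Gm T (q + 1) k (T.F z)).1 = (T.F z).1 := by
  by_contra hc
  rcases lt_or_gt_of_ne hc with h' | h'
  · obtain ⟨-, a, -, ⟨ha, ha1⟩, -, e, -, l⟩ := near (N := D ∩ T.F ⁻¹' {z : Pl | (Gm T (q + 1) k z).1 < z.1})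
      (R.op.inter ((oG _ _).preimage T.F.continuous)) (z := z) ⟨hz, h'⟩
    refine R.no_pm (q + 1) k ha ?_ ha1
    have := R.Gm_tw q k hz ha e.symm l
    linarith
  · obtain ⟨a, -, ⟨ha, ha1⟩, -, e, -, l, -⟩ := near (N := D ∩ T.F ⁻¹' {z : Pl | z.1 < (Gm T (q + 1) k z).1})
      (R.op.inter ((oL _ _).preimage T.F.continuous)) (z := z) ⟨hz, h'⟩
    refine R.no_mp (q + 1) k ha ?_ ha1
    have := R.Gm_tw q k ha hz e l
    linarith

lemma inv_eq_iff (R : Reg T um up D) (q : ℕ) (k : ℤ) {z : Pl} (hz : z ∈ D) :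
    (Gm T (q + 1) k (T.F z)).1 = (T.F z).1 ↔ (Gm T (q + 1) k z).1 = z.1 := by
  refine ⟨fun h => ?_, R.inv_eq q k hz⟩
  by_contra hc
  rcases lt_or_gt_of_ne hc with h' | h'
  · exact absurd (R.inv_gt q k hz h') (by rw [h]; exact lt_irrefl _)
  · exact absurd (R.inv_lt q k hz h') (by rw [h]; exact lt_irrefl _)

end Reg

end

section

lemma no_drift (H : Pl ≃ₜ Pl) (h : Ann ≃ₜ Ann) (hf : ∀ p, pr (H p) = h (pr p))
    (hm : MeasurePreserving h volume volume) {C : Set Pl} (ho : IsOpen C) {M : ℝ} (hb : ∀ p ∈ C, |p.2| ≤ M)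
    (hC : ∀ p ∈ C, H p ∈ C) (hj : ∀ w ∈ C, ∀ j : ℤ, w - ((j:ℝ), (0:ℝ)) ∈ C → j = 0) (e : ℝ)
    (hinv : ∀ w ∈ C, e * w.1 < e * (H w).1 → e * (H w).1 < e * (H (H w)).1) :
    ∀ z ∈ C, ¬ e * z.1 < e * (H z).1 := by
  intro z hz hlt
  obtain ⟨c, hc1, hc2⟩ := exists_between hlt
  have hi : ∀ n : ℕ, ∀ p ∈ C, H^[n] p ∈ C := by
    intro n p hp
    induction n with
    | zero => exact hp
    | succ n ih => rw [iterate_succ_apply']; exact hC _ ih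
  have o1 : IsOpen {w : Pl | e * w.1 < c} := isOpen_lt (by fun_prop) continuous_const
  have o2 : IsOpen {w : Pl | c < e * (H w).1} :=
    isOpen_lt continuous_const (continuous_const.mul (continuous_fst.comp H.continuous))
  obtain ⟨n, j, p, ⟨⟨hp, hp1⟩, hp2⟩, hp3⟩ := nw_gen H h hf hm
    ((C ∩ {w : Pl | e * w.1 < c}) ∩ {w : Pl | c < e * (H w).1}) ((ho.inter o1).inter o2)
    ⟨z, ⟨hz, hc1⟩, hc2⟩ ⟨M, fun n p hp => hb _ (hi n p hp.1.1)⟩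
  have hp1 : e * p.1 < c := hp1
  have hp2 : c < e * (H p).1 := hp2
  have j0 := hj _ (hi (n + 1) p hp) j hp3.1.1
  have hp3 : e * (H^[n + 1] p - ((j:ℝ), (0:ℝ))).1 < c := hp3.1.2
  rw [j0] at hp3
  simp only [Int.cast_zero, Prod.fst_sub, sub_zero] at hp3
  have key : ∀ n : ℕ, e * (H p).1 ≤ e * (H^[n + 1] p).1 ∧ e * (H^[n] p).1 < e * (H^[n + 1] p).1 := by
    intro n
    induction n with
    | zero => exact ⟨le_rfl, hp1.trans hp2⟩
    | succ n ih =>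
      have := hinv _ (hi n p hp) (by rw [← iterate_succ_apply' H]; exact ih.2)
      rw [← iterate_succ_apply' H, ← iterate_succ_apply' H] at this
      exact ⟨ih.1.trans this.le, this⟩
  linarith [(key n).1]

lemma homeo_iter {X : Type*} [TopologicalSpace X] (H : X ≃ₜ X) (n : ℕ) : ∃ K : X ≃ₜ X, ∀ p, K p = H^[n] p := by
  induction n with
  | zero => exact ⟨Homeomorph.refl X, fun p => rfl⟩
  | succ n ih =>
    obtain ⟨K, hK⟩ := ih
    exact ⟨K.trans H, fun p => by rw [iterate_succ_apply', ← hK]; rfl⟩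

namespace Reg
variable {T : TH} {um up : ℝ → ℝ} {D : Set Pl}

lemma Gm_lt (R : Reg T um up D) (q : ℕ) (k : ℤ) {z : Pl} (hz : z ∈ D) (h : z.1 < (Gm T (q + 1) k z).1) :
    (Gm T (q + 1) k z).1 < (Gm T (q + 1) k (Gm T (q + 1) k z)).1 := by
  have : ∀ n, (T.F^[n] z).1 < (Gm T (q + 1) k (T.F^[n] z)).1 := by
    intro n
    induction n with
    | zero => exact h
    | succ n ih => rw [iterate_succ_apply']; exact R.inv_lt q k ((R.memFi n z).2 hz) ih
  have := this (q + 1)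
  have e : Gm T (q + 1) k z = T.F^[q + 1] z - ((k:ℝ), 0) := rfl
  conv_rhs => rw [e, Gm_sub]
  conv_lhs => rw [e]
  simp only [Prod.fst_sub]; linarith

lemma Gm_gt (R : Reg T um up D) (q : ℕ) (k : ℤ) {z : Pl} (hz : z ∈ D) (h : (Gm T (q + 1) k z).1 < z.1) :
    (Gm T (q + 1) k (Gm T (q + 1) k z)).1 < (Gm T (q + 1) k z).1 := by
  have : ∀ n, (Gm T (q + 1) k (T.F^[n] z)).1 < (T.F^[n] z).1 := by
    intro n
    induction n with
    | zero => exact h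
    | succ n ih => rw [iterate_succ_apply']; exact R.inv_gt q k ((R.memFi n z).2 hz) ih
  have := this (q + 1)
  have e : Gm T (q + 1) k z = T.F^[q + 1] z - ((k:ℝ), 0) := rfl
  conv_lhs => rw [e, Gm_sub]
  conv_rhs => rw [e]
  simp only [Prod.fst_sub]; linarith

lemma bubble (R : Reg T um up D) (h : Ann ≃ₜ Ann) (hf : ∀ p, pr (T.F p) = h (pr p))
    (hm : MeasurePreserving h volume volume) {p0 : Pl} (hp0 : p0 ∈ D) {a : ℝ} (ha : um a = up a) : False := by
  obtain ⟨C, hCd⟩ : ∃ C, C = connectedComponentIn (wall um up) p0 := ⟨_, rfl⟩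
  have hCo : IsOpen C := hCd ▸ R.W.isOpen_wall.connectedComponentIn
  have hCp : IsPreconnected C := hCd ▸ isPreconnected_connectedComponentIn
  have hC0 : p0 ∈ C := hCd ▸ mem_connectedComponentIn (R.sub hp0)
  have hCW : C ⊆ wall um up := hCd ▸ connectedComponentIn_subset _ _
  have hCD : C ⊆ D := R.conn C hCp hCW ⟨p0, hC0, hp0⟩
  obtain ⟨q, k, p, hp, hpk⟩ := R.ret hCo ⟨p0, hC0⟩ hCD
  have hGC : ∀ w ∈ C, Gm T (q + 1) k w ∈ C := by
    intro w hw
    have hpre : IsPreconnected (Gm T (q + 1) k '' C) := hCp.image _ (Gm_cont _ _).continuousOn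
    have hG : Gm T (q + 1) k p ∈ C := hpk
    have hsub := hpre.subset_connectedComponentIn (F := wall um up) ⟨p, hp, rfl⟩
      (by rintro _ ⟨w, hw, rfl⟩; exact R.sub ((R.Gm_mem _ _ _).2 (hCD hw)))
    have hG' := hG
    rw [hCd] at hG'
    rw [← connectedComponentIn_eq hG', ← hCd] at hsub
    exact hsub ⟨w, hw, rfl⟩
  have hord : (Prod.fst '' C).OrdConnected := (hCp.image _ continuous_fst.continuousOn).ordConnected
  have hav : ∀ m : ℤ, a + m ∉ Prod.fst '' C := by
    rintro m ⟨w, hw, e⟩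
    have := hCW hw
    simp only [wall, Set.mem_ofPred_eq, e, R.W.hm.per_int, R.W.hp.per_int] at this
    linarith
  have hj : ∀ w ∈ C, ∀ j : ℤ, w - ((j:ℝ), (0:ℝ)) ∈ C → j = 0 := by
    intro w hw j hwj
    have m1 : w.1 ∈ Prod.fst '' C := ⟨w, hw, rfl⟩
    have m2 : w.1 - j ∈ Prod.fst '' C := ⟨_, hwj, by simp⟩
    rcases lt_trichotomy j 0 with c | c | c
    · exfalso
      have c' : (j:ℝ) ≤ -1 := by exact_mod_cast (by omega : j ≤ -1)
      refine hav ⌊w.1 - j - a⌋ (hord.out m1 m2 ⟨?_, ?_⟩)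
      · linarith [Int.lt_floor_add_one (w.1 - j - a)]
      · linarith [Int.floor_le (w.1 - j - a)]
    · exact c
    · exfalso
      have c' : (1:ℝ) ≤ j := by exact_mod_cast (by omega : 1 ≤ j)
      refine hav ⌊w.1 - a⌋ (hord.out m2 m1 ⟨?_, ?_⟩)
      · linarith [Int.lt_floor_add_one (w.1 - a)]
      · linarith [Int.floor_le (w.1 - a)]
  obtain ⟨K, hK⟩ := homeo_iter T.F (q + 1)
  obtain ⟨h', hh'⟩ := homeo_iter h (q + 1)
  obtain ⟨H, hH⟩ : ∃ H : Pl ≃ₜ Pl, ∀ p, H p = Gm T (q + 1) k p :=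
    ⟨K.trans (Homeomorph.addRight (-((k:ℝ), (0:ℝ)))), fun p => by
      show K p + -((k:ℝ), (0:ℝ)) = _
      rw [hK, ← sub_eq_add_neg]; rfl⟩
  have hHf : ∀ p, pr (H p) = h' (pr p) := by
    intro p
    rw [hH, hh', ← iter_lift hf, pr_eq_iff]
    exact ⟨-k, by simp [Gm, sub_eq_add_neg]⟩
  have hHm : MeasurePreserving h' volume volume := by
    have : (h' : Ann → Ann) = h^[q + 1] := funext hh'
    rw [this]; exact hm.iterate _
  obtain ⟨M, hM⟩ := R.D_bdd
  have n1 := no_drift H h' hHf hHm hCo (fun p hp => hM p (hCD hp)) (fun p hp => by rw [hH]; exact hGC p hp) hj 1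
    (fun w hw hl => by
      simp only [hH, one_mul] at *
      exact R.Gm_lt q k (hCD hw) hl)
  have n2 := no_drift H h' hHf hHm hCo (fun p hp => hM p (hCD hp)) (fun p hp => by rw [hH]; exact hGC p hp) hj (-1)
    (fun w hw hl => by
      simp only [hH, neg_mul, one_mul, neg_lt_neg_iff] at *
      exact R.Gm_gt q k (hCD hw) hl)
  have n3 : ∀ z ∈ C, (Gm T (q + 1) k z).1 = z.1 := by
    intro z hz
    have a1 := n1 z hz
    have a2 := n2 z hz
    simp only [hH, neg_mul, one_mul, neg_lt_neg_iff, not_lt] at a1 a2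
    exact le_antisymm a1 a2
  obtain ⟨b, -, hb, -, e, -, l, -⟩ := near hCo hC0
  have := R.Gm_tw q k (hCD hb) (hCD hC0) e l
  rw [n3 b hb, n3 p0 hC0, e] at this
  exact lt_irrefl _ this

end Reg

end

section

lemma irr_approx {ρ δ : ℝ} (hρ : Irrational ρ) (hδ : 0 < δ) :
    ∃ q : ℕ, 0 < q ∧ ∃ k : ℤ, (k:ℝ) - δ < q * ρ ∧ q * ρ < k := by
  obtain ⟨n, hn⟩ := exists_nat_one_div_lt hδ
  obtain ⟨k, k0, -, hk⟩ := Real.exists_nat_abs_mul_sub_round_le ρ (Nat.succ_pos n)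
  have hk2 : |k * ρ - round (k * ρ)| < δ := by
    refine lt_of_le_of_lt hk (lt_trans ?_ hn)
    push_cast
    apply one_div_lt_one_div_of_lt <;> linarith [(Nat.cast_nonneg n : (0:ℝ) ≤ n)]
  have hirr : ∀ m : ℕ, 0 < m → ∀ j : ℤ, (m:ℝ) * ρ ≠ j := by
    intro m hm j h
    exact ((irrational_natCast_mul_iff (x := ρ)).2 ⟨hm.ne', hρ⟩).ne_int j h
  obtain ⟨j, hj⟩ : ∃ j : ℤ, j = round (k * ρ) := ⟨_, rfl⟩
  rw [← hj] at hk2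
  obtain ⟨d, hd⟩ : ∃ d : ℝ, d = k * ρ - j := ⟨_, rfl⟩
  rw [← hd] at hk2
  have d0 : d ≠ 0 := fun h => hirr k k0 j (by linarith)
  rcases lt_or_gt_of_ne d0 with h | h
  · refine ⟨k, k0, j, ?_, ?_⟩
    · rw [abs_of_neg h] at hk2; linarith
    · linarith
  · rw [abs_of_pos h] at hk2
    have m1 := Nat.floor_le (a := 1 / d) (by positivity)
    have m2 := Nat.lt_floor_add_one (1 / d)
    obtain ⟨m, hm⟩ : ∃ m : ℕ, m = ⌊1 / d⌋₊ := ⟨_, rfl⟩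
    rw [← hm] at m1 m2
    rw [le_div_iff₀ h] at m1
    rw [div_lt_iff₀ h] at m2
    have hd1 : d ≤ 1 / 2 := by
      have := abs_sub_round (k * ρ)
      rw [← hj, ← hd, abs_of_pos h] at this
      exact this
    have mpos : 0 < m := by
      rcases Nat.eq_zero_or_pos m with h0 | h0
      · rw [h0] at m2; norm_num at m2; linarith
      · exact h0
    refine ⟨m * k, Nat.mul_pos mpos k0, m * j + 1, ?_, ?_⟩
    · push_cast
      have : (m:ℝ) * k * ρ = m * d + m * j := by rw [hd]; ring
      linarith
    · have e : ((m * k : ℕ) : ℝ) * ρ = m * d + m * j := by rw [hd]; push_cast; ring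
      have := hirr (m * k) (Nat.mul_pos mpos k0) (m * j + 1)
      refine lt_of_le_of_ne ?_ this
      rw [e]; push_cast; linarith

open CircleDeg1Lift in
lemma circ_sep (f g : CircleDeg1Lift) (hf : Continuous f) (hg : Continuous g) {δ : ℝ} (hδ : 0 < δ)
    (h : ∀ x, f x + δ ≤ g x) : ∃ (q : ℕ) (k : ℤ) (x : ℝ), f^[q + 1] x < x + k ∧ x + k < g^[q + 1] x := by
  suffices ∃ (q : ℕ) (k : ℤ) (x : ℝ), 0 < q ∧ (f ^ q) x < x + k ∧ x + k < (g ^ q) x by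
    obtain ⟨q, k, x, hq, h1, h2⟩ := this
    obtain ⟨q, rfl⟩ := Nat.exists_eq_succ_of_ne_zero hq.ne'
    rw [coe_pow] at h1 h2
    exact ⟨q, k, x, h1, h2⟩
  have hfg : f ≤ g := fun x => by linarith [h x]
  have hd : ∀ q : ℕ, 0 < q → ∀ x, (f ^ q) x + δ ≤ (g ^ q) x := by
    intro q hq x
    obtain ⟨q, rfl⟩ := Nat.exists_eq_succ_of_ne_zero hq.ne'
    rw [Nat.succ_eq_add_one, pow_succ', pow_succ', mul_apply, mul_apply]
    have h1 : (f ^ q) x ≤ (g ^ q) x := pow_mono hfg q x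
    have h2 := g.monotone h1
    linarith [h ((f ^ q) x)]
  rcases (translationNumber_mono hfg).lt_or_eq with hlt | heq
  · obtain ⟨r, hr1, hr2⟩ := exists_rat_btwn hlt
    have hq : (0:ℝ) < r.den := by exact_mod_cast r.den_pos
    have hr : (r:ℝ) = r.num / r.den := Rat.cast_def r
    rw [hr, lt_div_iff₀ hq] at hr1
    rw [hr, div_lt_iff₀ hq] at hr2
    refine ⟨r.den, r.num, 0, r.den_pos, ?_, ?_⟩
    · apply map_lt_of_translationNumber_lt_int
      rw [translationNumber_pow]; linarith
    · apply lt_map_of_int_lt_translationNumber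
      rw [translationNumber_pow]; linarith
  · by_cases hirr : Irrational (translationNumber f)
    · obtain ⟨q, hq, k, h1, h2⟩ := irr_approx hirr hδ
      obtain ⟨x, hx⟩ := (f ^ q).exists_eq_add_translationNumber (f.continuous_pow hf q)
      rw [translationNumber_pow] at hx
      refine ⟨q, k, x, hq, by linarith, ?_⟩
      linarith [hd q hq x]
    · obtain ⟨r, hr⟩ : ∃ r : ℚ, (r:ℝ) = translationNumber f := by simpa [Irrational] using hirr
      have hq : (0:ℝ) < r.den := by exact_mod_cast r.den_pos
      have hr' : (r:ℝ) = r.num / r.den := Rat.cast_def r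
      have e : (r.den : ℝ) * translationNumber f = r.num := by rw [← hr, hr']; field_simp
      obtain ⟨a, ha⟩ := ((f ^ r.den).translationNumber_eq_int_iff (f.continuous_pow hf _)).1 (by rw [translationNumber_pow]; exact e)
      obtain ⟨b, hb⟩ := ((g ^ r.den).translationNumber_eq_int_iff (g.continuous_pow hg _)).1 (by rw [translationNumber_pow, ← heq]; exact e)
      have o1 : IsOpen {x | (f ^ r.den) x < x + r.num} := isOpen_lt (f.continuous_pow hf _) (by fun_prop)
      have o2 : IsOpen {x | x + r.num < (g ^ r.den) x} := isOpen_lt (by fun_prop) (g.continuous_pow hg _)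
      obtain ⟨x, -, hx1, hx2⟩ := isPreconnected_univ (α := ℝ) _ _ o1 o2 (by
        intro x _
        by_cases c : (f ^ r.den) x < x + r.num
        · exact Or.inl c
        · exact Or.inr (show x + r.num < (g ^ r.den) x by linarith [hd r.den r.den_pos x]))
        ⟨b, mem_univ _, show (f ^ r.den) b < b + r.num by linarith [hd r.den r.den_pos b]⟩
        ⟨a, mem_univ _, show a + r.num < (g ^ r.den) a by linarith [hd r.den r.den_pos a]⟩
      exact ⟨r.den, r.num, x, r.den_pos, hx1, hx2⟩

/-- circle lift attached to an invariant graph -/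
def EpiInv.lift {T : TH} {u : ℝ → ℝ} (h : EpiInv T u) : CircleDeg1Lift where
  toFun := bm T u
  monotone' := h.bm_mono.monotone
  map_add_one' := h.bm_per

/-- clamp between two numbers -/
def clp (a b y : ℝ) : ℝ := max a (min b y)

namespace Reg
variable {T : TH} {um up : ℝ → ℝ} {D : Set Pl}

lemma sep (R : Reg T um up D) (hlt : ∀ x, um x < up x) :
    ∃ (q : ℕ) (k : ℤ) (x : ℝ), (bm T um)^[q + 1] x < x + k ∧ x + k < (bm T up)^[q + 1] x := by
  have c1 := R.W.hm.bm_cont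
  have c2 := R.W.hp.bm_cont
  have hl : ∀ x, bm T um x < bm T up x := fun x => T.vert (p := (x, um x)) (q := (x, up x)) rfl (hlt x)
  have hper : Function.Periodic (fun x => bm T up x - bm T um x) 1 := fun x => by
    simp only [R.W.hm.bm_per, R.W.hp.bm_per]; ring
  obtain ⟨x0, -, hx0⟩ := isCompact_Icc.exists_isMinOn (nonempty_Icc.2 (zero_le_one (α := ℝ))) (c2.sub c1).continuousOn
  refine circ_sep R.W.hm.lift R.W.hp.lift c1 c2 (δ := bm T up x0 - bm T um x0) (by linarith [hl x0]) ?_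
  intro x
  obtain ⟨y, hy, e⟩ := hper.exists_mem_Ico₀ zero_lt_one x
  have := hx0 (Ico_subset_Icc_self hy)
  have h2 : bm T up x0 - bm T um x0 ≤ bm T up y - bm T um y := this
  have h3 : bm T up x - bm T um x = bm T up y - bm T um y := e
  show bm T um x + _ ≤ bm T up x
  linarith

lemma annulus (R : Reg T um up D) (hlt : ∀ x, um x < up x) (hD : ∀ p, p ∈ wall um up → p ∈ D) : False := by
  obtain ⟨q, k, xs, s1, s2⟩ := R.sep hlt
  have cm := R.W.hm.cont
  have cp := R.W.hp.cont
  obtain ⟨φ, hφ⟩ : ∃ φ : ℝ → ℝ → ℝ, ∀ x y, φ x y = (Gm T (q + 1) k (x, y)).1 - x := ⟨_, fun _ _ => rfl⟩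
  have φc : Continuous fun p : ℝ × ℝ => φ p.1 p.2 := by
    simp only [hφ]
    exact (continuous_fst.comp (Gm_cont (q + 1) k)).sub continuous_fst
  have φm : ∀ x, StrictMonoOn (φ x) (Icc (um x) (up x)) := by
    intro x a ha b hb hab
    have := R.tw q x ((um x + up x) / 2) (hD _ ⟨by show um x < _; linarith [hlt x], by show _ < up x; linarith [hlt x]⟩) ha hb hab
    simp only [hφ, Gm, Prod.fst_sub] at *
    linarith
  have φp : ∀ x y, φ (x + 1) y = φ x y := by
    intro x y
    have := congrArg Prod.fst (Gm_add (T := T) (q + 1) k 1 (x, y))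
    simp only [Int.cast_one, Prod.mk_add_mk, add_zero, Prod.fst_add] at this
    rw [hφ, hφ, this]; ring
  have φum : ∀ x, φ x (um x) = (bm T um)^[q + 1] x - k - x := by
    intro x; rw [hφ, Gm, R.W.hm.bm_iter]; simp
  have φup : ∀ x, φ x (up x) = (bm T up)^[q + 1] x - k - x := by
    intro x; rw [hφ, Gm, R.W.hp.bm_iter]; simp
  -- clamped extension
  have clm : ∀ x y, clp (um x) (up x) y ∈ Icc (um x) (up x) := fun x y =>
    ⟨le_max_left _ _, max_le (hlt x).le (min_le_left _ _)⟩
  have cl1 : ∀ x y, y ≤ um x → clp (um x) (up x) y = um x := fun x y h => by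
    unfold clp; exact max_eq_left ((min_le_right _ _).trans h)
  have cl2 : ∀ x y, up x ≤ y → clp (um x) (up x) y = up x := fun x y h => by
    unfold clp; rw [min_eq_left h]; exact max_eq_right (hlt x).le
  have cl3 : ∀ x y, um x ≤ y → y ≤ up x → clp (um x) (up x) y = y := fun x y h h' => by
    unfold clp; rw [min_eq_right h', max_eq_right h]
  obtain ⟨ψ, hψ⟩ : ∃ ψ : ℝ → ℝ → ℝ, ∀ x y, ψ x y = φ x (clp (um x) (up x) y) + (y - clp (um x) (up x) y) :=
    ⟨_, fun _ _ => rfl⟩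
  have clc : Continuous fun p : ℝ × ℝ => clp (um p.1) (up p.1) p.2 := by unfold clp; fun_prop
  have ψc : Continuous fun p : ℝ × ℝ => ψ p.1 p.2 := by
    simp only [hψ]
    exact (φc.comp (continuous_fst.prodMk clc)).add (continuous_snd.sub clc)
  have ψm : ∀ x, StrictMono (ψ x) := by
    intro x a b hab
    have h1 : clp (um x) (up x) a ≤ clp (um x) (up x) b := max_le_max le_rfl (min_le_min le_rfl hab.le)
    have h2 : a - clp (um x) (up x) a ≤ b - clp (um x) (up x) b := by
      rcases le_total a (um x) with ha | ha <;> rcases le_total b (um x) with hb | hb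
      · rw [cl1 x a ha, cl1 x b hb]; linarith
      · rw [cl1 x a ha]
        rcases le_total b (up x) with hb' | hb'
        · rw [cl3 x b hb hb']; linarith
        · rw [cl2 x b hb']; linarith
      · linarith
      · rcases le_total a (up x) with ha' | ha' <;> rcases le_total b (up x) with hb' | hb'
        · rw [cl3 x a ha ha', cl3 x b hb hb']; linarith
        · rw [cl3 x a ha ha', cl2 x b hb']; linarith
        · rw [cl2 x a ha', cl3 x b hb hb']; linarith
        · rw [cl2 x a ha', cl2 x b hb']; linarith
    rw [hψ, hψ]
    rcases h1.eq_or_lt with e | l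
    · rw [← e]; linarith
    · have := φm x (clm x a) (clm x b) l
      linarith
  have ψz : ∀ x, ∃ y, ψ x y = 0 := by
    intro x
    have hc : Continuous (ψ x) := ψc.comp (by fun_prop : Continuous fun y : ℝ => (x, y))
    obtain ⟨a, ha⟩ : ∃ a, ψ x a ≤ 0 := by
      refine ⟨um x - |φ x (um x)|, ?_⟩
      rw [hψ, cl1 x _ (by linarith [abs_nonneg (φ x (um x))])]
      linarith [le_abs_self (φ x (um x))]
    obtain ⟨b, hb⟩ : ∃ b, 0 ≤ ψ x b := by
      refine ⟨up x + |φ x (up x)|, ?_⟩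
      rw [hψ, cl2 x _ (by linarith [abs_nonneg (φ x (up x))])]
      linarith [neg_abs_le (φ x (up x))]
    exact mem_range_of_exists_le_of_exists_ge hc ⟨a, ha⟩ ⟨b, hb⟩
  choose r hr using ψz
  have rc : Continuous r := implicit_cont ψc ψm continuous_const hr
  have ψp : ∀ x y, ψ (x + 1) y = ψ x y := fun x y => by
    rw [hψ, hψ, φp, R.W.hm.per, R.W.hp.per]
  have rp : ∀ x, r (x + 1) = r x := fun x => (ψm x).injective (by rw [← ψp, hr, hr])
  have ψum : ∀ x, ψ x (um x) = φ x (um x) := fun x => by rw [hψ, cl1 x _ le_rfl]; ring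
  have ψup : ∀ x, ψ x (up x) = φ x (up x) := fun x => by rw [hψ, cl2 x _ le_rfl]; ring
  obtain ⟨c, hc⟩ : ∃ c : ℝ → ℝ, ∀ x, c x = clp (um x) (up x) (r x) := ⟨_, fun _ => rfl⟩
  have cc : Continuous c := by
    have : c = fun x => clp (um x) (up x) (r x) := funext hc
    rw [this]; unfold clp; fun_prop
  have cper : ∀ x, c (x + 1) = c x := fun x => by rw [hc, hc, rp, R.W.hm.per, R.W.hp.per]
  have char : ∀ x y, y = c x ↔ ((x, y) ∈ wall um up ∧ φ x y = 0) ∨ (y = um x ∧ 0 ≤ φ x y) ∨ (y = up x ∧ φ x y ≤ 0) := by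
    intro x y
    constructor
    · intro h
      have hz := hr x
      rw [hψ] at hz
      rw [hc] at h
      rcases le_or_gt (r x) (um x) with h1 | h1
      · right; left
        rw [cl1 x _ h1] at h hz
        refine ⟨h, ?_⟩
        rw [h]; linarith
      · rcases le_or_gt (up x) (r x) with h2 | h2
        · right; right
          rw [cl2 x _ h2] at h hz
          refine ⟨h, ?_⟩
          rw [h]; linarith
        · left
          rw [cl3 x _ h1.le h2.le] at h hz
          rw [h]
          exact ⟨⟨h1, h2⟩, by linarith⟩
    · rintro (⟨⟨h1, h2⟩, h3⟩ | ⟨rfl, h⟩ | ⟨rfl, h⟩)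
      · have h1 : um x < y := h1
        have h2 : y < up x := h2
        have : ψ x y = ψ x (r x) := by rw [hr, hψ, cl3 x y h1.le h2.le, h3]; ring
        rw [hc, ← (ψm x).injective this, cl3 x y h1.le h2.le]
      · have : r x ≤ um x := (ψm x).le_iff_le.1 (by rw [hr, ψum]; exact h)
        rw [hc, cl1 x _ this]
      · have : up x ≤ r x := (ψm x).le_iff_le.1 (by rw [hr, ψup]; exact h)
        rw [hc, cl2 x _ this]
  have bdry : ∀ u, EpiInv T u → ∀ p : Pl, p.2 = u p.1 →
      ((T.F p).1 = bm T u p.1 ∧ (Gm T (q + 1) k (T.F p)).1 = bm T u (Gm T (q + 1) k p).1) := by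
    intro u hu p hp
    have e : p = (p.1, u p.1) := Prod.ext rfl hp
    refine ⟨by have := congrArg (fun z => (T.F z).1) e; exact this, ?_⟩
    rw [Gm_F]
    have e2 : (Gm T (q + 1) k p).2 = u (Gm T (q + 1) k p).1 := by
      have e3 : Gm T (q + 1) k p = ((bm T u)^[q + 1] p.1, u ((bm T u)^[q + 1] p.1)) - ((k:ℝ), 0) := by
        rw [← hu.bm_iter, ← e]; rfl
      have e4 := hu.per_int ((bm T u)^[q + 1] p.1) (-k)
      rw [e3]
      simp only [Prod.fst_sub, Prod.snd_sub, sub_zero]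
      rw [← e4]; simp [sub_eq_add_neg]
    have e5 : Gm T (q + 1) k p = ((Gm T (q + 1) k p).1, u (Gm T (q + 1) k p).1) := Prod.ext rfl e2
    conv_lhs => rw [e5]
    rfl
  have hE : EpiInv T c := by
    refine EpiInv.of_graph cc cper fun p => ?_
    rw [char, char]
    simp only [Prod.mk.eta, hφ, sub_eq_zero, sub_nonneg, sub_nonpos, R.W.mem_F, R.W.hm.gr, R.W.hp.gr]
    refine or_congr (and_congr_right fun h => R.inv_eq_iff q k (hD _ h)) (or_congr (and_congr_right fun h => ?_)
      (and_congr_right fun h => ?_))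
    · obtain ⟨a, b⟩ := bdry um R.W.hm p h
      rw [a, b, R.W.hm.bm_mono.le_iff_le]
    · obtain ⟨a, b⟩ := bdry up R.W.hp p h
      rw [a, b, R.W.hp.bm_mono.le_iff_le]
  have l1 : um xs < r xs := (ψm xs).lt_iff_lt.1 (by rw [hr, ψum, φum]; linarith)
  have l2 : r xs < up xs := (ψm xs).lt_iff_lt.1 (by rw [hr, ψup, φup]; linarith)
  have l3 : c xs = r xs := by rw [hc, cl3 xs _ l1.le l2.le]
  exact R.W.no c hE xs (l3 ▸ l1) (l3 ▸ l2)

end Reg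

end

section

/-- saturation by connected subsets of the wall -/
def SatW (um up : ℝ → ℝ) (V : Set Ann) : Prop :=
  ∀ B : Set Pl, IsPreconnected B → B ⊆ wall um up → (∃ b ∈ B, pr b ∈ V) → pr '' B ⊆ V

lemma SatW.push {um up : ℝ → ℝ} {V : Set Ann} (h : SatW um up V) (G : Pl ≃ₜ Pl) (g : Ann ≃ₜ Ann)
    (hg : ∀ p, pr (G p) = g (pr p)) (hW : ∀ p, G p ∈ wall um up ↔ p ∈ wall um up) :
    SatW um up (g '' V) := by
  rintro B hB hBW ⟨b, hb, v, hv, e⟩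
  have hs : ∀ p, g (pr (G.symm p)) = pr p := fun p => by rw [← hg, G.apply_symm_apply]
  have := h (G.symm '' B) (hB.image _ G.symm.continuous.continuousOn) (by
    rintro _ ⟨p, hp, rfl⟩
    rw [← hW, G.apply_symm_apply]; exact hBW hp) ⟨_, ⟨b, hb, rfl⟩, by
      have : pr (G.symm b) = v := g.injective (by rw [hs, e])
      rw [this]; exact hv⟩
  rintro _ ⟨p, hp, rfl⟩
  exact ⟨_, this ⟨_, ⟨p, hp, rfl⟩, rfl⟩, hs p⟩

lemma SatW.iter {um up : ℝ → ℝ} {V : Set Ann} (h : SatW um up V) (G : Pl ≃ₜ Pl) (g : Ann ≃ₜ Ann)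
    (hg : ∀ p, pr (G p) = g (pr p)) (hW : ∀ p, G p ∈ wall um up ↔ p ∈ wall um up) (n : ℕ) :
    SatW um up (g^[n] '' V) := by
  induction n with
  | zero => simpa using h
  | succ n ih =>
    rw [iterate_succ', image_comp]
    exact ih.push G g hg hW

namespace IsotopySetup
variable {S : IsotopySetup}

lemma satW_sat (ht : S.PosTwist) (hpres : MeasurePreserving S.f volume volume) {U : Set Ann}
    {um up : ℝ → ℝ} (W : Wall (th ht hpres) um up) (h : SatW um up U) : SatW um up (sat S U) := by
  rintro B hB hBW ⟨b, hb, hbU⟩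
  simp only [sat, mem_iUnion] at hbU
  obtain ⟨i, hi⟩ := hbU
  have key : SatW um up (iterZ S.f i '' U) := by
    cases i with
    | ofNat n =>
      have := h.iter S.FH S.fH S.lift_f W.mem_F n
      rw [← iterZ_ofNat] at this
      exact this
    | negSucc n =>
      rw [iterZ_negSucc]
      refine h.iter S.FH.symm S.fH.symm lift_symm (fun p => ?_) (n + 1)
      have := W.mem_F (S.FH.symm p)
      rw [← this]
      show S.FH (S.FH.symm p) ∈ _ ↔ _
      rw [S.FH.apply_symm_apply]
  exact (key B hB hBW ⟨b, hb, hi⟩).trans (subset_iUnion (fun i => iterZ S.f i '' U) i)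

lemma ang_range (ht : S.PosTwist) (hpres : MeasurePreserving S.f volume volume) {p : Pl}
    (hA : ∀ N, -(1/2) ≤ S.aa N (pr p)) (n : ℕ) :
    -(1/2) < S.ang (n + 1) p 0 ∧ S.ang (n + 1) p 0 < 0 := by
  have hA' : ∀ N, -(1/2) ≤ S.ang N p 0 := fun N => by rw [← aa_pr]; exact hA N
  constructor
  · refine lt_of_le_of_ne (hA' _) fun e => ?_
    have h := hA' (n + 2)
    rw [ang_succ, ← e] at h
    have h2 := S.vth_int 1 (S.F^[n+1] p) 0 (-1)
    have h3 := (vth_first ht hpres (S.F^[n+1] p)).2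
    have e2 : (0:ℝ) + ((-1 : ℤ) : ℝ) / 2 = -(1/2) := by norm_num
    rw [e2] at h2
    rw [h2] at h
    push_cast at h
    linarith
  · rw [ang_succ]
    have h1 := (aa_bd ht hpres n (pr p)).2
    rw [aa_pr] at h1
    exact ((S.vth_mono 1 (S.F^[n] p)).monotone h1).trans_lt (vth_first ht hpres _).2

lemma key_neg (ht : S.PosTwist) (hpres : MeasurePreserving S.f volume volume) {U : Set Ann}
    {um up : ℝ → ℝ} {x0 y0 : ℝ} (W : Wall (th ht hpres) um up) (hU : IsOpen U)
    (hsub : sat S U ⊆ pr '' wall um up) (h0 : pr (x0, y0) ∈ U) (hs : SatW um up U) :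
    ∃ N, ∃ z ∈ sat S U, S.aa N z < -(1/2) := by
  by_contra! hA
  obtain ⟨D, hD⟩ : ∃ D : Set Pl, D = pr ⁻¹' (sat S U) := ⟨_, rfl⟩
  have hmD : ∀ p, p ∈ D ↔ pr p ∈ sat S U := fun p => by rw [hD]; rfl
  have hsW := satW_sat ht hpres W hs
  have hconn : ∀ B, IsPreconnected B → B ⊆ wall um up → (B ∩ D).Nonempty → B ⊆ D := by
    rintro B hB hBW ⟨b, hb, hbD⟩ p hp
    rw [hmD]
    exact hsW B hB hBW ⟨b, hb, (hmD b).1 hbD⟩ ⟨p, hp, rfl⟩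
  have hDW : D ⊆ wall um up := fun p hp => (W.mem_pr p).1 (hsub ((hmD p).1 hp))
  have R : Reg (th ht hpres) um up D := by
    refine ⟨W, ?_, hDW, ?_, ?_, hconn, ?_⟩
    · rw [hD]; exact (sat_open hU).preimage continuous_pr
    · intro p
      rw [hmD, hmD]
      show pr (S.Ft 1 p) ∈ _ ↔ _
      rw [S.lift_f]
      have := sat_inv (S := S) U
      exact Set.ext_iff.1 this (pr p)
    · intro p k
      rw [hmD, hmD, (pr_eq_iff (p + ((k:ℝ), 0)) p).2 ⟨k, rfl⟩]
    · intro n x y hxy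
      have hf : ∀ y' ∈ Ioo (um x) (up x), (x, y') ∈ D := by
        intro y' hy'
        exact hconn ((fun y => (x, y)) '' Ioo (um x) (up x)) (isPreconnected_Ioo.image _ (by fun_prop))
          (by rintro _ ⟨y, hy, rfl⟩; exact hy) ⟨(x, y), ⟨y, hDW hxy, rfl⟩, hxy⟩ ⟨y', hy', rfl⟩
      have hc := S.contDiff_iter (n + 1)
      refine strictMonoOn_of_deriv_pos (convex_Icc _ _) ?_ ?_
      · show ContinuousOn (fun y => (S.F^[n+1] (x, y)).1) _
        have := hc.continuous
        exact (continuous_fst.comp (this.comp (by fun_prop))).continuousOn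
      · intro y' hy'
        rw [interior_Icc] at hy'
        have hd := deriv_vert (x := x) (y := y') ((hc.differentiable (by norm_num)) (x, y')).hasFDerivAt
        show 0 < deriv (fun y => (S.F^[n+1] (x, y)).1) y'
        rw [hd.deriv]
        have hr := ang_range ht hpres (p := (x, y')) (fun N => hA N _ ((hmD _).1 (hf y' hy'))) n
        have ha := S.ang_isAng (n + 1) (x, y') (isAng_dirv 0)
        rw [dirv_zero] at ha
        exact ha.fst_pos hr.1 hr.2
  have hp0 : ((x0, y0) : Pl) ∈ D := (hmD _).2 (subset_sat _ h0)
  by_cases ha : ∃ a, um a = up a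
  · obtain ⟨a, ha⟩ := ha
    exact R.bubble S.fH S.lift_f hpres hp0 ha
  · push Not at ha
    have hlt : ∀ x, um x < up x := fun x => lt_of_le_of_ne (W.le x) (ha x)
    have hm1 : ∀ x, um x < (um x + up x) / 2 := fun x => by linarith [hlt x]
    have hm2 : ∀ x, (um x + up x) / 2 < up x := fun x => by linarith [hlt x]
    have hmid : ∀ x, (x, (um x + up x) / 2) ∈ D := by
      intro x
      have c1 := W.hm.cont
      have c2 := W.hp.cont
      have c : Continuous fun x => ((x, (um x + up x) / 2) : Pl) := by fun_prop
      refine hconn (range fun x => ((x, (um x + up x) / 2) : Pl)) (isPreconnected_range c) ?_ ?_ ⟨x, rfl⟩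
      · rintro _ ⟨t, rfl⟩; exact ⟨hm1 t, hm2 t⟩
      · exact ⟨_, ⟨x0, rfl⟩, R.fib hp0 (hm1 x0) (hm2 x0)⟩
    exact R.annulus hlt fun p hp => R.fib (hmid p.1) hp.1 hp.2

end IsotopySetup

/-- For a positive twist map preserving Lebesgue measure, every bounded
connected component `U` of the complement of the union `ℐ(f)` of all `f`-invariant essential
curves contains a set of positive measure of points with nonzero asymptotic torsion; moreover
the integral of the torsion over `⋃_{i∈ℤ} fⁱ(U)` is negative. -/
theorem statement4 (S : IsotopySetup) (htwist : S.PosTwist)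
    (hpres : MeasurePreserving S.f volume volume)
    (U : Set Ann) (hUbdd : Bornology.IsBounded U)
    (hUcc : ∃ z : Ann, z ∉ invCurveUnion S.f ∧ U = connectedComponentIn (invCurveUnion S.f)ᶜ z) :
    0 < volume {z ∈ U | ∃ L : ℝ, S.Torsion z L ∧ L ≠ 0} ∧
    ∫ z in ⋃ i : ℤ, iterZ S.f i '' U, S.torsionFun z ∂volume < 0 := by
  obtain ⟨um, up, x0, y0, W, -, -, hU, hV, hsub, h0, hs⟩ := IsotopySetup.setup htwist hpres hUbdd hUcc
  obtain ⟨N, z, hz, hN⟩ := IsotopySetup.key_neg htwist hpres W hU hsub h0 hs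
  exact IsotopySetup.final htwist hpres hU hV hz hN


end

end
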